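/- arXiv:2302.04718 — 2 statements merged into one kernel-verified Lean document; each statement's English description precedes it below -/
import Mathlib

section
/- Let q ∈ {4,8} and n ≥ 3. Every set of even type in PG(n,q) of size (q+2)q^{n−2} is a hypercylinder whose underlying hyperoval is a regular hyperoval. -/
open Submodule

/-- The points of the projective space `PG(n, K)`: the 1-dimensional
`K`-subspaces of `K^{n+1}`. -/
def PGPoint (K : Type*) [Field K] (n : ℕ) : Type _ :=
  {W : Submodule K (Fin (n + 1) → K) // Module.finrank K W = 1}

/-- The set of points of `PG(n, K)` lying in a given linear subspace. -/
def pts {K : Type*} [Field K] {n : ℕ} (W : Submodule K (Fin (n + 1) → K)) :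
    Set (PGPoint K n) :=
  {P | P.1 ≤ W}

/-- `S` is a `k`-dimensional projective subspace of `PG(n, K)`. -/
def IsKSpace {K : Type*} [Field K] {n : ℕ} (k : ℕ) (S : Set (PGPoint K n)) : Prop :=
  ∃ W : Submodule K (Fin (n + 1) → K), Module.finrank K W = k + 1 ∧ S = pts W

/-- A set of points is of even type if every line meets it in an even
number of points. -/
def IsEvenType {K : Type*} [Field K] {n : ℕ} (S : Set (PGPoint K n)) : Prop :=
  ∀ L : Set (PGPoint K n), IsKSpace 1 L → Even (S ∩ L).ncard

/-- `O` is a hyperoval in the plane `π`: a set of `q + 2` points of `π`,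
no three of which are collinear. -/
def IsHyperovalIn {K : Type*} [Field K] {n : ℕ}
    (π O : Set (PGPoint K n)) : Prop :=
  O ⊆ π ∧ O.ncard = Nat.card K + 2 ∧
    ∀ L : Set (PGPoint K n), IsKSpace 1 L → (O ∩ L).ncard ≤ 2

/-- A hypercylinder in `PG(n, K)`, `n ≥ 3`: the set
`(⋃_{P ∈ O} ⟨P, τ⟩) \ τ`, where `O` is a hyperoval in a plane `π` and the
vertex `τ` is an `(n-3)`-dimensional projective subspace (linear dimension
`n - 2`) disjoint from `π`.  (For `n = 3` the vertex is a point.) -/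
def IsHypercylinder {K : Type*} [Field K] {n : ℕ}
    (S : Set (PGPoint K n)) : Prop :=
  ∃ (Wπ T : Submodule K (Fin (n + 1) → K)) (O : Set (PGPoint K n)),
    Module.finrank K Wπ = 3 ∧ Module.finrank K T = n - 2 ∧ Wπ ⊓ T = ⊥ ∧
    IsHyperovalIn (pts Wπ) O ∧
    S = {Q : PGPoint K n | (∃ P ∈ O, Q.1 ≤ P.1 ⊔ T) ∧ ¬ Q.1 ≤ T}

/-- A hyperoval `O` (in a plane of `PG(n, K)`) is regular if it is the image,
under an injective linear (hence projectively linear) embedding of `K^3` into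
`K^{n+1}`, of the standard hyperoval
`{(s², st, t²) : (s,t) ∈ PG(1,q)} ∪ {(0,1,0)}` (a conic plus its nucleus). -/
def IsRegularHyperoval {K : Type*} [Field K] {n : ℕ}
    (O : Set (PGPoint K n)) : Prop :=
  ∃ g : (Fin 3 → K) →ₗ[K] (Fin (n + 1) → K), Function.Injective g ∧
    O = {P : PGPoint K n |
      (∃ s t : K, ¬(s = 0 ∧ t = 0) ∧
        P.1 = Submodule.span K {g ![s ^ 2, s * t, t ^ 2]}) ∨
      P.1 = Submodule.span K {g ![0, 1, 0]}}

/-- A hypercylinder whose underlying hyperoval is a regular hyperoval. -/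
def IsRegularHypercylinder {K : Type*} [Field K] {n : ℕ}
    (S : Set (PGPoint K n)) : Prop :=
  ∃ (Wπ T : Submodule K (Fin (n + 1) → K)) (O : Set (PGPoint K n)),
    Module.finrank K Wπ = 3 ∧ Module.finrank K T = n - 2 ∧ Wπ ⊓ T = ⊥ ∧
    IsHyperovalIn (pts Wπ) O ∧ IsRegularHyperoval O ∧
    S = {Q : PGPoint K n | (∃ P ∈ O, Q.1 ≤ P.1 ⊔ T) ∧ ¬ Q.1 ≤ T}


section Infra
set_option linter.unusedSectionVars false
open Classical Module Submodule
variable {K V : Type*} [Field K] [AddCommGroup V] [Module K V] [Fintype V]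
  [Fintype (Submodule K V)]

/-- Subspaces of linear dimension `k` between `W` and `U`. -/
noncomputable def Gr (k : ℕ) (W U : Submodule K V) : Finset (Submodule K V) :=
  Finset.univ.filter (fun X => W ≤ X ∧ X ≤ U ∧ finrank K X = k)

/-- Number of points of `S` in `W`. -/
noncomputable def NN (S : Finset (Submodule K V)) (W : Submodule K V) : ℕ :=
  (S.filter (fun P => P ≤ W)).card

lemma mem_Gr {k : ℕ} {W U X : Submodule K V} :
    X ∈ Gr k W U ↔ W ≤ X ∧ X ≤ U ∧ finrank K X = k := by
  simp [Gr]

lemma fr_span_sup {W : Submodule K V} {v : V} (hv : v ∉ W) :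
    finrank K (W ⊔ span K {v} : Submodule K V) = finrank K W + 1 := by
  have hv0 : v ≠ 0 := by rintro rfl; exact hv W.zero_mem
  have h := Submodule.finrank_sup_add_finrank_inf_eq W (span K {v})
  have h2 : W ⊓ span K {v} = ⊥ := by
    rw [eq_bot_iff]
    rintro x ⟨hx1, hx2⟩
    obtain ⟨c, rfl⟩ := mem_span_singleton.1 hx2
    by_cases hc : c = 0
    · simp [hc]
    · exact absurd ((W.smul_mem_iff hc).1 hx1) hv
  rw [h2, finrank_bot, finrank_span_singleton hv0] at h
  omega

lemma pt_exists {P : Submodule K V} (hP : finrank K P = 1) :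
    ∃ v : V, v ≠ 0 ∧ P = span K {v} := by
  obtain ⟨v, hv, h⟩ := finrank_eq_one_iff'.1 hP
  refine ⟨v, by simpa using hv, le_antisymm ?_ ?_⟩
  · intro x hx
    obtain ⟨c, hc⟩ := h ⟨x, hx⟩
    exact mem_span_singleton.2 ⟨c, by simpa using congrArg Subtype.val hc⟩
  · rw [span_singleton_le_iff_mem]; exact v.2

lemma fr_sup_pt {W P : Submodule K V} (hP : finrank K P = 1) (h : ¬ P ≤ W) :
    finrank K (W ⊔ P : Submodule K V) = finrank K W + 1 := by
  obtain ⟨v, hv, rfl⟩ := pt_exists hP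
  exact fr_span_sup (by rwa [span_singleton_le_iff_mem] at h)

lemma eq_of_le_fr {W U : Submodule K V} (h : W ≤ U) (hr : finrank K U ≤ finrank K W) : W = U :=
  Submodule.eq_of_le_of_finrank_le h hr

lemma card_vec (W : Submodule K V) :
    (Finset.univ.filter (fun v : V => v ∈ W)).card = Nat.card K ^ finrank K W := by
  rw [← Module.natCard_eq_pow_finrank (K := K) (V := W), Nat.card_eq_fintype_card,
    Fintype.card_subtype]

lemma card_vec_diff {W U : Submodule K V} (h : W ≤ U) :
    (Finset.univ.filter (fun v : V => v ∈ U ∧ v ∉ W)).card + Nat.card K ^ finrank K W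
      = Nat.card K ^ finrank K U := by
  rw [← card_vec W, ← card_vec U, ← Finset.card_union_of_disjoint]
  · congr 1
    ext v
    simp only [Finset.mem_union, Finset.mem_filter, Finset.mem_univ, true_and]
    have := @h v
    tauto
  · rw [Finset.disjoint_left]; intro v; simp

lemma card_Gr_aux {W U : Submodule K V} (h : W ≤ U) :
    (Finset.univ.filter (fun v : V => v ∈ U ∧ v ∉ W)).card =
    (Gr (finrank K W + 1) W U).card * (Nat.card K ^ (finrank K W + 1) - Nat.card K ^ finrank K W) := by
  rw [Finset.card_eq_sum_card_fiberwise (f := fun v => W ⊔ span K {v}) (t := Gr (finrank K W + 1) W U)]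
  · rw [Finset.sum_const_nat (m := Nat.card K ^ (finrank K W + 1) - Nat.card K ^ finrank K W)]
    intro X hX
    obtain ⟨h1, h2, h3⟩ := mem_Gr.1 hX
    have := card_vec_diff h1
    rw [h3] at this
    rw [← this, Nat.add_sub_cancel]
    congr 1
    ext v
    simp only [Finset.mem_filter, Finset.mem_univ, true_and]
    constructor
    · rintro ⟨⟨_, hv⟩, rfl⟩
      exact ⟨mem_sup_right (mem_span_singleton_self v), hv⟩
    · rintro ⟨hv, hv'⟩
      refine ⟨⟨h2 hv, hv'⟩, ?_⟩
      apply eq_of_le_fr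
      · exact sup_le h1 (by rwa [span_singleton_le_iff_mem])
      · rw [fr_span_sup hv', h3]
  · intro v hv
    simp only [Finset.coe_filter, Finset.mem_univ, true_and, Set.mem_ofPred_eq] at hv
    simp only [SetLike.mem_coe, mem_Gr]
    exact ⟨le_sup_left, sup_le h (by rw [span_singleton_le_iff_mem]; exact hv.1), fr_span_sup hv.2⟩

/-- Counting the subspaces one dimension above `W` inside `U`. -/
lemma card_Gr [Finite K] {W U : Submodule K V} {k d : ℕ} (h : W ≤ U) (hW : finrank K W = k)
    (hU : finrank K U = k + d) :
    (Gr (k + 1) W U).card * (Nat.card K - 1) + 1 = Nat.card K ^ d := by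
  have h1 := card_Gr_aux h
  have h2 := card_vec_diff h
  rw [hW] at h1 h2
  rw [hU] at h2
  have hq : 0 < Nat.card K := Nat.card_pos
  set q := Nat.card K
  have hk : 0 < q ^ k := by positivity
  have h3 : q ^ (k+1) - q ^ k = q ^ k * (q - 1) := by
    rw [pow_succ, Nat.mul_sub, mul_one]
  rw [h3] at h1
  rw [h1, pow_add] at h2
  apply Nat.eq_of_mul_eq_mul_left hk
  rw [← h2]; ring

lemma sum_Gr {S : Finset (Submodule K V)} (hS : ∀ P ∈ S, finrank K P = 1)
    {W U : Submodule K V} {k : ℕ} (h : W ≤ U) (hW : finrank K W = k) :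
    ∑ X ∈ Gr (k + 1) W U, NN S X + NN S W = NN S U + (Gr (k + 1) W U).card * NN S W := by
  subst hW
  have key : ∀ X, W ≤ X → NN S X = (S.filter (fun P => P ≤ X ∧ ¬ P ≤ W)).card + NN S W := by
    intro X hX
    unfold NN
    rw [← Finset.card_union_of_disjoint]
    · congr 1
      ext P
      simp only [Finset.mem_union, Finset.mem_filter]
      have : P ≤ W → P ≤ X := fun h => h.trans hX
      tauto
    · rw [Finset.disjoint_left]; intro P; simp; tauto
  rw [key U h, Finset.sum_congr rfl (fun X hX => key X (mem_Gr.1 hX).1), Finset.sum_add_distrib,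
    Finset.sum_const, smul_eq_mul]
  have : (S.filter (fun P => P ≤ U ∧ ¬ P ≤ W)).card
      = ∑ X ∈ Gr (finrank K W + 1) W U, (S.filter (fun P => P ≤ X ∧ ¬ P ≤ W)).card := by
    rw [Finset.card_eq_sum_card_fiberwise (f := fun P => W ⊔ P) (t := Gr (finrank K W + 1) W U)]
    · apply Finset.sum_congr rfl
      intro X hX
      obtain ⟨h1, h2, h3⟩ := mem_Gr.1 hX
      congr 1
      ext P
      simp only [Finset.mem_filter]
      constructor
      · rintro ⟨⟨a, b, c⟩, rfl⟩
        exact ⟨a, le_sup_right, c⟩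
      · rintro ⟨a, b, c⟩
        refine ⟨⟨a, b.trans h2, c⟩, ?_⟩
        apply eq_of_le_fr (sup_le h1 b)
        rw [fr_sup_pt (hS P a) c, h3]
    · intro P hP
      simp only [Finset.coe_filter, Set.mem_ofPred_eq] at hP
      simp only [SetLike.mem_coe, mem_Gr]
      exact ⟨le_sup_left, sup_le h hP.2.1, fr_sup_pt (hS P hP.1) hP.2.2⟩
  rw [this]; ring

end Infra


section Infra2
set_option linter.unusedSectionVars false
set_option linter.unusedVariables false
open Classical Module Submodule
variable {K V : Type*} [Field K] [Finite K] [AddCommGroup V] [Module K V] [Fintype V]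
  [Fintype (Submodule K V)]

/-- Sets of even type, as finsets of one-dimensional subspaces. -/
structure EvenSet (S : Finset (Submodule K V)) : Prop where
  pt : ∀ P ∈ S, finrank K P = 1
  even : ∀ L : Submodule K V, finrank K L = 2 → Even (NN S L)

lemma two_le_q : 2 ≤ Nat.card K := Finite.one_lt_card

lemma card_Gr2 {W U : Submodule K V} {k : ℕ} (h : W ≤ U) (hW : finrank K W = k)
    (hU : finrank K U = k + 2) : (Gr (k + 1) W U).card = Nat.card K + 1 := by
  have h1 := card_Gr h hW hU
  have h2 : 2 ≤ Nat.card K := two_le_q (K := K)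
  obtain ⟨m, hm⟩ : ∃ m, Nat.card K = m + 2 := ⟨Nat.card K - 2, by omega⟩
  rw [hm] at h1 ⊢
  have : m + 2 - 1 = m + 1 := by omega
  rw [this] at h1
  apply Nat.eq_of_mul_eq_mul_right (Nat.succ_pos m)
  simp only [Nat.succ_eq_add_one]
  nlinarith

lemma card_Gr3 {W U : Submodule K V} {k : ℕ} (h : W ≤ U) (hW : finrank K W = k)
    (hU : finrank K U = k + 3) :
    (Gr (k + 1) W U).card = Nat.card K ^ 2 + Nat.card K + 1 := by
  have h1 := card_Gr h hW hU
  have h2 : 2 ≤ Nat.card K := two_le_q (K := K)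
  obtain ⟨m, hm⟩ : ∃ m, Nat.card K = m + 2 := ⟨Nat.card K - 2, by omega⟩
  rw [hm] at h1 ⊢
  have : m + 2 - 1 = m + 1 := by omega
  rw [this] at h1
  apply Nat.eq_of_mul_eq_mul_right (Nat.succ_pos m)
  simp only [Nat.succ_eq_add_one]
  nlinarith

/-- Double counting of flags. -/
lemma flag_count {α β : Type*} (A : Finset α) (B : Finset β) (R : α → β → Prop) :
    ∑ a ∈ A, (B.filter (fun b => R a b)).card = ∑ b ∈ B, (A.filter (fun a => R a b)).card := by
  simp only [Finset.card_filter]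
  exact Finset.sum_comm

lemma card_Gr3' {W U : Submodule K V} {k : ℕ} (h : W ≤ U) (hW : finrank K W = k)
    (hU : finrank K U = k + 3) :
    (Gr (k + 2) W U).card = Nat.card K ^ 2 + Nat.card K + 1 := by
  have h1 := flag_count (Gr (k + 1) W U) (Gr (k + 2) W U) (fun X Y => X ≤ Y)
  have h2 : ∀ X ∈ Gr (k + 1) W U,
      ((Gr (k + 2) W U).filter (fun Y => X ≤ Y)).card = Nat.card K + 1 := by
    intro X hX
    obtain ⟨a, b, c⟩ := mem_Gr.1 hX
    rw [← card_Gr2 b c (by omega)]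
    congr 1
    ext Y
    simp only [Finset.mem_filter, mem_Gr]
    constructor
    · tauto
    · rintro ⟨d, e, f⟩; exact ⟨⟨a.trans d, e, f⟩, d⟩
  have h3 : ∀ Y ∈ Gr (k + 2) W U,
      ((Gr (k + 1) W U).filter (fun X => X ≤ Y)).card = Nat.card K + 1 := by
    intro X hX
    obtain ⟨a, b, c⟩ := mem_Gr.1 hX
    rw [← card_Gr2 a hW c]
    congr 1
    ext Y
    simp only [Finset.mem_filter, mem_Gr]
    constructor
    · tauto
    · rintro ⟨d, e, f⟩; exact ⟨⟨d, e.trans b, f⟩, e⟩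
  rw [Finset.sum_const_nat h2, Finset.sum_const_nat h3, card_Gr3 h hW hU] at h1
  exact (Nat.eq_of_mul_eq_mul_right (Nat.succ_pos _) h1).symm

lemma fr_inf {A B U : Submodule K V} (hA : A ≤ U) (hB : B ≤ U)
    (hU : finrank K U = finrank K B + 1) (h : ¬ A ≤ B) :
    finrank K (A ⊓ B : Submodule K V) + 1 = finrank K A := by
  have h1 := Submodule.finrank_sup_add_finrank_inf_eq A B
  have h2 : finrank K (A ⊔ B : Submodule K V) ≤ finrank K U := Submodule.finrank_mono (sup_le hA hB)
  have h3 : finrank K B < finrank K (A ⊔ B : Submodule K V) := by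
    apply Submodule.finrank_lt_finrank_of_lt
    refine lt_of_le_of_ne le_sup_right fun e => h ?_
    rw [e]; exact le_sup_left
  omega

lemma pt_eq {P Q : Submodule K V} (hP : finrank K P = 1) (hQ : finrank K Q = 1) (h : P ≤ Q) :
    P = Q := eq_of_le_fr h (by omega)

lemma fr_line {P Q : Submodule K V} (hP : finrank K P = 1) (hQ : finrank K Q = 1) (h : P ≠ Q) :
    finrank K (P ⊔ Q : Submodule K V) = 2 := by
  rw [fr_sup_pt hQ (fun e => h (pt_eq hQ hP e).symm), hP]

lemma line_eq {P Q L : Submodule K V} (hP : finrank K P = 1) (hQ : finrank K Q = 1) (h : P ≠ Q)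
    (hL : finrank K L = 2) (hPL : P ≤ L) (hQL : Q ≤ L) : P ⊔ Q = L :=
  eq_of_le_fr (sup_le hPL hQL) (by rw [fr_line hP hQ h, hL])

lemma le_NN_of_subset {S F : Finset (Submodule K V)} {W : Submodule K V}
    (h : ∀ P ∈ F, P ∈ S ∧ P ≤ W) : F.card ≤ NN S W :=
  Finset.card_le_card fun P hP => Finset.mem_filter.2 (h P hP)

lemma NN_pos {S : Finset (Submodule K V)} {W P : Submodule K V} (hP : P ∈ S) (h : P ≤ W) :
    1 ≤ NN S W :=
  Finset.card_pos.2 ⟨P, Finset.mem_filter.2 ⟨hP, h⟩⟩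

lemma exists_of_NN {S : Finset (Submodule K V)} {W : Submodule K V} (h : 1 ≤ NN S W) :
    ∃ P ∈ S, P ≤ W := by
  obtain ⟨P, hP⟩ := Finset.card_pos.1 h
  exact ⟨P, (Finset.mem_filter.1 hP).1, (Finset.mem_filter.1 hP).2⟩

namespace EvenSet
variable {S : Finset (Submodule K V)}

lemma NN_mem (hS : EvenSet S) {P : Submodule K V} (h : P ∈ S) : NN S P = 1 := by
  unfold NN
  rw [Finset.card_eq_one]
  refine ⟨P, ?_⟩
  ext Q
  simp only [Finset.mem_filter, Finset.mem_singleton]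
  constructor
  · rintro ⟨a, b⟩; exact pt_eq (hS.pt Q a) (hS.pt P h) b
  · rintro rfl; exact ⟨h, le_rfl⟩

lemma NN_not_mem (hS : EvenSet S) {P : Submodule K V} (hP : finrank K P = 1) (h : P ∉ S) : NN S P = 0 := by
  unfold NN
  rw [Finset.card_eq_zero, Finset.filter_eq_empty_iff]
  intro Q hQ hle
  rw [pt_eq (hS.pt Q hQ) hP hle] at hQ
  exact h hQ

lemma line_ge2 (hS : EvenSet S) {P L : Submodule K V} (h : P ∈ S) (hPL : P ≤ L) (hL : finrank K L = 2) :
    2 ≤ NN S L := by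
  obtain ⟨m, hm⟩ := hS.even L hL
  have := NN_pos h hPL
  omega

/-- Excess formula from a point of the set. -/
lemma ex_sum (hS : EvenSet S) {P U : Submodule K V} (h : P ∈ S) (hPU : P ≤ U) :
    ∑ L ∈ Gr 2 P U, (NN S L - 2) + (Gr 2 P U).card + 1 = NN S U := by
  have h1 := sum_Gr hS.pt hPU (hS.pt P h)
  have h2 : ∑ L ∈ Gr 2 P U, NN S L = ∑ L ∈ Gr 2 P U, (NN S L - 2) + (Gr 2 P U).card * 2 := by
    rw [← smul_eq_mul (Gr 2 P U).card 2, ← Finset.sum_const, ← Finset.sum_add_distrib]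
    apply Finset.sum_congr rfl
    intro L hL
    obtain ⟨a, b, c⟩ := mem_Gr.1 hL
    have := hS.line_ge2 h a c
    omega
  rw [hS.NN_mem h] at h1
  simp only [Nat.reduceAdd] at h1
  rw [h2] at h1
  omega

lemma out_sum (hS : EvenSet S) {P U : Submodule K V} (hP : finrank K P = 1) (h : P ∉ S) (hPU : P ≤ U) :
    ∑ L ∈ Gr 2 P U, NN S L = NN S U := by
  have h1 := sum_Gr hS.pt hPU hP
  rw [hS.NN_not_mem hP h] at h1
  simpa using h1

lemma ex_plane (hS : EvenSet S) {P U : Submodule K V} (h : P ∈ S) (hPU : P ≤ U) (hU : finrank K U = 3) :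
    ∑ L ∈ Gr 2 P U, (NN S L - 2) + Nat.card K + 2 = NN S U := by
  have := hS.ex_sum h hPU
  rw [card_Gr2 hPU (hS.pt P h) hU] at this
  omega

lemma ex_solid (hS : EvenSet S) {P U : Submodule K V} (h : P ∈ S) (hPU : P ≤ U) (hU : finrank K U = 4) :
    ∑ L ∈ Gr 2 P U, (NN S L - 2) + Nat.card K ^ 2 + Nat.card K + 2 = NN S U := by
  have := hS.ex_sum h hPU
  rw [card_Gr3 hPU (hS.pt P h) hU] at this
  omega

lemma plane_ge (hS : EvenSet S) {P U : Submodule K V} (h : P ∈ S) (hPU : P ≤ U) (hU : finrank K U = 3) :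
    Nat.card K + 2 ≤ NN S U := by
  have := hS.ex_plane h hPU hU
  omega

lemma ex_one (hS : EvenSet S) {P U L : Submodule K V} (hL : L ∈ Gr 2 P U) :
    NN S L - 2 ≤ ∑ L ∈ Gr 2 P U, (NN S L - 2) :=
  Finset.single_le_sum (f := fun L => NN S L - 2) (fun _ _ => Nat.zero_le _) hL

lemma ex_two (hS : EvenSet S) {P U L M : Submodule K V} (hL : L ∈ Gr 2 P U) (hM : M ∈ Gr 2 P U) (h : L ≠ M) :
    (NN S L - 2) + (NN S M - 2) ≤ ∑ L ∈ Gr 2 P U, (NN S L - 2) := by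
  rw [← Finset.sum_pair (f := fun L => NN S L - 2) h]
  apply Finset.sum_le_sum_of_subset
  intro x hx
  simp only [Finset.mem_insert, Finset.mem_singleton] at hx
  rcases hx with rfl | rfl <;> assumption

lemma ex_mono (hS : EvenSet S) {P U W : Submodule K V} (h : W ≤ U) :
    ∑ L ∈ Gr 2 P W, (NN S L - 2) ≤ ∑ L ∈ Gr 2 P U, (NN S L - 2) := by
  apply Finset.sum_le_sum_of_subset
  intro L hL
  obtain ⟨a, b, c⟩ := mem_Gr.1 hL
  exact mem_Gr.2 ⟨a, b.trans h, c⟩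

lemma filter_sub (hS : EvenSet S) {L : Submodule K V} : S.filter (fun P => P ≤ L) ⊆ Gr 1 ⊥ L := by
  intro P hP
  rw [Finset.mem_filter] at hP
  exact mem_Gr.2 ⟨bot_le, hP.2, hS.pt P hP.1⟩

/-- On a `q`-secant with hole `v`, all other points are in `S`. -/
lemma qsec_mem (hS : EvenSet S) {L v R : Submodule K V} (hL : finrank K L = 2) (hN : NN S L = Nat.card K)
    (hv : finrank K v = 1) (hvL : v ≤ L) (hvS : v ∉ S) (hR : finrank K R = 1) (hRL : R ≤ L)
    (hne : R ≠ v) : R ∈ S := by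
  have h1 : S.filter (fun P => P ≤ L) = (Gr 1 ⊥ L).erase v := by
    apply Finset.eq_of_subset_of_card_le
    · intro P hP
      refine Finset.mem_erase.2 ⟨?_, hS.filter_sub hP⟩
      rintro rfl
      exact hvS (Finset.mem_filter.1 hP).1
    · rw [Finset.card_erase_of_mem (mem_Gr.2 ⟨bot_le, hvL, hv⟩),
        card_Gr2 (k := 0) bot_le (by simp) (by omega)]
      simp only [NN] at hN
      omega
  have h2 : R ∈ (Gr 1 ⊥ L).erase v := Finset.mem_erase.2 ⟨hne, mem_Gr.2 ⟨bot_le, hRL, hR⟩⟩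
  rw [← h1] at h2
  exact (Finset.mem_filter.1 h2).1

lemma qsec_hole (hS : EvenSet S) {L : Submodule K V} (hL : finrank K L = 2) (hN : NN S L = Nat.card K) :
    ∃ v : Submodule K V, finrank K v = 1 ∧ v ≤ L ∧ v ∉ S := by
  by_contra! hcon
  have h1 : Gr 1 ⊥ L ⊆ S.filter (fun P => P ≤ L) := by
    intro P hP
    obtain ⟨a, b, c⟩ := mem_Gr.1 hP
    exact Finset.mem_filter.2 ⟨hcon P c b, b⟩
  have h2 := Finset.card_le_card h1
  rw [card_Gr2 (k := 0) bot_le (by simp) (by omega)] at h2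
  simp only [NN] at hN
  omega

end EvenSet

/-- `v` is the vertex of the cone `S ∩ U`. -/
def IsVertex (S : Finset (Submodule K V)) (U v : Submodule K V) : Prop :=
  finrank K v = 1 ∧ v ≤ U ∧ v ∉ S ∧ ∀ P ∈ S, P ≤ U → NN S (P ⊔ v) = Nat.card K

namespace EvenSet
variable {S : Finset (Submodule K V)}

lemma other_two (hS : EvenSet S) {U P L M : Submodule K V} (hU : finrank K U = 4)
    (hN : NN S U = Nat.card K ^ 2 + 2 * Nat.card K) (hP : P ∈ S)
    (hL : finrank K L = 2) (hPL : P ≤ L) (hLU : L ≤ U) (hNL : NN S L = Nat.card K)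
    (hM : finrank K M = 2) (hPM : P ≤ M) (hMU : M ≤ U) (hne : M ≠ L) : NN S M = 2 := by
  have h1 := hS.ex_solid hP (hPL.trans hLU) hU
  have h2 := hS.ex_two (mem_Gr.2 ⟨hPL, hLU, hL⟩) (mem_Gr.2 ⟨hPM, hMU, hM⟩) hne.symm
  have h3 := hS.line_ge2 hP hPM hM
  have h4 := hS.line_ge2 hP hPL hL
  omega

lemma vertex_of_qsec (hS : EvenSet S) {U L : Submodule K V} (hU : finrank K U = 4)
    (hN : NN S U = Nat.card K ^ 2 + 2 * Nat.card K)
    (hL : finrank K L = 2) (hLU : L ≤ U) (hNL : NN S L = Nat.card K) :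
    ∃ v, IsVertex S U v := by
  have hq : 2 ≤ Nat.card K := two_le_q (K := K)
  obtain ⟨v, hv, hvL, hvS⟩ := hS.qsec_hole hL hNL
  refine ⟨v, hv, hvL.trans hLU, hvS, fun P hP hPU => ?_⟩
  have hPv : P ≠ v := by rintro rfl; exact hvS hP
  by_cases hPL : P ≤ L
  · rwa [line_eq (hS.pt P hP) hv hPv hL hPL hvL]
  have hπ : finrank K (L ⊔ P : Submodule K V) = 3 := by rw [fr_sup_pt (hS.pt P hP) hPL, hL]
  obtain ⟨P0, hP0, hP0L⟩ := exists_of_NN (S := S) (W := L) (by omega)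
  have hπU : L ⊔ P ≤ U := sup_le hLU hPU
  have h1 := hS.ex_plane hP0 (hP0L.trans le_sup_left : P0 ≤ L ⊔ P) hπ
  rw [Finset.sum_eq_single_of_mem L (mem_Gr.2 ⟨hP0L, le_sup_left, hL⟩)] at h1
  · have h2 := hS.ex_plane hP (le_sup_right : P ≤ L ⊔ P) hπ
    have hPvr := fr_line (hS.pt P hP) hv hPv
    rw [Finset.sum_eq_single_of_mem (P ⊔ v)
      (mem_Gr.2 ⟨le_sup_left, sup_le le_sup_right (hvL.trans le_sup_left), hPvr⟩)] at h2
    · have h3 := hS.line_ge2 hP (le_sup_left : P ≤ P ⊔ v) hPvr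
      omega
    · intro M hM hne
      obtain ⟨a, b, c⟩ := mem_Gr.1 hM
      have hML : ¬ M ≤ L := fun h => hPL (a.trans h)
      have hR : finrank K (M ⊓ L : Submodule K V) = 1 := by
        have := fr_inf b (le_sup_left : L ≤ L ⊔ P) (by omega) hML
        omega
      have hRv : M ⊓ L ≠ v := by
        intro e
        apply hne
        rw [line_eq (hS.pt P hP) hv hPv c a (e ▸ inf_le_left)]
      have hRS := hS.qsec_mem hL hNL hv hvL hvS hR inf_le_right hRv
      rw [hS.other_two hU hN hRS hL inf_le_right hLU hNL c inf_le_left (b.trans hπU)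
        (fun e => hML e.le), Nat.sub_self]
  · intro M hM hne
    obtain ⟨a, b, c⟩ := mem_Gr.1 hM
    rw [hS.other_two hU hN hP0 hL hP0L hLU hNL c a (b.trans hπU) hne, Nat.sub_self]

end EvenSet
end Infra2


section Solid8
set_option linter.unusedSectionVars false
set_option linter.unusedVariables false
open Classical Module Submodule
variable {K V : Type*} [Field K] [Finite K] [AddCommGroup V] [Module K V] [Fintype V]
  [Fintype (Submodule K V)]

namespace EvenSet
variable {S : Finset (Submodule K V)}

/-- A plane section with 14 points has no 6-secant (`q = 8`). -/
lemma claim6 (hS : EvenSet S) (hq : Nat.card K = 8) {π L M v w : Submodule K V}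
    (hπ : finrank K π = 3) (hN : NN S π = 14) (hL : finrank K L = 2) (hLπ : L ≤ π)
    (hNL : NN S L = 6) (hM : finrank K M = 2) (hMπ : M ≤ π) (hNM : 4 ≤ NN S M)
    (hv : finrank K v = 1) (hvS : v ∉ S) (hvL : v ≤ L) (hvM : ¬ v ≤ M)
    (hML : M ⊓ L = w) (hw : w ∉ S) :
    NN S M ≤ 4 ∧ ∀ A : Submodule K V, finrank K A = 2 → A ≤ π → v ≤ A → A ≠ L → NN S A ≤ 2 := by
  have h1 := hS.out_sum hv hvS (hvL.trans hLπ)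
  have hLG : L ∈ Gr 2 v π := mem_Gr.2 ⟨hvL, hLπ, hL⟩
  rw [← Finset.add_sum_erase _ _ hLG, hN, hNL] at h1
  set J := (Gr 2 v π).erase L with hJ
  set I := (S.filter (fun P => P ≤ M)).image (fun P => P ⊔ v) with hI
  have hIc : I.card = NN S M := by
    rw [hI, Finset.card_image_of_injOn]
    · rfl
    intro P hP Q hQ (e : P ⊔ v = Q ⊔ v)
    have hP' := Finset.mem_filter.1 hP
    have hQ' := Finset.mem_filter.1 hQ
    by_contra hne
    apply hvM
    have hPv : P ≠ v := by rintro rfl; exact hvS hP'.1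
    have h2 := line_eq (hS.pt P hP'.1) (hS.pt Q hQ'.1) hne hM hP'.2 hQ'.2
    have h3 := line_eq (hS.pt P hP'.1) (hS.pt Q hQ'.1) hne
      (fr_line (hS.pt P hP'.1) hv hPv) le_sup_left (e ▸ le_sup_left)
    rw [← h2, h3]; exact le_sup_right
  have hIJ : I ⊆ J := by
    intro A hA
    obtain ⟨P, hP, rfl⟩ := Finset.mem_image.1 hA
    have hP' := Finset.mem_filter.1 hP
    have hPv : P ≠ v := by rintro rfl; exact hvS hP'.1
    refine Finset.mem_erase.2 ⟨?_, mem_Gr.2 ⟨le_sup_right, sup_le (hP'.2.trans hMπ) (hvL.trans hLπ),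
      fr_line (hS.pt P hP'.1) hv hPv⟩⟩
    intro e
    have hPL : P ≤ L := e ▸ le_sup_left
    have hPw : P ≤ w := hML ▸ le_inf hP'.2 hPL
    have hwr : finrank K w = 1 := by
      have := fr_inf hMπ hLπ (by omega) (fun h => hvM ?_)
      · rw [hML] at this; omega
      · rw [eq_of_le_fr h (by omega)]; exact hvL
    rw [pt_eq (hS.pt P hP'.1) hwr hPw] at hP'
    exact hw hP'.1
  have hI2 : ∀ A ∈ I, 2 ≤ NN S A := by
    intro A hA
    have hA2 := (mem_Gr.1 (Finset.mem_of_mem_erase (hIJ hA))).2.2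
    obtain ⟨P, hP, rfl⟩ := Finset.mem_image.1 hA
    exact hS.line_ge2 (Finset.mem_filter.1 hP).1 le_sup_left hA2
  constructor
  · have h2 := Finset.card_nsmul_le_sum I (fun A => NN S A) 2 hI2
    have h3 := Finset.sum_le_sum_of_subset (f := fun A => NN S A) hIJ
    simp only [smul_eq_mul] at h2
    omega
  · intro A hA hAπ hvA hAL
    have hAJ : A ∈ J := Finset.mem_erase.2 ⟨hAL, mem_Gr.2 ⟨hvA, hAπ, hA⟩⟩
    have h2 := Finset.card_nsmul_le_sum (I.erase A) (fun A => NN S A) 2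
      (fun B hB => hI2 B (Finset.mem_of_mem_erase hB))
    have h3 := Finset.sum_le_sum_of_subset (f := fun A => NN S A) (Finset.erase_subset_erase A hIJ)
    have h4 := Finset.add_sum_erase J (fun A => NN S A) hAJ
    have h5 := Finset.pred_card_le_card_erase (s := I) (a := A)
    simp only [smul_eq_mul] at h2
    omega

lemma no6 (hS : EvenSet S) (hq : Nat.card K = 8) {π L : Submodule K V}
    (hπ : finrank K π = 3) (hN : NN S π = 14) (hL : finrank K L = 2) (hLπ : L ≤ π)
    (hNL : NN S L = 6) : False := by
  obtain ⟨Q, hQS, hQπ, hQL⟩ : ∃ Q ∈ S, Q ≤ π ∧ ¬ Q ≤ L := by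
    by_contra! hcon
    have : NN S π ≤ NN S L := by
      apply Finset.card_le_card
      intro P hP
      rw [Finset.mem_filter] at hP ⊢
      exact ⟨hP.1, hcon P hP.1 hP.2⟩
    omega
  have h2 : ∀ {w M : Submodule K V}, w ∈ S → w ≤ L → finrank K M = 2 → M ≤ π → w ≤ M → M ≠ L →
      NN S M = 2 := by
    intro w M hw hwL hM hMπ hwM hne
    have a := hS.ex_plane hw (hwL.trans hLπ) hπ
    have b := hS.ex_two (mem_Gr.2 ⟨hwL, hLπ, hL⟩) (mem_Gr.2 ⟨hwM, hMπ, hM⟩) hne.symm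
    have c := hS.line_ge2 hw hwM hM
    omega
  have h3 := hS.ex_plane hQS hQπ hπ
  obtain ⟨M, hMG, hM0⟩ : ∃ M ∈ Gr 2 Q π, NN S M - 2 ≠ 0 := by
    apply Finset.exists_ne_zero_of_sum_ne_zero
    omega
  obtain ⟨hQM, hMπ, hM⟩ := mem_Gr.1 hMG
  have hM4 : 4 ≤ NN S M := by
    obtain ⟨m, hm⟩ := hS.even M hM
    omega
  have hMLne : ∀ {A : Submodule K V}, Q ≤ A → ¬ A ≤ L := fun h h' => hQL (h.trans h')
  have hr : ∀ {A : Submodule K V}, finrank K A = 2 → A ≤ π → Q ≤ A →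
      finrank K (A ⊓ L : Submodule K V) = 1 := by
    intro A hA hAπ hQA
    have := fr_inf hAπ hLπ (by omega) (hMLne hQA)
    omega
  have hwS : M ⊓ L ∉ S := by
    intro hw
    have := h2 hw inf_le_right hM hMπ inf_le_left (fun e => hMLne hQM e.le)
    omega
  obtain ⟨v, hv, hvL, hvS, hvw⟩ : ∃ v : Submodule K V, finrank K v = 1 ∧ v ≤ L ∧ v ∉ S ∧
      v ≠ M ⊓ L := by
    by_contra! hcon
    have : Gr 1 ⊥ L ⊆ insert (M ⊓ L) (S.filter (fun P => P ≤ L)) := by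
      intro P hP
      obtain ⟨a, b, c⟩ := mem_Gr.1 hP
      rw [Finset.mem_insert, Finset.mem_filter]
      by_cases hPS : P ∈ S
      · exact Or.inr ⟨hPS, b⟩
      · exact Or.inl (hcon P c b hPS)
    have h5 := (Finset.card_le_card this).trans (Finset.card_insert_le _ _)
    rw [card_Gr2 (k := 0) bot_le (by simp) (by omega)] at h5
    simp only [NN] at hNL
    omega
  have hkey : ∀ {v : Submodule K V}, finrank K v = 1 → v ≤ L → v ∉ S → v ≠ M ⊓ L → ¬ v ≤ M := by
    intro v hv hvL hvS hvw h
    exact hvw (pt_eq hv (hr hM hMπ hQM) (le_inf h hvL))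
  have hM4' := (hS.claim6 hq hπ hN hL hLπ hNL hM hMπ hM4 hv hvS hvL (hkey hv hvL hvS hvw) rfl hwS).1
  rw [Finset.sum_eq_single_of_mem M hMG] at h3
  · omega
  intro A hA hne
  obtain ⟨hQA, hAπ, hA2⟩ := mem_Gr.1 hA
  have hra := hr hA2 hAπ hQA
  by_cases hAS : A ⊓ L ∈ S
  · rw [h2 hAS inf_le_right hA2 hAπ inf_le_left (fun e => hMLne hQA e.le), Nat.sub_self]
  · have hw' : A ⊓ L ≠ M ⊓ L := by
      intro e
      apply hne
      have hQne : Q ≠ A ⊓ L := fun e => hQL (e.le.trans inf_le_right)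
      rw [← line_eq (hS.pt Q hQS) hra hQne hA2 hQA inf_le_left,
        line_eq (hS.pt Q hQS) hra hQne hM hQM (e ▸ inf_le_left)]
    have := (hS.claim6 hq hπ hN hL hLπ hNL hM hMπ hM4 hra hAS inf_le_right
      (hkey hra inf_le_right hAS hw') rfl hwS).2 A hA2 hAπ inf_le_left (fun e => hMLne hQA e.le)
    omega

lemma no6_solid (hS : EvenSet S) (hq : Nat.card K = 8) {U L : Submodule K V}
    (hU : finrank K U = 4) (hN : NN S U ≤ 80) (hL : finrank K L = 2) (hLU : L ≤ U)
    (hNL : NN S L = 6) : False := by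
  have h1 := sum_Gr hS.pt hLU hL
  rw [card_Gr2 hLU hL hU, hq, hNL] at h1
  obtain ⟨P, hP, hPL⟩ := exists_of_NN (S := S) (W := L) (by omega)
  have h2 : ∀ X ∈ Gr 3 L U, 14 ≤ NN S X := by
    intro X hX
    obtain ⟨a, b, c⟩ := mem_Gr.1 hX
    have h3 := hS.ex_plane hP (hPL.trans a) c
    have h4 := hS.ex_one (mem_Gr.2 ⟨hPL, a, hL⟩)
    omega
  obtain ⟨X, hX, h3⟩ : ∃ X ∈ Gr 3 L U, NN S X < 15 := by
    by_contra! hcon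
    have := Finset.card_nsmul_le_sum (Gr 3 L U) (fun A => NN S A) 15 hcon
    rw [card_Gr2 hLU hL hU, hq] at this
    simp only [smul_eq_mul, Nat.reduceAdd] at this h1
    omega
  obtain ⟨a, b, c⟩ := mem_Gr.1 hX
  have := h2 X hX
  exact hS.no6 hq c (by omega) hL a hNL

end EvenSet
end Solid8


section Solid4
set_option linter.unusedSectionVars false
set_option linter.unusedVariables false
open Classical Module Submodule
variable {K V : Type*} [Field K] [Finite K] [AddCommGroup V] [Module K V] [Fintype V]
  [Fintype (Submodule K V)]

/-- The 4-secants through `P` in `W`. -/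
noncomputable def F4 (S : Finset (Submodule K V)) (P W : Submodule K V) : Finset (Submodule K V) :=
  (Gr 2 P W).filter (fun L => NN S L = 4)

lemma mem_F4 {S : Finset (Submodule K V)} {P W L : Submodule K V} :
    L ∈ F4 S P W ↔ (P ≤ L ∧ L ≤ W ∧ finrank K L = 2) ∧ NN S L = 4 := by
  simp only [F4, Finset.mem_filter, mem_Gr]

lemma part3 {α : Type*} (G : Finset α) (f : α → ℕ) {a b c : ℕ} (hab : a ≠ b) (hac : a ≠ c)
    (hbc : b ≠ c) (h : ∀ x ∈ G, f x = a ∨ f x = b ∨ f x = c) :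
    G.card = (G.filter (fun x => f x = a)).card + (G.filter (fun x => f x = b)).card
      + (G.filter (fun x => f x = c)).card ∧
    ∑ x ∈ G, f x = a * (G.filter (fun x => f x = a)).card + b * (G.filter (fun x => f x = b)).card
      + c * (G.filter (fun x => f x = c)).card := by
  simp only [Finset.card_filter, Finset.mul_sum, ← Finset.sum_add_distrib]
  constructor
  · rw [Finset.card_eq_sum_ones]
    apply Finset.sum_congr rfl
    intro x hx
    rcases h x hx with e | e | e <;> simp [e, hab, hac, hbc, hab.symm, hac.symm, hbc.symm]
  · apply Finset.sum_congr rfl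
    intro x hx
    rcases h x hx with e | e | e <;> simp [e, hab, hac, hbc, hab.symm, hac.symm, hbc.symm]

namespace EvenSet
variable {S : Finset (Submodule K V)}

lemma ex4 (hS : EvenSet S) {P W U : Submodule K V}
    (h4 : ∀ L : Submodule K V, L ≤ U → finrank K L = 2 → NN S L ≤ 4) (hP : P ∈ S) (hW : W ≤ U) :
    ∑ L ∈ Gr 2 P W, (NN S L - 2) = 2 * (F4 S P W).card := by
  unfold F4
  rw [Finset.card_filter, Finset.mul_sum]
  apply Finset.sum_congr rfl
  intro L hL
  obtain ⟨a, b, c⟩ := mem_Gr.1 hL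
  have h1 := h4 L (b.trans hW) c
  have h2 := hS.line_ge2 hP a c
  obtain ⟨m, hm⟩ := hS.even L c
  split_ifs <;> omega

lemma plane4 (hS : EvenSet S) (hq : Nat.card K = 8) {P W U : Submodule K V}
    (h4 : ∀ L : Submodule K V, L ≤ U → finrank K L = 2 → NN S L ≤ 4) (hP : P ∈ S) (hPW : P ≤ W)
    (hW : W ≤ U) (hWr : finrank K W = 3) : NN S W = 10 + 2 * (F4 S P W).card := by
  have := hS.ex_plane hP hPW hWr
  rw [hS.ex4 h4 hP hW] at this
  omega

lemma solid4 (hS : EvenSet S) (hq : Nat.card K = 8) {P U : Submodule K V}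
    (h4 : ∀ L : Submodule K V, L ≤ U → finrank K L = 2 → NN S L ≤ 4) (hP : P ∈ S) (hPU : P ≤ U)
    (hU : finrank K U = 4) : NN S U = 74 + 2 * (F4 S P U).card := by
  have := hS.ex_solid hP hPU hU
  rw [hS.ex4 h4 hP le_rfl, hq] at this
  omega

lemma count4 (hS : EvenSet S) {W : Submodule K V} {t : ℕ}
    (ht : ∀ P ∈ S, P ≤ W → (F4 S P W).card = t) : NN S W * t = (F4 S ⊥ W).card * 4 := by
  have h := flag_count (S.filter (fun P => P ≤ W)) (F4 S ⊥ W) (fun P L => P ≤ L)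
  rw [Finset.sum_const_nat (m := t), Finset.sum_const_nat (m := 4)] at h
  · exact h
  · intro L hL
    obtain ⟨⟨a, b, c⟩, d⟩ := mem_F4.1 hL
    rw [← d]
    unfold NN
    congr 1
    ext P
    simp only [Finset.mem_filter]
    have : P ≤ L → P ≤ W := fun h => h.trans b
    tauto
  · intro P hP
    obtain ⟨a, b⟩ := Finset.mem_filter.1 hP
    rw [← ht P a b]
    congr 1
    ext L
    simp only [Finset.mem_filter, mem_F4]
    have : ⊥ ≤ L := bot_le
    tauto

lemma plane_count4 (hS : EvenSet S) (hq : Nat.card K = 8) {W U : Submodule K V}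
    (h4 : ∀ L : Submodule K V, L ≤ U → finrank K L = 2 → NN S L ≤ 4)
    (hW : W ≤ U) (hWr : finrank K W = 3) {t : ℕ} (hN : NN S W = 10 + 2 * t) :
    (10 + 2 * t) * t = (F4 S ⊥ W).card * 4 := by
  rw [← hN]
  apply hS.count4
  intro P hP hPW
  have := hS.plane4 hq h4 hP hPW hW hWr
  omega

lemma F4_le (hS : EvenSet S) {P W U : Submodule K V} (hW : W ≤ U) :
    (F4 S P W).card ≤ (F4 S P U).card := by
  apply Finset.card_le_card
  intro L hL
  rw [mem_F4] at hL ⊢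
  exact ⟨⟨hL.1.1, hL.1.2.1.trans hW, hL.1.2.2⟩, hL.2⟩

/-- Planes through a 4-secant. -/
lemma pencil4 (hS : EvenSet S) (hq : Nat.card K = 8) {L U : Submodule K V} (hU : finrank K U = 4)
    (hL : L ∈ F4 S ⊥ U) :
    (Gr 3 L U).card = 9 ∧ ∑ X ∈ Gr 3 L U, NN S X = NN S U + 32 := by
  obtain ⟨⟨a, b, c⟩, d⟩ := mem_F4.1 hL
  have h1 := sum_Gr hS.pt b c
  have h2 := card_Gr2 b c hU
  rw [h2, d, hq] at h1
  rw [hq] at h2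
  simp only [Nat.reduceAdd] at h1 h2
  exact ⟨h2, by omega⟩

lemma pencil4_val (hS : EvenSet S) (hq : Nat.card K = 8) {L U X : Submodule K V}
    (hU : finrank K U = 4) (hNU : NN S U ≤ 80)
    (h4 : ∀ L : Submodule K V, L ≤ U → finrank K L = 2 → NN S L ≤ 4)
    (hL : L ∈ F4 S ⊥ U) (hX : X ∈ Gr 3 L U) :
    (NN S X = 12 ∨ NN S X = 14 ∨ NN S X = 16) ∧ NN S X + 64 ≤ NN S U := by
  obtain ⟨⟨a, b, c⟩, d⟩ := mem_F4.1 hL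
  obtain ⟨a', b', c'⟩ := mem_Gr.1 hX
  obtain ⟨P, hP, hPL⟩ := exists_of_NN (S := S) (W := L) (by omega)
  have h1 := hS.plane4 hq h4 hP (hPL.trans a') b' c'
  have h2 := hS.solid4 hq h4 hP (hPL.trans b) hU
  have h3 := hS.F4_le (P := P) b'
  have h5 : 1 ≤ (F4 S P X).card := Finset.card_pos.2 ⟨L, mem_F4.2 ⟨⟨hPL, a', c⟩, d⟩⟩
  omega

lemma flag10 (hS : EvenSet S) {U : Submodule K V} {c m : ℕ}
    (hc : ∀ P ∈ S, P ≤ U → ((Gr 3 P U).filter (fun X => NN S X = m)).card = c) :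
    NN S U * c = ((Gr 3 ⊥ U).filter (fun X => NN S X = m)).card * m := by
  have h := flag_count (S.filter (fun P => P ≤ U)) ((Gr 3 ⊥ U).filter (fun X => NN S X = m))
    (fun P X => P ≤ X)
  rw [Finset.sum_const_nat (m := c), Finset.sum_const_nat (m := m)] at h
  · exact h
  · intro X hX
    obtain ⟨hX1, hX2⟩ := Finset.mem_filter.1 hX
    obtain ⟨a, b, c⟩ := mem_Gr.1 hX1
    rw [← hX2]
    conv_rhs => unfold NN
    congr 1
    ext P
    simp only [Finset.mem_filter]
    have : P ≤ X → P ≤ U := fun h => h.trans b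
    tauto
  · intro P hP
    obtain ⟨a, b⟩ := Finset.mem_filter.1 hP
    rw [← hc P a b]
    congr 1
    ext L
    simp only [Finset.mem_filter, mem_Gr]
    have : ⊥ ≤ L := bot_le
    tauto

lemma case74 (hS : EvenSet S) (hq : Nat.card K = 8) {U : Submodule K V} (hU : finrank K U = 4)
    (h4 : ∀ L : Submodule K V, L ≤ U → finrank K L = 2 → NN S L ≤ 4) (hN : NN S U = 74) :
    False := by
  have := hS.flag10 (U := U) (c := 73) (m := 10) ?_
  · rw [hN] at this; omega
  intro P hP hPU
  have h1 := card_Gr3' hPU (hS.pt P hP) hU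
  rw [hq] at h1
  rw [Finset.filter_true_of_mem]
  · exact h1
  intro X hX
  obtain ⟨a', b', c'⟩ := mem_Gr.1 hX
  have h1 := hS.plane4 hq h4 hP a' b' c'
  have h2 := hS.solid4 hq h4 hP hPU hU
  have h3 := hS.F4_le (P := P) b'
  omega

lemma case76 (hS : EvenSet S) (hq : Nat.card K = 8) {U : Submodule K V} (hU : finrank K U = 4)
    (h4 : ∀ L : Submodule K V, L ≤ U → finrank K L = 2 → NN S L ≤ 4) (hN : NN S U = 76) :
    False := by
  have := hS.flag10 (U := U) (c := 64) (m := 10) ?_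
  · rw [hN] at this; omega
  intro P hP hPU
  have h1 := card_Gr3' hPU (hS.pt P hP) hU
  rw [hq] at h1
  have h2 := hS.solid4 hq h4 hP hPU hU
  obtain ⟨L, hL⟩ := Finset.card_eq_one.1 (by omega : (F4 S P U).card = 1)
  obtain ⟨⟨a, b, c⟩, d⟩ := mem_F4.1 (hL ▸ Finset.mem_singleton_self L : L ∈ F4 S P U)
  have h3 := card_Gr2 b c hU
  have h5 := Finset.card_filter_add_card_filter_not (s := Gr 3 P U) (fun X => NN S X = 10)
  have h6 : (Gr 3 P U).filter (fun X => ¬ NN S X = 10) = Gr 3 L U := by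
    ext X
    simp only [Finset.mem_filter, mem_Gr]
    constructor
    · rintro ⟨⟨a', b', c'⟩, d'⟩
      have h1 := hS.plane4 hq h4 hP a' b' c'
      obtain ⟨M, hM⟩ := Finset.card_pos.1 (by omega : 0 < (F4 S P X).card)
      obtain ⟨⟨a1, b1, c1⟩, d1⟩ := mem_F4.1 hM
      have : M ∈ F4 S P U := mem_F4.2 ⟨⟨a1, b1.trans b', c1⟩, d1⟩
      rw [hL, Finset.mem_singleton] at this
      exact ⟨this ▸ b1, b', c'⟩
    · rintro ⟨a', b', c'⟩
      refine ⟨⟨a.trans a', b', c'⟩, ?_⟩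
      have h1 := hS.plane4 hq h4 hP (a.trans a') b' c'
      have : 0 < (F4 S P X).card := Finset.card_pos.2 ⟨L, mem_F4.2 ⟨⟨a, a', c⟩, d⟩⟩
      omega
  rw [h6, h3, hq] at h5
  simp only [Nat.reduceAdd] at h1 h5
  omega

/-- Flags of 4-secants and planes of given size. -/
lemma flag4 (hS : EvenSet S) {U : Submodule K V} {m f : ℕ}
    (hf : ∀ X ∈ Gr 3 ⊥ U, NN S X = m → (F4 S ⊥ X).card = f) :
    ∑ L ∈ F4 S ⊥ U, ((Gr 3 L U).filter (fun X => NN S X = m)).card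
     = ((Gr 3 ⊥ U).filter (fun X => NN S X = m)).card * f := by
  have h := flag_count (F4 S ⊥ U) ((Gr 3 ⊥ U).filter (fun X => NN S X = m)) (fun L X => L ≤ X)
  rw [Finset.sum_const_nat (m := f) (s := (Gr 3 ⊥ U).filter (fun X => NN S X = m))] at h
  · rw [← h]
    apply Finset.sum_congr rfl
    intro L hL
    congr 1
    ext X
    simp only [Finset.mem_filter, mem_Gr]
    have : ⊥ ≤ X := bot_le
    tauto
  · intro X hX
    obtain ⟨hX1, hX2⟩ := Finset.mem_filter.1 hX
    rw [← hf X hX1 hX2]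
    congr 1
    ext L
    simp only [Finset.mem_filter, mem_F4]
    have : L ≤ X → L ≤ U := fun h => h.trans (mem_Gr.1 hX1).2.1
    tauto

lemma case78 (hS : EvenSet S) (hq : Nat.card K = 8) {U : Submodule K V} (hU : finrank K U = 4)
    (h4 : ∀ L : Submodule K V, L ≤ U → finrank K L = 2 → NN S L ≤ 4) (hN : NN S U = 78) :
    False := by
  have h1 : NN S U * 2 = (F4 S ⊥ U).card * 4 := hS.count4 fun P hP hPU => by
    have := hS.solid4 hq h4 hP hPU hU
    omega
  have h2 := hS.flag4 (U := U) (m := 14) (f := 7) (fun X hX hX2 => by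
    have := hS.plane_count4 hq h4 (mem_Gr.1 hX).2.1 (mem_Gr.1 hX).2.2 (t := 2) hX2
    omega)
  rw [Finset.sum_const_nat (m := 1)] at h2
  · omega
  intro L hL
  obtain ⟨p1, p2⟩ := hS.pencil4 hq hU hL
  obtain ⟨r1, r2⟩ := part3 (Gr 3 L U) (fun X => NN S X) (a := 12) (b := 14) (c := 16)
    (by omega) (by omega) (by omega) (fun X hX => (hS.pencil4_val hq hU (by omega) h4 hL hX).1)
  omega

end EvenSet
end Solid4


section Solid80
set_option linter.unusedSectionVars false
set_option linter.unusedVariables false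
open Classical Module Submodule
variable {K V : Type*} [Field K] [Finite K] [AddCommGroup V] [Module K V] [Fintype V]
  [Fintype (Submodule K V)]

namespace EvenSet
variable {S : Finset (Submodule K V)}

/-- A 16-plane has at most 13 external lines. -/
lemma ext16 (hS : EvenSet S) (hq : Nat.card K = 8) {π : Submodule K V} (hπ : finrank K π = 3)
    (h4 : ∀ L : Submodule K V, L ≤ π → finrank K L = 2 → NN S L ≤ 4) (hN : NN S π = 16) :
    ((Gr 2 ⊥ π).filter (fun L => NN S L = 0)).card = 13 := by
  have h1 := hS.plane_count4 hq h4 le_rfl hπ (t := 3) hN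
  have h2 := card_Gr3' (bot_le : ⊥ ≤ π) (k := 0) (by simp) (by omega)
  rw [hq] at h2
  obtain ⟨r1, r2⟩ := part3 (Gr 2 ⊥ π) (fun X => NN S X) (a := 0) (b := 2) (c := 4)
    (by omega) (by omega) (by omega) (fun L hL => by
      obtain ⟨a, b, c⟩ := mem_Gr.1 hL
      have := h4 L b c
      obtain ⟨m, hm⟩ := hS.even L c
      omega)
  have h3 := flag_count (S.filter (fun P => P ≤ π)) (Gr 2 ⊥ π) (fun P L => P ≤ L)
  rw [Finset.sum_const_nat (m := 9)] at h3
  · have h5 : ∑ b ∈ Gr 2 ⊥ π, ((S.filter (fun P => P ≤ π)).filter (fun a => a ≤ b)).card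
        = ∑ L ∈ Gr 2 ⊥ π, NN S L := by
      apply Finset.sum_congr rfl
      intro L hL
      unfold NN
      congr 1
      ext P
      simp only [Finset.mem_filter]
      have : P ≤ L → P ≤ π := fun h => h.trans (mem_Gr.1 hL).2.1
      tauto
    rw [h5, r2] at h3
    change NN S π * 9 = _ at h3
    simp only [F4] at h1
    simp only [Nat.reduceAdd, Nat.zero_add] at h2
    omega
  · intro P hP
    obtain ⟨a, b⟩ := Finset.mem_filter.1 hP
    have := card_Gr2 b (hS.pt P a) hπ
    rw [hq] at this
    refine Eq.trans ?_ this
    congr 1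
    ext L
    simp only [Finset.mem_filter, mem_Gr]
    have : ⊥ ≤ L := bot_le
    tauto

lemma fibre80 (hS : EvenSet S) (hq : Nat.card K = 8) {U π m : Submodule K V}
    (hU : finrank K U = 4) (hN : NN S U = 80) (hπ : finrank K π = 3) (hπU : π ≤ U)
    (hNπ : NN S π = 16) (hm : finrank K m = 2) (hmπ : m ≤ π) (hNm : NN S m = 0) :
    ((Gr 3 m U).filter (fun X => NN S X = 12)).card ≤ 4 := by
  have h1 := sum_Gr hS.pt (hmπ.trans hπU) hm
  rw [hNm, hN] at h1
  simp only [Nat.reduceAdd, Nat.mul_zero, Nat.add_zero] at h1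
  have hge : ∀ X ∈ Gr 3 m U, NN S X = 0 ∨ 10 ≤ NN S X := by
    intro X hX
    obtain ⟨a, b, c⟩ := mem_Gr.1 hX
    by_cases h : NN S X = 0
    · exact Or.inl h
    · right
      obtain ⟨P, hP, hPX⟩ := exists_of_NN (S := S) (W := X) (by omega)
      have := hS.plane_ge hP hPX c
      omega
  rw [← Finset.sum_filter_add_sum_filter_not _ (fun X => NN S X = 12),
    Finset.sum_congr rfl (fun X hX => (Finset.mem_filter.1 hX).2), Finset.sum_const, smul_eq_mul] at h1
  set R := (Gr 3 m U).filter (fun X => ¬ NN S X = 12)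
  have hπR : π ∈ R := Finset.mem_filter.2 ⟨mem_Gr.2 ⟨hmπ, hπU, hπ⟩, by omega⟩
  rw [← Finset.add_sum_erase _ _ hπR, hNπ] at h1
  by_cases h0 : ∑ X ∈ R.erase π, NN S X = 0
  · omega
  · obtain ⟨X, hX, hX0⟩ := Finset.exists_ne_zero_of_sum_ne_zero h0
    have h2 := Finset.single_le_sum (f := fun X => NN S X) (fun _ _ => Nat.zero_le _) hX
    have h3 := hge X (Finset.mem_filter.1 (Finset.mem_of_mem_erase hX)).1
    omega

lemma case80 (hS : EvenSet S) (hq : Nat.card K = 8) {U : Submodule K V} (hU : finrank K U = 4)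
    (h4 : ∀ L : Submodule K V, L ≤ U → finrank K L = 2 → NN S L ≤ 4) (hN : NN S U = 80) :
    False := by
  have h1 : NN S U * 3 = (F4 S ⊥ U).card * 4 := hS.count4 fun P hP hPU => by
    have := hS.solid4 hq h4 hP hPU hU
    omega
  have f12 := hS.flag4 (U := U) (m := 12) (f := 3) (fun X hX hX2 => by
    have := hS.plane_count4 hq h4 (mem_Gr.1 hX).2.1 (mem_Gr.1 hX).2.2 (t := 1) hX2
    omega)
  have f14 := hS.flag4 (U := U) (m := 14) (f := 7) (fun X hX hX2 => by
    have := hS.plane_count4 hq h4 (mem_Gr.1 hX).2.1 (mem_Gr.1 hX).2.2 (t := 2) hX2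
    omega)
  have f16 := hS.flag4 (U := U) (m := 16) (f := 12) (fun X hX hX2 => by
    have := hS.plane_count4 hq h4 (mem_Gr.1 hX).2.1 (mem_Gr.1 hX).2.2 (t := 3) hX2
    omega)
  have hloc : ∀ L ∈ F4 S ⊥ U,
      ((Gr 3 L U).filter (fun X => NN S X = 12)).card +
        ((Gr 3 L U).filter (fun X => NN S X = 14)).card +
        ((Gr 3 L U).filter (fun X => NN S X = 16)).card = 9 ∧
      ((Gr 3 L U).filter (fun X => NN S X = 14)).card +
        2 * ((Gr 3 L U).filter (fun X => NN S X = 16)).card = 2 := by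
    intro L hL
    obtain ⟨p1, p2⟩ := hS.pencil4 hq hU hL
    obtain ⟨r1, r2⟩ := part3 (Gr 3 L U) (fun X => NN S X) (a := 12) (b := 14) (c := 16)
      (by omega) (by omega) (by omega) (fun X hX => (hS.pencil4_val hq hU (by omega) h4 hL hX).1)
    constructor <;> omega
  have hsum : ∑ L ∈ F4 S ⊥ U, (((Gr 3 L U).filter (fun X => NN S X = 14)).card +
        2 * ((Gr 3 L U).filter (fun X => NN S X = 16)).card) = (F4 S ⊥ U).card * 2 :=
    Finset.sum_const_nat fun L hL => (hloc L hL).2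
  rw [Finset.sum_add_distrib, ← Finset.mul_sum, f14, f16] at hsum
  have n14 : ((Gr 3 ⊥ U).filter (fun X => NN S X = 14)).card = 0 := by omega
  have n16 : ((Gr 3 ⊥ U).filter (fun X => NN S X = 16)).card = 5 := by omega
  have hloc8 : ∀ L ∈ F4 S ⊥ U, ((Gr 3 L U).filter (fun X => NN S X = 12)).card = 8 := by
    intro L hL
    have h5 : ((Gr 3 L U).filter (fun X => NN S X = 14)).card ≤
        ((Gr 3 ⊥ U).filter (fun X => NN S X = 14)).card := by
      apply Finset.card_le_card
      intro X hX
      simp only [Finset.mem_filter, mem_Gr] at hX ⊢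
      exact ⟨⟨bot_le, hX.1.2⟩, hX.2⟩
    have := hloc L hL
    omega
  rw [Finset.sum_const_nat hloc8] at f12
  obtain ⟨π, hπ⟩ := Finset.card_pos.1 (by omega : 0 < ((Gr 3 ⊥ U).filter (fun X => NN S X = 16)).card)
  obtain ⟨hπG, hNπ⟩ := Finset.mem_filter.1 hπ
  obtain ⟨-, hπU, hπr⟩ := mem_Gr.1 hπG
  have h4π : ∀ L : Submodule K V, L ≤ π → finrank K L = 2 → NN S L ≤ 4 :=
    fun L hL => h4 L (hL.trans hπU)
  have hE := hS.ext16 hq hπr h4π hNπ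
  have hL1 := hS.plane_count4 hq h4 hπU hπr (t := 3) hNπ
  set B12 := (Gr 3 ⊥ U).filter (fun X => NN S X = 12) with hB12
  have hBin : (B12.filter (fun X => ∃ L ∈ F4 S ⊥ π, L ≤ X)).card ≤ (F4 S ⊥ π).card * 8 := by
    have hsub : B12.filter (fun X => ∃ L ∈ F4 S ⊥ π, L ≤ X) ⊆
        (F4 S ⊥ π).biUnion (fun L => (Gr 3 L U).filter (fun X => NN S X = 12)) := by
      intro X hX
      simp only [hB12, Finset.mem_filter, mem_Gr] at hX
      obtain ⟨⟨⟨_, a, b⟩, c⟩, L, hL, hLX⟩ := hX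
      simp only [Finset.mem_biUnion, Finset.mem_filter, mem_Gr]
      exact ⟨L, hL, ⟨hLX, a, b⟩, c⟩
    refine (Finset.card_le_card hsub).trans (Finset.card_biUnion_le_card_mul _ _ _ ?_)
    intro L hL
    rw [hloc8]
    obtain ⟨⟨a, b, c⟩, d⟩ := mem_F4.1 hL
    exact mem_F4.2 ⟨⟨a, b.trans hπU, c⟩, d⟩
  have hsplit := Finset.card_filter_add_card_filter_not (s := B12)
    (fun X => ∃ L ∈ F4 S ⊥ π, L ≤ X)
  have hBE := Finset.card_le_mul_card_image_of_maps_to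
    (s := B12.filter (fun X => ¬ ∃ L ∈ F4 S ⊥ π, L ≤ X))
    (t := (Gr 2 ⊥ π).filter (fun L => NN S L = 0)) (f := fun X => X ⊓ π) ?_ 4 ?_
  · rw [hE] at hBE
    omega
  · intro X hX
    obtain ⟨hX1, hX2⟩ := Finset.mem_filter.1 hX
    obtain ⟨hX1, hX3⟩ := Finset.mem_filter.1 hX1
    obtain ⟨-, hXU, hXr⟩ := mem_Gr.1 hX1
    have hne : ¬ X ≤ π := by
      intro h
      rw [eq_of_le_fr h (by omega)] at hX3
      omega
    refine Finset.mem_filter.2 ⟨mem_Gr.2 ⟨bot_le, inf_le_right, ?_⟩, ?_⟩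
    · have := fr_inf hXU hπU (by omega) hne
      omega
    · by_contra h0
      obtain ⟨P, hP, hPX⟩ := exists_of_NN (S := S) (W := X ⊓ π) (by omega)
      have a1 := hS.plane4 hq h4 hP (hPX.trans inf_le_left) hXU hXr
      have a2 := hS.plane4 hq h4 hP (hPX.trans inf_le_right) hπU hπr
      have a3 := hS.solid4 hq h4 hP ((hPX.trans inf_le_right).trans hπU) hU
      have a4 : F4 S P π = F4 S P U := by
        apply Finset.eq_of_subset_of_card_le
        · intro L hL
          rw [mem_F4] at hL ⊢
          exact ⟨⟨hL.1.1, hL.1.2.1.trans hπU, hL.1.2.2⟩, hL.2⟩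
        · omega
      obtain ⟨L, hL⟩ := Finset.card_pos.1 (by omega : 0 < (F4 S P X).card)
      obtain ⟨⟨b1, b2, b3⟩, b4⟩ := mem_F4.1 hL
      have hLU : L ∈ F4 S P U := mem_F4.2 ⟨⟨b1, b2.trans hXU, b3⟩, b4⟩
      rw [← a4, mem_F4] at hLU
      exact hX2 ⟨L, mem_F4.2 ⟨⟨bot_le, hLU.1.2⟩, b4⟩, b2⟩
  · intro m hm
    obtain ⟨hm1, hm2⟩ := Finset.mem_filter.1 hm
    obtain ⟨-, hmπ, hmr⟩ := mem_Gr.1 hm1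
    refine le_trans (Finset.card_le_card ?_) (hS.fibre80 hq hU hN hπr hπU hNπ hmr hmπ hm2)
    intro X hX
    simp only [hB12, Finset.mem_filter, mem_Gr] at hX ⊢
    refine ⟨⟨?_, hX.1.1.1.2⟩, hX.1.1.2⟩
    rw [← hX.2]; exact inf_le_left

theorem solid_8 (hS : EvenSet S) (hq : Nat.card K = 8) {U P : Submodule K V}
    (hU : finrank K U = 4) (hP : P ∈ S) (hPU : P ≤ U) (hN : NN S U ≤ 80) :
    NN S U = 80 ∧ ∃ v, IsVertex S U v := by
  by_cases h8 : ∃ L : Submodule K V, L ≤ U ∧ finrank K L = 2 ∧ 7 ≤ NN S L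
  · obtain ⟨L, hLU, hL, h7⟩ := h8
    obtain ⟨Q, hQ, hQL⟩ := exists_of_NN (S := S) (W := L) (by omega)
    have h1 := hS.ex_solid hQ (hQL.trans hLU) hU
    have h2 := hS.ex_one (mem_Gr.2 ⟨hQL, hLU, hL⟩)
    obtain ⟨m, hm⟩ := hS.even L hL
    rw [hq] at h1
    refine ⟨by omega, hS.vertex_of_qsec hU (by rw [hq]; omega) hL hLU (by omega)⟩
  · exfalso
    push Not at h8
    have h4 : ∀ L : Submodule K V, L ≤ U → finrank K L = 2 → NN S L ≤ 4 := by
      intro L hLU hL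
      have h1 := h8 L hLU hL
      obtain ⟨m, hm⟩ := hS.even L hL
      by_contra hcon
      exact hS.no6_solid hq hU hN hL hLU (by omega)
    have h1 := hS.solid4 hq h4 hP hPU hU
    obtain h | h | h | h : (NN S U = 74 ∨ NN S U = 76 ∨ NN S U = 78 ∨ NN S U = 80) := by omega
    · exact hS.case74 hq hU h4 h
    · exact hS.case76 hq hU h4 h
    · exact hS.case78 hq hU h4 h
    · exact hS.case80 hq hU h4 h

theorem solid_4 (hS : EvenSet S) (hq : Nat.card K = 4) {U P : Submodule K V}
    (hU : finrank K U = 4) (hP : P ∈ S) (hPU : P ≤ U) (hN : NN S U ≤ 24) :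
    NN S U = 24 ∧ ∃ v, IsVertex S U v := by
  by_cases h8 : ∃ L : Submodule K V, L ≤ U ∧ finrank K L = 2 ∧ 3 ≤ NN S L
  · obtain ⟨L, hLU, hL, h7⟩ := h8
    obtain ⟨Q, hQ, hQL⟩ := exists_of_NN (S := S) (W := L) (by omega)
    have h1 := hS.ex_solid hQ (hQL.trans hLU) hU
    have h2 := hS.ex_one (mem_Gr.2 ⟨hQL, hLU, hL⟩)
    obtain ⟨m, hm⟩ := hS.even L hL
    rw [hq] at h1
    refine ⟨by omega, hS.vertex_of_qsec hU (by rw [hq]; omega) hL hLU (by omega)⟩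
  · exfalso
    push Not at h8
    have hex : ∀ {W Q : Submodule K V}, W ≤ U → ∑ L ∈ Gr 2 Q W, (NN S L - 2) = 0 := by
      intro W Q hW
      apply Finset.sum_eq_zero
      intro L hL
      obtain ⟨a, b, c⟩ := mem_Gr.1 hL
      have := h8 L (b.trans hW) c
      omega
    have h1 := hS.ex_solid hP hPU hU
    rw [hex le_rfl, hq] at h1
    have hpl : ∀ {X : Submodule K V}, X ≤ U → finrank K X = 3 → NN S X = 0 ∨ NN S X = 6 := by
      intro X hXU hX
      by_cases h0 : NN S X = 0
      · exact Or.inl h0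
      right
      obtain ⟨Q, hQ, hQX⟩ := exists_of_NN (S := S) (W := X) (by omega)
      have := hS.ex_plane hQ hQX hX
      rw [hex hXU, hq] at this
      omega
    have c1 := card_Gr3' hPU (hS.pt P hP) hU
    obtain ⟨X, hX⟩ := Finset.card_pos.1 (by omega : 0 < (Gr (1 + 2) P U).card)
    obtain ⟨hPX, hXU, hXr⟩ := mem_Gr.1 hX
    have hX6 : NN S X = 6 := by
      have := NN_pos hP hPX
      have := hpl hXU hXr
      omega
    obtain ⟨R, hR, hRX, hRS⟩ : ∃ R : Submodule K V, finrank K R = 1 ∧ R ≤ X ∧ R ∉ S := by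
      by_contra! hcon
      have c2 := card_Gr3 (bot_le : ⊥ ≤ X) (k := 0) (by simp) (by omega)
      have : (Gr (0 + 1) ⊥ X).card ≤ NN S X := by
        apply le_NN_of_subset
        intro Q hQ
        obtain ⟨a, b, c⟩ := mem_Gr.1 hQ
        exact ⟨hcon Q c b, b⟩
      rw [c2, hq] at this
      omega
    have h2 := hS.out_sum hR hRS hRX
    have c3 := card_Gr2 hRX hR hXr
    obtain ⟨m, hm, hm0⟩ : ∃ m ∈ Gr 2 R X, NN S m < 2 := by
      by_contra! hcon
      have := Finset.card_nsmul_le_sum (Gr 2 R X) (fun A => NN S A) 2 hcon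
      rw [c3, hq] at this
      simp only [smul_eq_mul] at this
      omega
    obtain ⟨hRm, hmX, hmr⟩ := mem_Gr.1 hm
    have hm0' : NN S m = 0 := by
      obtain ⟨k, hk⟩ := hS.even m hmr
      omega
    have h3 := sum_Gr hS.pt (hmX.trans hXU) hmr
    rw [hm0'] at h3
    have h5 : 6 ∣ ∑ Y ∈ Gr (2 + 1) m U, NN S Y := by
      apply Finset.dvd_sum
      intro Y hY
      obtain ⟨a, b, c⟩ := mem_Gr.1 hY
      rcases hpl b c with h | h <;> rw [h] <;> omega
    omega

end EvenSet
end Solid80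


section PartB
set_option linter.unusedSectionVars false
set_option linter.unusedVariables false
open Classical Module Submodule
variable {K V : Type*} [Field K] [Finite K] [AddCommGroup V] [Module K V] [Fintype V]
  [Fintype (Submodule K V)]

/-- The data needed to build the cylinder structure. -/
structure CylHyp (S : Finset (Submodule K V)) : Prop where
  ev : EvenSet S
  q4 : 4 ≤ Nat.card K
  qe : Even (Nat.card K)
  sol : ∀ W U : Submodule K V, finrank K W = 3 → NN S W = Nat.card K + 2 → W ≤ U →
    finrank K U = 4 → NN S U = Nat.card K ^ 2 + 2 * Nat.card K ∧ ∃ v, IsVertex S U v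

namespace EvenSet
variable {S : Finset (Submodule K V)}

lemma solid_48 (hS : EvenSet S) (hq : Nat.card K = 4 ∨ Nat.card K = 8) {U P : Submodule K V}
    (hU : finrank K U = 4) (hP : P ∈ S) (hPU : P ≤ U)
    (hN : NN S U ≤ Nat.card K ^ 2 + 2 * Nat.card K) :
    NN S U = Nat.card K ^ 2 + 2 * Nat.card K ∧ ∃ v, IsVertex S U v := by
  rcases hq with hq | hq
  · have := hS.solid_4 hq hU hP hPU (by rw [hq] at hN; omega)
    rw [hq]; exact this
  · have := hS.solid_8 hq hU hP hPU (by rw [hq] at hN; omega)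
    rw [hq]; exact this

lemma exists_plane (hS : EvenSet S) (hq : Nat.card K = 4 ∨ Nat.card K = 8) {n : ℕ}
    (hV : finrank K V = n + 3)
    (hc : NN S ⊤ = (Nat.card K + 2) * Nat.card K ^ n) :
    ∃ W : Submodule K V, finrank K W = 3 ∧ NN S W = Nat.card K + 2 := by
  have hQ : 1 ≤ Nat.card K ^ n := Nat.one_le_pow _ _ (by omega)
  obtain ⟨P, hP, -⟩ := exists_of_NN (S := S) (W := ⊤) (by
    rw [hc]; exact Nat.mul_pos (by omega) hQ)
  have hex : ∃ L ∈ Gr 2 P ⊤, NN S L = 2 := by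
    by_contra! hcon
    have h1 := hS.ex_sum hP le_top
    have h2 := card_Gr (le_top : P ≤ ⊤) (hS.pt P hP) (d := n + 2)
      (by rw [finrank_top]; omega)
    have h3 : (Gr 2 P ⊤).card * 2 ≤ ∑ L ∈ Gr 2 P ⊤, (NN S L - 2) := by
      rw [← smul_eq_mul, ← Finset.sum_const]
      apply Finset.sum_le_sum
      intro L hL
      obtain ⟨a, b, c⟩ := mem_Gr.1 hL
      have := hcon L hL
      have := hS.line_ge2 hP a c
      obtain ⟨m, hm⟩ := hS.even L c
      omega
    rw [pow_add] at h2
    simp only [Nat.reduceAdd] at h2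
    rw [hc] at h1
    generalize Nat.card K ^ n = Q at *
    rcases hq with hq | hq <;> rw [hq] at h1 h2 <;> omega
  obtain ⟨L, hL, hNL⟩ := hex
  obtain ⟨a, b, c⟩ := mem_Gr.1 hL
  have hex : ∃ W ∈ Gr 3 L ⊤, NN S W = Nat.card K + 2 := by
    by_contra! hcon
    have h1 := sum_Gr hS.pt (le_top : L ≤ ⊤) c
    have h2 := card_Gr (le_top : L ≤ ⊤) c (d := n + 1)
      (by rw [finrank_top]; omega)
    have h3 : (Gr 3 L ⊤).card * (Nat.card K + 3) ≤ ∑ L ∈ Gr 3 L ⊤, NN S L := by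
      rw [← smul_eq_mul, ← Finset.sum_const]
      apply Finset.sum_le_sum
      intro W hW
      obtain ⟨d, e, f⟩ := mem_Gr.1 hW
      have := hcon W hW
      have := hS.plane_ge hP (a.trans d) f
      omega
    rw [pow_add] at h2
    simp only [Nat.reduceAdd] at h1 h2
    rw [hc, hNL] at h1
    generalize Nat.card K ^ n = Q at *
    rcases hq with hq | hq <;> rw [hq] at h1 h2 h3 <;> omega
  obtain ⟨W, hW, hNW⟩ := hex
  exact ⟨W, (mem_Gr.1 hW).2.2, hNW⟩

lemma cylHyp (hS : EvenSet S) (hq : Nat.card K = 4 ∨ Nat.card K = 8) {n : ℕ}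
    (hV : finrank K V = n + 3)
    (hc : NN S ⊤ = (Nat.card K + 2) * Nat.card K ^ n) : CylHyp S := by
  refine ⟨hS, by omega, ?_, ?_⟩
  · rcases hq with hq | hq <;> rw [hq] <;> decide
  intro W U hW hNW hWU hU
  obtain ⟨P, hP, hPW⟩ := exists_of_NN (S := S) (W := W) (by omega)
  have hge : ∀ X ∈ Gr 4 W ⊤, Nat.card K ^ 2 + 2 * Nat.card K ≤ NN S X := by
    intro X hX
    obtain ⟨d, e, f⟩ := mem_Gr.1 hX
    by_contra hlt
    have := (hS.solid_48 hq f hP (hPW.trans d) (by omega)).1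
    omega
  have h1 := sum_Gr hS.pt (le_top : W ≤ ⊤) hW
  have h2 := card_Gr (le_top : W ≤ ⊤) hW (d := n) (by rw [finrank_top]; omega)
  have hUm : U ∈ Gr 4 W ⊤ := mem_Gr.2 ⟨hWU, le_top, hU⟩
  have h3 := Finset.sum_le_sum (fun X hX => hge X (Finset.mem_of_mem_erase hX) :
    ∀ X ∈ (Gr 4 W ⊤).erase U, _)
  have h4 := Finset.add_sum_erase (Gr 4 W ⊤) (fun X => NN S X) hUm
  rw [Finset.sum_const, smul_eq_mul, Finset.card_erase_of_mem hUm] at h3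
  have h5 : 1 ≤ (Gr 4 W ⊤).card := Finset.card_pos.2 ⟨U, hUm⟩
  simp only [Nat.reduceAdd] at h1 h2
  rw [hc, hNW] at h1
  generalize Nat.card K ^ n = Q at *
  have hle : NN S U ≤ Nat.card K ^ 2 + 2 * Nat.card K := by
    rcases hq with hq | hq <;> rw [hq] at h1 h2 h3 ⊢ <;> omega
  exact hS.solid_48 hq hU hP (hPW.trans hWU) hle

end EvenSet
end PartB


section PartC
set_option linter.unusedSectionVars false
set_option linter.unusedVariables false
open Classical Module Submodule
variable {K V : Type*} [Field K] [Finite K] [AddCommGroup V] [Module K V] [Fintype V]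
  [Fintype (Submodule K V)]

/-- `Y` is a point of the vertex of the cylinder, seen from the base plane `W`. -/
def GoodPt (S : Finset (Submodule K V)) (W Y : Submodule K V) : Prop :=
  finrank K Y = 1 ∧ Y ∉ S ∧ ¬ Y ≤ W ∧ ∀ P ∈ S, P ≤ W → NN S (P ⊔ Y) = Nat.card K

namespace EvenSet
variable {S : Finset (Submodule K V)}

lemma plane_two (hS : EvenSet S) {W P M : Submodule K V} (hW : finrank K W = 3)
    (hN : NN S W = Nat.card K + 2) (hP : P ∈ S) (hPM : P ≤ M) (hMW : M ≤ W)
    (hM : finrank K M = 2) : NN S M = 2 := by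
  have h1 := hS.ex_plane hP (hPM.trans hMW) hW
  have h2 := hS.ex_one (mem_Gr.2 ⟨hPM, hMW, hM⟩)
  have h3 := hS.line_ge2 hP hPM hM
  omega

/-- A line all of whose points except `Y` belong to `S`. -/
lemma line_full (hS : EvenSet S) (hq : Even (Nat.card K)) {L Y : Submodule K V}
    (hL : finrank K L = 2) (hY : finrank K Y = 1) (hYL : Y ≤ L)
    (h : ∀ R : Submodule K V, finrank K R = 1 → R ≤ L → R ≠ Y → R ∈ S) :
    NN S L = Nat.card K ∧ Y ∉ S := by
  have h0 : (Gr 1 ⊥ L).card = Nat.card K + 1 :=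
    card_Gr2 (k := 0) bot_le (by simp) (by omega)
  have h1 : (Gr 1 ⊥ L).erase Y ⊆ S.filter (fun P => P ≤ L) := by
    intro R hR
    obtain ⟨a, b⟩ := Finset.mem_erase.1 hR
    obtain ⟨c, d, e⟩ := mem_Gr.1 b
    exact Finset.mem_filter.2 ⟨h R e d a, d⟩
  have h2 := Finset.card_le_card h1
  rw [Finset.card_erase_of_mem (mem_Gr.2 ⟨bot_le, hYL, hY⟩), h0] at h2
  have h3 := Finset.card_le_card (hS.filter_sub (L := L))
  rw [h0] at h3
  have h4 := hS.even L hL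
  change _ ≤ NN S L at h2
  change NN S L ≤ _ at h3
  have h5 : NN S L = Nat.card K := by
    obtain ⟨a, ha⟩ := h4
    obtain ⟨b, hb⟩ := hq
    omega
  refine ⟨h5, fun hYS => ?_⟩
  have h6 : Gr 1 ⊥ L ⊆ S.filter (fun P => P ≤ L) := by
    intro R hR
    by_cases e : R = Y
    · rw [e]; exact Finset.mem_filter.2 ⟨hYS, hYL⟩
    · exact h1 (Finset.mem_erase.2 ⟨e, hR⟩)
  have h7 := Finset.card_le_card h6
  rw [h0] at h7
  change _ ≤ NN S L at h7
  omega

lemma vertex_eq (hS : EvenSet S) (hq : 4 ≤ Nat.card K) {U v Y P1 P2 : Submodule K V}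
    (hU : finrank K U = 4) (hN : NN S U = Nat.card K ^ 2 + 2 * Nat.card K)
    (hv : IsVertex S U v) (hP1 : P1 ∈ S) (hP1U : P1 ≤ U) (hP2 : P2 ∈ S) (hP2U : P2 ≤ U)
    (hne : P1 ≠ P2) (hY : finrank K Y = 1) (hYU : Y ≤ U) (hY12 : ¬ Y ≤ P1 ⊔ P2)
    (h1 : NN S (P1 ⊔ Y) = Nat.card K) (h2 : NN S (P2 ⊔ Y) = Nat.card K) : Y = v := by
  obtain ⟨v1, vU, vS, vq⟩ := hv
  have key : ∀ P ∈ S, P ≤ U → P ≠ Y → NN S (P ⊔ Y) = Nat.card K → P ⊔ Y = P ⊔ v := by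
    intro P hP hPU hPY h
    by_contra hn
    have hPv : P ≠ v := by rintro rfl; exact vS hP
    have := hS.other_two hU hN hP (fr_line (hS.pt P hP) v1 hPv) le_sup_left (sup_le hPU vU)
      (vq P hP hPU) (fr_line (hS.pt P hP) hY hPY) le_sup_left (sup_le hPU hYU) hn
    omega
  have n1 : P1 ≠ Y := by rintro rfl; exact hY12 le_sup_left
  have n2 : P2 ≠ Y := by rintro rfl; exact hY12 le_sup_right
  have k1 := key P1 hP1 hP1U n1 h1
  have k2 := key P2 hP2 hP2U n2 h2
  by_contra hYv
  have e1 := line_eq hY v1 hYv (fr_line (hS.pt P1 hP1) hY n1) le_sup_right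
    (k1 ▸ le_sup_right : v ≤ P1 ⊔ Y)
  have e2 := line_eq hY v1 hYv (fr_line (hS.pt P2 hP2) hY n2) le_sup_right
    (k2 ▸ le_sup_right : v ≤ P2 ⊔ Y)
  have e3 : P1 ⊔ P2 = P1 ⊔ Y := line_eq (hS.pt P1 hP1) (hS.pt P2 hP2) hne
    (fr_line (hS.pt P1 hP1) hY n1) le_sup_left (by rw [← e1, e2]; exact le_sup_left)
  exact hY12 (e3 ▸ le_sup_right)

lemma plane_of_vertex (hS : EvenSet S) {U v X W : Submodule K V}
    (hU : finrank K U = 4) (hN : NN S U = Nat.card K ^ 2 + 2 * Nat.card K)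
    (hv : IsVertex S U v) (hW : finrank K W = 3) (hWU : W ≤ U) (hX : X ∈ S) (hXW : X ≤ W)
    (hvW : ¬ v ≤ W) : NN S W = Nat.card K + 2 := by
  obtain ⟨v1, vU, vS, vq⟩ := hv
  have h1 := hS.ex_plane hX hXW hW
  rw [Finset.sum_eq_zero] at h1
  · omega
  · intro M hM
    obtain ⟨a, b, c⟩ := mem_Gr.1 hM
    have hXv : X ≠ v := by rintro rfl; exact vS hX
    rw [hS.other_two hU hN hX (fr_line (hS.pt X hX) v1 hXv) le_sup_left
      (sup_le (hXW.trans hWU) vU) (vq X hX (hXW.trans hWU)) c a (b.trans hWU)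
      (fun e => hvW ((le_sup_right.trans e.ge).trans b)), Nat.sub_self]

end EvenSet

namespace CylHyp
variable {S : Finset (Submodule K V)} {W : Submodule K V}

lemma vert_good (H : CylHyp S) (hW : finrank K W = 3) (hN : NN S W = Nat.card K + 2)
    {U v : Submodule K V} (hWU : W ≤ U) (hv : IsVertex S U v) : GoodPt S W v := by
  obtain ⟨v1, vU, vS, vq⟩ := hv
  refine ⟨v1, vS, fun hvW => ?_, fun P hP hPW => vq P hP (hPW.trans hWU)⟩
  obtain ⟨P, hP, hPW⟩ := exists_of_NN (S := S) (W := W) (by omega)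
  have hPv : P ≠ v := by rintro rfl; exact vS hP
  have := H.ev.plane_two hW hN hP le_sup_left (sup_le hPW hvW) (fr_line (H.ev.pt P hP) v1 hPv)
  have := vq P hP (hPW.trans hWU)
  have := H.q4
  omega

lemma two_others (H : CylHyp S) (hN : NN S W = Nat.card K + 2) (P : Submodule K V) :
    ∃ P1 P2 : Submodule K V, P1 ∈ S ∧ P1 ≤ W ∧ P2 ∈ S ∧ P2 ≤ W ∧ P1 ≠ P2 ∧ P1 ≠ P ∧ P2 ≠ P := by
  have h1 : 1 < ((S.filter (fun Q => Q ≤ W)).erase P).card := by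
    have := Finset.pred_card_le_card_erase (s := S.filter (fun Q => Q ≤ W)) (a := P)
    have h2 : (S.filter (fun Q => Q ≤ W)).card = Nat.card K + 2 := hN
    have := H.q4
    omega
  obtain ⟨P1, h1, P2, h2, hne⟩ := Finset.one_lt_card.1 h1
  obtain ⟨a, b⟩ := Finset.mem_erase.1 h1
  obtain ⟨c, d⟩ := Finset.mem_erase.1 h2
  exact ⟨P1, P2, (Finset.mem_filter.1 b).1, (Finset.mem_filter.1 b).2,
    (Finset.mem_filter.1 d).1, (Finset.mem_filter.1 d).2, hne, a, c⟩

lemma good_vert (H : CylHyp S) (hW : finrank K W = 3) (hN : NN S W = Nat.card K + 2)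
    {U Y : Submodule K V} (hU : finrank K U = 4) (hWU : W ≤ U) (hY : GoodPt S W Y) (hYU : Y ≤ U) :
    IsVertex S U Y := by
  obtain ⟨y1, yS, yW, yq⟩ := hY
  obtain ⟨hNU, v, hv⟩ := H.sol W U hW hN hWU hU
  obtain ⟨P1, P2, p1, p1W, p2, p2W, hne, -, -⟩ := H.two_others hN ⊥
  rw [H.ev.vertex_eq H.q4 hU hNU hv p1 (p1W.trans hWU) p2 (p2W.trans hWU) hne y1 hYU
    (fun h => yW (h.trans (sup_le p1W p2W))) (yq P1 p1 p1W) (yq P2 p2 p2W)]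
  exact hv

lemma good_not_le (H : CylHyp S) (hW : finrank K W = 3) (hN : NN S W = Nat.card K + 2)
    {Y1 Y2 : Submodule K V} (h1 : GoodPt S W Y1) (h2 : GoodPt S W Y2) (hne : Y1 ≠ Y2) :
    ¬ Y2 ≤ W ⊔ Y1 := by
  intro hle
  have hU : finrank K (W ⊔ Y1 : Submodule K V) = 4 := by rw [fr_sup_pt h1.1 h1.2.2.1, hW]
  obtain ⟨hNU, -⟩ := H.sol W _ hW hN le_sup_left hU
  obtain ⟨P1, P2, p1, p1W, p2, p2W, hne', -, -⟩ := H.two_others hN ⊥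
  obtain ⟨y1, yS, yW, yq⟩ := h2
  exact hne.symm (H.ev.vertex_eq H.q4 hU hNU (H.good_vert hW hN hU le_sup_left h1 le_sup_right)
    p1 (p1W.trans le_sup_left) p2 (p2W.trans le_sup_left) hne' y1 hle
    (fun h => yW (h.trans (sup_le p1W p2W))) (yq P1 p1 p1W) (yq P2 p2 p2W))

/-- three points of the hyperoval span the plane -/
lemma not_le_line (H : CylHyp S) (hW : finrank K W = 3) (hN : NN S W = Nat.card K + 2)
    {P P1 P2 : Submodule K V} (hP : P ∈ S) (h1 : P1 ∈ S) (h1W : P1 ≤ W)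
    (h2 : P2 ∈ S) (h2W : P2 ≤ W) (n12 : P1 ≠ P2) (n1 : P1 ≠ P) (n2 : P2 ≠ P) :
    ¬ P ≤ P1 ⊔ P2 := by
  intro h
  have := H.ev.plane_two hW hN h1 le_sup_left (sup_le h1W h2W)
    (fr_line (H.ev.pt _ h1) (H.ev.pt _ h2) n12)
  have h3 := le_NN_of_subset (S := S) (F := {P, P1, P2}) (W := P1 ⊔ P2) (by
    intro Q hQ
    simp only [Finset.mem_insert, Finset.mem_singleton] at hQ
    rcases hQ with rfl | rfl | rfl
    · exact ⟨hP, h⟩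
    · exact ⟨h1, le_sup_left⟩
    · exact ⟨h2, le_sup_right⟩)
  rw [Finset.card_eq_three.2 ⟨P, P1, P2, n1.symm, n2.symm, n12, rfl⟩] at h3
  omega

lemma claimA (H : CylHyp S) (hW : finrank K W = 3) (hN : NN S W = Nat.card K + 2)
    {Y1 Y2 P X : Submodule K V} (g1 : GoodPt S W Y1) (g2 : GoodPt S W Y2) (hne : Y1 ≠ Y2)
    (hP : P ∈ S) (hPW : P ≤ W) (hX : X ∈ S) (hXL : X ≤ P ⊔ Y1) :
    NN S (X ⊔ Y2) = Nat.card K := by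
  have hY2 := H.good_not_le hW hN g1 g2 hne
  obtain ⟨P1, P2, p1, p1W, p2, p2W, n12, n1, n2⟩ := H.two_others hN P
  have hPm := H.not_le_line hW hN hP p1 p1W p2 p2W n12 n1 n2
  have hU : finrank K (W ⊔ Y1 : Submodule K V) = 4 := by rw [fr_sup_pt g1.1 g1.2.2.1, hW]
  obtain ⟨hNU, -⟩ := H.sol W _ hW hN le_sup_left hU
  have hv1 := H.good_vert hW hN hU le_sup_left g1 le_sup_right
  have hPp := H.ev.pt P hP
  have hXp := H.ev.pt X hX
  have hm : finrank K (P1 ⊔ P2 : Submodule K V) = 2 := fr_line (H.ev.pt _ p1) (H.ev.pt _ p2) n12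
  have hmW : P1 ⊔ P2 ≤ W := sup_le p1W p2W
  have hPY : P ≠ Y1 := by rintro rfl; exact g1.2.1 hP
  have hL := fr_line hPp g1.1 hPY
  have hXm : ¬ X ≤ P1 ⊔ P2 := by
    intro h
    by_cases e : P = X
    · exact hPm (e ▸ h)
    · have := line_eq hPp hXp e hL le_sup_left hXL
      apply g1.2.2.1
      calc Y1 ≤ P ⊔ Y1 := le_sup_right
        _ = P ⊔ X := this.symm
        _ ≤ W := sup_le hPW (h.trans hmW)
  have hπ : finrank K (P1 ⊔ P2 ⊔ X : Submodule K V) = 3 := by rw [fr_sup_pt hXp hXm, hm]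
  have hXU : X ≤ W ⊔ Y1 := hXL.trans (sup_le_sup_right hPW _)
  have hπU : P1 ⊔ P2 ⊔ X ≤ W ⊔ Y1 := sup_le (hmW.trans le_sup_left) hXU
  have hXY : X ≠ Y1 := by rintro rfl; exact g1.2.1 hX
  have hY1π : ¬ Y1 ≤ P1 ⊔ P2 ⊔ X := by
    intro h
    have e := line_eq hXp g1.1 hXY hL hXL le_sup_right
    have hPπ : P ≤ P1 ⊔ P2 ⊔ X := by
      calc P ≤ P ⊔ Y1 := le_sup_left
        _ = X ⊔ Y1 := e.symm
        _ ≤ _ := sup_le le_sup_right h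
    have e1 : P1 ⊔ P2 ⊔ P = W :=
      eq_of_le_fr (sup_le hmW hPW) (by rw [fr_sup_pt hPp hPm, hm, hW])
    have e2 : W = P1 ⊔ P2 ⊔ X :=
      eq_of_le_fr (e1 ▸ sup_le le_sup_left hPπ) (by omega)
    exact g1.2.2.1 (e2 ▸ h)
  have hNπ := H.ev.plane_of_vertex hU hNU hv1 hπ hπU hX le_sup_right hY1π
  have hY2π : ¬ Y2 ≤ P1 ⊔ P2 ⊔ X := fun h => hY2 (h.trans hπU)
  have hU' : finrank K (P1 ⊔ P2 ⊔ X ⊔ Y2 : Submodule K V) = 4 := by rw [fr_sup_pt g2.1 hY2π, hπ]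
  obtain ⟨hNU', v, hv⟩ := H.sol _ _ hπ hNπ le_sup_left hU'
  have e := H.ev.vertex_eq H.q4 hU' hNU' hv p1 ((le_sup_left.trans le_sup_left).trans le_sup_left)
    p2 ((le_sup_right.trans le_sup_left).trans le_sup_left) n12 g2.1 le_sup_right
    (fun h => g2.2.2.1 (h.trans hmW)) (g2.2.2.2 P1 p1 p1W) (g2.2.2.2 P2 p2 p2W)
  rw [e]
  exact hv.2.2.2 X hX (le_sup_right.trans le_sup_left)

lemma not_le_join (H : CylHyp S) (hW : finrank K W = 3) (hN : NN S W = Nat.card K + 2)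
    {Y1 Y2 Q : Submodule K V} (g1 : GoodPt S W Y1) (g2 : GoodPt S W Y2) (hne : Y1 ≠ Y2)
    (hQ : finrank K Q = 1) (hQW : Q ≤ W) : ¬ Q ≤ Y1 ⊔ Y2 := by
  intro h
  have hQY : Q ≠ Y1 := by rintro rfl; exact g1.2.2.1 hQW
  have e := line_eq hQ g1.1 hQY (fr_line g1.1 g2.1 hne) h le_sup_left
  apply H.good_not_le hW hN g1 g2 hne
  calc Y2 ≤ Y1 ⊔ Y2 := le_sup_right
    _ = Q ⊔ Y1 := e.symm
    _ ≤ _ := sup_le_sup_right hQW _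

lemma claimB (H : CylHyp S) (hW : finrank K W = 3) (hN : NN S W = Nat.card K + 2)
    {Y1 Y2 P Z : Submodule K V} (g1 : GoodPt S W Y1) (g2 : GoodPt S W Y2) (hne : Y1 ≠ Y2)
    (hP : P ∈ S) (hPW : P ≤ W) (hZ : finrank K Z = 1) (hZU : Z ≤ P ⊔ Y1 ⊔ Y2)
    (hZY : ¬ Z ≤ Y1 ⊔ Y2) : Z ∈ S := by
  have hPp := H.ev.pt P hP
  have hPY : P ≠ Y1 := by rintro rfl; exact g1.2.1 hP
  have hL := fr_line hPp g1.1 hPY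
  have hY2 : ¬ Y2 ≤ P ⊔ Y1 := fun h =>
    H.good_not_le hW hN g1 g2 hne (h.trans (sup_le_sup_right hPW _))
  have hU : finrank K (P ⊔ Y1 ⊔ Y2 : Submodule K V) = 3 := by rw [fr_sup_pt g2.1 hY2, hL]
  have hZ2 : Z ≠ Y2 := by rintro rfl; exact hZY le_sup_right
  have hM := fr_line hZ g2.1 hZ2
  have hX : finrank K ((Z ⊔ Y2) ⊓ (P ⊔ Y1) : Submodule K V) = 1 := by
    have := fr_inf (A := Z ⊔ Y2) (B := P ⊔ Y1) (U := P ⊔ Y1 ⊔ Y2)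
      (sup_le hZU le_sup_right) le_sup_left (by omega) (fun h => hY2 (le_sup_right.trans h))
    omega
  set X := (Z ⊔ Y2) ⊓ (P ⊔ Y1) with hXdef
  have hX1 : X ≠ Y1 := by
    intro e
    have : Y1 ⊔ Y2 = Z ⊔ Y2 := line_eq g1.1 g2.1 hne hM (e ▸ inf_le_left) le_sup_right
    exact hZY (this ▸ le_sup_left)
  have hX2 : X ≠ Y2 := by
    intro e
    exact hY2 (e ▸ inf_le_right)
  have hXS : X ∈ S := H.ev.qsec_mem hL (g1.2.2.2 P hP hPW) g1.1 le_sup_right g1.2.1 hX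
    inf_le_right hX1
  have hA := H.claimA hW hN g1 g2 hne hP hPW hXS inf_le_right
  rw [line_eq hX g2.1 hX2 hM inf_le_left le_sup_right] at hA
  exact H.ev.qsec_mem hM hA g2.1 le_sup_right g2.2.1 hZ le_sup_left hZ2

lemma claimC (H : CylHyp S) (hW : finrank K W = 3) (hN : NN S W = Nat.card K + 2)
    {Y1 Y2 Y : Submodule K V} (g1 : GoodPt S W Y1) (g2 : GoodPt S W Y2) (hne : Y1 ≠ Y2)
    (hY : finrank K Y = 1) (hYL : Y ≤ Y1 ⊔ Y2) : GoodPt S W Y := by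
  have key : ∀ P ∈ S, P ≤ W → NN S (P ⊔ Y) = Nat.card K ∧ Y ∉ S := by
    intro P hP hPW
    have hPp := H.ev.pt P hP
    have hPJ := H.not_le_join hW hN g1 g2 hne hPp hPW
    have hPY : P ≠ Y := by rintro rfl; exact hPJ hYL
    refine H.ev.line_full H.qe (fr_line hPp hY hPY) hY le_sup_right fun R hR hRL hRY => ?_
    refine H.claimB hW hN g1 g2 hne hP hPW hR
      (hRL.trans (sup_le (le_sup_left.trans le_sup_left) (hYL.trans
        (sup_le_sup_right le_sup_right _)))) fun h => hPJ ?_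
    have := line_eq hR hY hRY (fr_line hPp hY hPY) hRL le_sup_right
    calc P ≤ P ⊔ Y := le_sup_left
      _ = R ⊔ Y := this.symm
      _ ≤ _ := sup_le h hYL
  obtain ⟨P, hP, hPW⟩ := exists_of_NN (S := S) (W := W) (by omega)
  exact ⟨hY, (key P hP hPW).2, fun h => H.not_le_join hW hN g1 g2 hne hY h hYL,
    fun P hP hPW => (key P hP hPW).1⟩

/-- The vertex of the cylinder. -/
lemma exists_T (H : CylHyp S) (hW : finrank K W = 3) (hN : NN S W = Nat.card K + 2) :
    ∃ T : Submodule K V, ∀ y : V, y ∈ T ↔ y = 0 ∨ GoodPt S W (span K {y}) := by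
  refine ⟨{ carrier := {y | y = 0 ∨ GoodPt S W (span K {y})}
            zero_mem' := Or.inl rfl
            add_mem' := ?_
            smul_mem' := ?_ }, fun y => Iff.rfl⟩
  · rintro a b (rfl | ha) hb
    · simpa using hb
    rcases hb with rfl | hb
    · simpa using Or.inr ha
    by_cases h0 : a + b = 0
    · exact Or.inl h0
    right
    have hab : span K {a + b} ≤ span K {a} ⊔ span K {b} := by
      rw [span_singleton_le_iff_mem]
      exact add_mem (mem_sup_left (mem_span_singleton_self a))
        (mem_sup_right (mem_span_singleton_self b))
    by_cases e : (span K {a} : Submodule K V) = span K {b}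
    · rw [← e, sup_idem] at hab
      rwa [pt_eq (finrank_span_singleton h0) ha.1 hab]
    · exact H.claimC hW hN ha hb e (finrank_span_singleton h0) hab
  · rintro c a (rfl | ha)
    · left; simp
    by_cases hc : c = 0
    · left; simp [hc]
    right
    rwa [span_singleton_smul_eq (IsUnit.mk0 c hc)]

theorem structure_thm (H : CylHyp S) (hW : finrank K W = 3) (hN : NN S W = Nat.card K + 2) :
    ∃ T : Submodule K V, W ⊓ T = ⊥ ∧ W ⊔ T = ⊤ ∧
      ∀ Q : Submodule K V, finrank K Q = 1 →
        (Q ∈ S ↔ (∃ P ∈ S, P ≤ W ∧ Q ≤ P ⊔ T) ∧ ¬ Q ≤ T) := by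
  obtain ⟨T, hT⟩ := H.exists_T hW hN
  have hgT : ∀ Y, GoodPt S W Y → Y ≤ T := by
    intro Y hY
    obtain ⟨y, hy0, rfl⟩ := pt_exists hY.1
    rw [span_singleton_le_iff_mem, hT]
    exact Or.inr hY
  have hTg : ∀ Y : Submodule K V, finrank K Y = 1 → Y ≤ T → GoodPt S W Y := by
    intro Y hY h
    obtain ⟨y, hy0, rfl⟩ := pt_exists hY
    rw [span_singleton_le_iff_mem, hT] at h
    exact h.resolve_left hy0
  have hver : ∀ Q : Submodule K V, finrank K Q = 1 → ¬ Q ≤ W →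
      ∃ v, IsVertex S (W ⊔ Q) v ∧ GoodPt S W v ∧ finrank K (W ⊔ Q : Submodule K V) = 4 := by
    intro Q hQ hQW
    have hU : finrank K (W ⊔ Q : Submodule K V) = 4 := by rw [fr_sup_pt hQ hQW, hW]
    obtain ⟨-, v, hv⟩ := H.sol W _ hW hN le_sup_left hU
    exact ⟨v, hv, H.vert_good hW hN le_sup_left hv, hU⟩
  refine ⟨T, ?_, ?_, ?_⟩
  · rw [eq_bot_iff]
    rintro x ⟨hx1, hx2⟩
    rcases (hT x).1 hx2 with h | h
    · exact h
    · exact absurd ((span_singleton_le_iff_mem x W).2 hx1) h.2.2.1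
  · rw [eq_top_iff]
    intro z _
    by_cases hz : z ∈ W
    · exact mem_sup_left hz
    have hz0 : z ≠ 0 := by rintro rfl; exact hz (zero_mem _)
    have hzW : ¬ span K {z} ≤ W := by rwa [span_singleton_le_iff_mem]
    obtain ⟨v, hv, hg, hU⟩ := hver _ (finrank_span_singleton hz0) hzW
    have e : W ⊔ v = W ⊔ span K {z} :=
      eq_of_le_fr (sup_le le_sup_left hv.2.1) (by rw [hU, fr_sup_pt hg.1 hg.2.2.1, hW])
    have : z ∈ W ⊔ v := by
      rw [e]; exact mem_sup_right (mem_span_singleton_self z)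
    exact sup_le_sup_left (hgT v hg) W this
  · intro Q hQ
    constructor
    · intro hQS
      refine ⟨?_, fun h => (hTg Q hQ h).2.1 hQS⟩
      by_cases hQW : Q ≤ W
      · exact ⟨Q, hQS, hQW, le_sup_left⟩
      obtain ⟨v, hv, hg, hU⟩ := hver Q hQ hQW
      have hQv : Q ≠ v := by rintro rfl; exact hg.2.1 hQS
      have hL := fr_line hQ hg.1 hQv
      have hP : finrank K ((Q ⊔ v) ⊓ W : Submodule K V) = 1 := by
        have := fr_inf (A := Q ⊔ v) (B := W) (U := W ⊔ Q) (sup_le le_sup_right hv.2.1)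
          le_sup_left (by omega) (fun h => hQW (le_sup_left.trans h))
        omega
      have hPv : (Q ⊔ v) ⊓ W ≠ v := fun e => hg.2.2.1 (e ▸ inf_le_right)
      refine ⟨(Q ⊔ v) ⊓ W, H.ev.qsec_mem hL (hv.2.2.2 Q hQS le_sup_right) hg.1 le_sup_right
        hg.2.1 hP inf_le_left hPv, inf_le_right, ?_⟩
      have e := line_eq hP hg.1 hPv hL inf_le_left le_sup_right
      calc Q ≤ Q ⊔ v := le_sup_left
        _ = (Q ⊔ v) ⊓ W ⊔ v := e.symm
        _ ≤ _ := sup_le_sup_left (hgT v hg) _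
    · rintro ⟨⟨P, hP, hPW, hQP⟩, hQT⟩
      obtain ⟨z, hz0, rfl⟩ := pt_exists hQ
      rw [span_singleton_le_iff_mem, mem_sup] at hQP
      obtain ⟨p, hp, t, ht, rfl⟩ := hQP
      by_cases ht0 : t = 0
      · subst ht0
        rw [add_zero] at hQ ⊢
        rwa [pt_eq hQ (H.ev.pt P hP) ((span_singleton_le_iff_mem p P).2 hp)]
      have htg := hTg (span K {t}) (finrank_span_singleton ht0)
        ((span_singleton_le_iff_mem t T).2 ht)
      have hPt : P ≠ span K {t} := by rintro e; exact htg.2.1 (e ▸ hP)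
      refine H.ev.qsec_mem (fr_line (H.ev.pt P hP) htg.1 hPt) (htg.2.2.2 P hP hPW) htg.1
        le_sup_right htg.2.1 hQ ?_ ?_
      · rw [span_singleton_le_iff_mem]
        exact add_mem (mem_sup_left hp) (mem_sup_right (mem_span_singleton_self t))
      · intro e
        exact hQT (e ▸ hgT _ htg)

end CylHyp
end PartC


section OPoly
set_option linter.unusedSectionVars false
set_option linter.unusedVariables false
open Classical
variable {K : Type*} [Field K] [Fintype K]

/-- o-polynomial condition -/
structure OFun (f : K → K) : Prop where
  two : (2 : K) = 0
  inj : ∀ x y, x ≠ y → f x ≠ f y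
  slope : ∀ s y z, y ≠ s → z ≠ s → y ≠ z → (f y + f s) * (z + s) ≠ (f z + f s) * (y + s)

namespace OFun
variable {f : K → K}

lemma charP (hf : OFun f) : CharP K 2 :=
  CharTwo.of_one_ne_zero_of_two_eq_zero one_ne_zero hf.two

lemma add_ne (hf : OFun f) {x y : K} (h : x ≠ y) : x + y ≠ 0 := by
  intro e
  apply h
  linear_combination e - y * hf.two

lemma h_inj (hf : OFun f) {q : ℕ} (hq : Fintype.card K = q + 2) (hq0 : 0 < q) (s : K) :
    Function.Injective (fun y => (f y + f s) * (y + s) ^ q) := by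
  have hw : ∀ w : K, w ≠ 0 → w ^ q * w = 1 := by
    intro w hw
    have := FiniteField.pow_card_sub_one_eq_one w hw
    rw [hq] at this
    rw [← pow_succ]
    simpa using this
  have hs : s + s = 0 := by linear_combination s * hf.two
  have h0 : ∀ y, y ≠ s → (f y + f s) * (y + s) ^ q ≠ 0 := by
    intro y hy
    exact mul_ne_zero (hf.add_ne (hf.inj _ _ hy)) (pow_ne_zero _ (hf.add_ne hy))
  intro y z hyz
  simp only at hyz
  by_contra hne
  by_cases hy : y = s
  · subst hy
    rw [hs, zero_pow hq0.ne', mul_zero] at hyz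
    exact h0 z (Ne.symm hne) hyz.symm
  by_cases hz : z = s
  · subst hz
    rw [hs, zero_pow hq0.ne', mul_zero] at hyz
    exact h0 y hne hyz
  apply hf.slope s y z hy hz hne
  have h1 := hw _ (hf.add_ne hy)
  have h2 := hw _ (hf.add_ne hz)
  linear_combination (y + s) * (z + s) * hyz - (f y + f s) * (z + s) * h1
    + (f z + f s) * (y + s) * h2

lemma sum_h (hf : OFun f) {q : ℕ} (hq : Fintype.card K = q + 2) (hq0 : 0 < q) (s : K) (k : ℕ)
    (hk : k < q + 1) : ∑ y, ((f y + f s) * (y + s) ^ q) ^ k = 0 := by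
  have hb := Finite.injective_iff_bijective.1 (hf.h_inj hq hq0 s)
  rw [hb.sum_comp (fun z => z ^ k)]
  exact FiniteField.sum_pow_lt_card_sub_one _ k (by omega)

lemma sum_f (hf : OFun f) {q : ℕ} (hq : Fintype.card K = q + 2) (hq0 : 0 < q) : ∑ y, f y = 0 := by
  have hi : Function.Injective f := fun x y h => by
    by_contra hne
    exact hf.inj x y hne h
  have hb := Finite.injective_iff_bijective.1 hi
  rw [hb.sum_comp (fun z => z)]
  have := FiniteField.sum_pow_lt_card_sub_one K 1 (by omega)
  simpa using this

lemma interp (hf : OFun f) {q : ℕ} (hq : Fintype.card K = q + 2) (x : K) :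
    f x = ∑ y, f y * (1 + (x + y) ^ (q + 1)) := by
  rw [Finset.sum_eq_single x]
  · have hs : x + x = 0 := by linear_combination x * hf.two
    rw [hs, zero_pow (by omega)]; ring
  · intro y _ hy
    have := FiniteField.pow_card_sub_one_eq_one (x + y) (hf.add_ne hy.symm)
    rw [hq] at this
    simp only [Nat.add_succ_sub_one] at this
    rw [this]
    linear_combination f y * hf.two
  · simp

lemma add_two (hf : OFun f) (x y : K) : (x + y) ^ 2 = x ^ 2 + y ^ 2 := by
  linear_combination x * y * hf.two

lemma add_four (hf : OFun f) (x y : K) : (x + y) ^ 4 = x ^ 4 + y ^ 4 := by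
  have : (x + y) ^ 4 = ((x + y) ^ 2) ^ 2 := by ring
  rw [this, hf.add_two, hf.add_two]; ring

lemma add_six (hf : OFun f) (x y : K) :
    (x + y) ^ 6 = x ^ 6 + x ^ 4 * y ^ 2 + x ^ 2 * y ^ 4 + y ^ 6 := by
  have : (x + y) ^ 6 = (x + y) ^ 4 * (x + y) ^ 2 := by ring
  rw [this, hf.add_two, hf.add_four]; ring

lemma sum_shift (k : ℕ) (hk : k < Fintype.card K - 1) (s : K) : ∑ y : K, (y + s) ^ k = 0 := by
  refine (Equiv.sum_comp (Equiv.addRight s) (fun z => z ^ k)).trans ?_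
  exact FiniteField.sum_pow_lt_card_sub_one _ k hk

theorem four (hf : OFun f) (hq : Fintype.card K = 4) :
    ∃ a d : K, a ≠ 0 ∧ ∀ x, f x = a * x ^ 2 + d := by
  have m0 := hf.sum_f (q := 2) hq (by omega)
  have m2 : ∑ y, f y * y ^ 2 = 0 := by
    have h1 := hf.sum_h (q := 2) hq (by omega) 0 1 (by omega)
    have h2 : ∑ y : K, y ^ 2 = 0 := FiniteField.sum_pow_lt_card_sub_one _ 2 (by omega)
    simp only [pow_one, add_zero, add_mul, Finset.sum_add_distrib, ← Finset.mul_sum] at h1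
    rw [h2] at h1
    simpa using h1
  have hfx : ∀ x, f x = (∑ y, f y * y) * x ^ 2 + ∑ y, f y * y ^ 3 := by
    intro x
    have h1 := hf.interp (q := 2) hq x
    have h2 : ∀ y, f y * (1 + (x + y) ^ (2 + 1)) =
        f y + (f y * y ^ 3 + f y * y * x ^ 2 + f y * y ^ 2 * x + f y * x ^ 3) := by
      intro y
      have : (x + y) ^ (2 + 1) = (x + y) ^ 2 * (x + y) := by ring
      rw [this, hf.add_two]; ring
    rw [Finset.sum_congr rfl (fun y _ => h2 y)] at h1
    simp only [Finset.sum_add_distrib, ← Finset.sum_mul] at h1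
    rw [m0, m2] at h1
    rw [h1]; ring
  refine ⟨_, _, ?_, hfx⟩
  intro h0
  apply hf.inj 0 1 zero_ne_one
  rw [hfx 0, hfx 1, h0]; ring

lemma exists_third (hq : Fintype.card K = 8) : ∃ t : K, t ≠ 0 ∧ t ≠ 1 := by
  have : ({0, 1} : Finset K).card < Fintype.card K := by
    have := Finset.card_le_two (a := (0 : K)) (b := 1)
    omega
  obtain ⟨t, ht⟩ := Finset.exists_mem_notMem_of_card_lt_card (s := {0, 1}) (t := Finset.univ) this
  simp at ht
  exact ⟨t, ht.1, ht.2⟩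

lemma eight_form (hf : OFun f) (hq : Fintype.card K = 8) :
    ∃ a b c d : K, ∀ x, f x = a * x ^ 2 + b * x ^ 4 + c * x ^ 6 + d := by
  have m0 := hf.sum_f (q := 6) hq (by omega)
  have hs : ∀ s : K, (∑ y, f y * y ^ 6) + (∑ y, f y * y ^ 4) * s ^ 2 +
      (∑ y, f y * y ^ 2) * s ^ 4 = 0 := by
    intro s
    have h1 := hf.sum_h (q := 6) hq (by omega) s 1 (by omega)
    have h2 := sum_shift (K := K) 6 (by omega) s
    simp only [pow_one, add_mul, Finset.sum_add_distrib] at h1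
    rw [← Finset.mul_sum, h2] at h1
    have h3 : ∀ y, f y * (y + s) ^ 6 =
        f y * y ^ 6 + f y * y ^ 4 * s ^ 2 + f y * y ^ 2 * s ^ 4 + f y * s ^ 6 := by
      intro y
      rw [hf.add_six]; ring
    rw [Finset.sum_congr rfl (fun y _ => h3 y)] at h1
    simp only [Finset.sum_add_distrib, ← Finset.sum_mul] at h1
    rw [m0] at h1
    linear_combination h1
  obtain ⟨t, t0, t1⟩ := exists_third hq
  have m6 : ∑ y, f y * y ^ 6 = 0 := by
    have := hs 0
    simpa using this
  have e1 := hs 1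
  have e2 := hs t
  rw [m6] at e1 e2
  have m2 : ∑ y, f y * y ^ 2 = 0 := by
    have h3 : (∑ y, f y * y ^ 2) * (t ^ 2 * (t + 1) ^ 2) = 0 := by
      rw [hf.add_two]
      linear_combination e2 - t ^ 2 * e1 + (∑ y, f y * y ^ 2) * t ^ 2 * hf.two
    rcases mul_eq_zero.1 h3 with h | h
    · exact h
    · exact absurd h (mul_ne_zero (pow_ne_zero _ t0) (pow_ne_zero _ (hf.add_ne t1)))
  have m4 : ∑ y, f y * y ^ 4 = 0 := by
    rw [m2] at e1
    linear_combination e1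
  refine ⟨∑ y, f y * y ^ 5, ∑ y, f y * y ^ 3, ∑ y, f y * y, ∑ y, f y * y ^ 7, fun x => ?_⟩
  have h1 := hf.interp (q := 6) hq x
  have h2 : ∀ y, f y * (1 + (x + y) ^ (6 + 1)) =
      f y + (f y * y ^ 7 + f y * y ^ 6 * x + f y * y ^ 5 * x ^ 2 + f y * y ^ 4 * x ^ 3
        + f y * y ^ 3 * x ^ 4 + f y * y ^ 2 * x ^ 5 + f y * y * x ^ 6 + f y * x ^ 7) := by
    intro y
    have : (x + y) ^ (6 + 1) = (x + y) ^ 6 * (x + y) := by ring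
    rw [this, hf.add_six]; ring
  rw [Finset.sum_congr rfl (fun y _ => h2 y)] at h1
  simp only [Finset.sum_add_distrib, ← Finset.sum_mul] at h1
  rw [m0, m2, m4, m6] at h1
  rw [h1]; ring

lemma cube_sum (hf : OFun f) (hq : Fintype.card K = 8) (A B C : K) :
    ∑ z : K, (A * z + B * z ^ 3 + C * z ^ 5) ^ 3 = A * (A * C + B ^ 2) := by
  have h8 : ∀ z : K, z ^ 8 = z := fun z => by
    have := FiniteField.pow_card z
    rwa [hq] at this
  have s : ∀ k < 7, ∑ z : K, z ^ k = 0 := fun k hk =>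
    FiniteField.sum_pow_lt_card_sub_one _ k (by omega)
  have s7 : ∑ z : K, z ^ 7 = 1 := by
    have h1 : ∀ z : K, z ^ 7 = 1 - if z = 0 then 1 else 0 := by
      intro z
      split_ifs with h
      · rw [h]; ring
      · have := FiniteField.pow_card_sub_one_eq_one z h
        rw [hq] at this
        simpa using this
    rw [Finset.sum_congr rfl (fun z _ => h1 z), Finset.sum_sub_distrib]
    simp only [Finset.sum_const, Finset.card_univ, hq, Finset.sum_ite_eq', Finset.mem_univ, if_true,
      nsmul_eq_mul]
    push_cast
    linear_combination 3 * hf.two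
  have h : ∀ z : K, (A * z + B * z ^ 3 + C * z ^ 5) ^ 3 =
      A ^ 3 * z ^ 3 + 3 * A ^ 2 * B * z ^ 5 + (3 * A ^ 2 * C + 3 * A * B ^ 2) * z ^ 7
      + (B ^ 3 + 6 * A * B * C) * z ^ 2 + (3 * A * C ^ 2 + 3 * B ^ 2 * C) * z ^ 4
      + 3 * B * C ^ 2 * z ^ 6 + C ^ 3 * z ^ 1 := by
    intro z
    linear_combination ((B ^ 3 + 6 * A * B * C) * z + (3 * A * C ^ 2 + 3 * B ^ 2 * C) * z ^ 3
      + 3 * B * C ^ 2 * z ^ 5 + C ^ 3 * z ^ 7 + C ^ 3) * h8 z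
  rw [Finset.sum_congr rfl (fun z _ => h z)]
  simp only [Finset.sum_add_distrib, ← Finset.mul_sum]
  rw [s 3 (by omega), s 5 (by omega), s7, s 2 (by omega), s 4 (by omega), s 6 (by omega),
    s 1 (by omega)]
  linear_combination (A ^ 2 * C + A * B ^ 2) * hf.two

theorem eight (hf : OFun f) (hq : Fintype.card K = 8) :
    (∃ a d : K, a ≠ 0 ∧ ∀ x, f x = a * x ^ 2 + d) ∨
    (∃ a d : K, a ≠ 0 ∧ ∀ x, f x = a * x ^ 4 + d) ∨
    (∃ c g d : K, c ≠ 0 ∧ ∀ x, f x = c * (x + g) ^ 6 + d) := by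
  obtain ⟨a, b, c, d, hfx⟩ := hf.eight_form hq
  have h8 : ∀ z : K, z ^ 8 = z := fun z => by
    have := FiniteField.pow_card z
    rwa [hq] at this
  have key : ∀ s : K, (a + c * s ^ 4) * (a * c + b ^ 2) = 0 := by
    intro s
    have h1 := hf.sum_h (q := 6) hq (by omega) s 3 (by omega)
    rw [← Equiv.sum_comp (Equiv.addRight s)] at h1
    have h2 : ∀ z : K, ((f (Equiv.addRight s z) + f s) * (Equiv.addRight s z + s) ^ 6) ^ 3 =
        ((a + c * s ^ 4) * z + (b + c * s ^ 2) * z ^ 3 + c * z ^ 5) ^ 3 := by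
      intro z
      congr 1
      have h3 : Equiv.addRight s z + s = z := by
        simp only [Equiv.coe_addRight]
        linear_combination s * hf.two
      rw [h3]
      simp only [Equiv.coe_addRight]
      rw [hfx, hfx, hf.add_two, hf.add_four, hf.add_six]
      linear_combination ((a + c * s ^ 4) + (b + c * s ^ 2) * z ^ 2 + c * z ^ 4) * h8 z
        + z ^ 6 * (a * s ^ 2 + b * s ^ 4 + c * s ^ 6 + d) * hf.two
    rw [Finset.sum_congr rfl (fun z _ => h2 z), hf.cube_sum hq] at h1
    linear_combination h1 - (a + c * s ^ 4) * (c ^ 2 * s ^ 4 + b * c * s ^ 2) * hf.two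
  by_cases hc : c = 0
  · subst hc
    have h0 := key 0
    simp only [zero_mul, add_zero, mul_zero, zero_add] at h0
    rcases mul_eq_zero.1 h0 with h | h
    · right; left
      subst h
      refine ⟨b, d, ?_, fun x => by rw [hfx]; ring⟩
      rintro rfl
      apply hf.inj 0 1 zero_ne_one
      rw [hfx, hfx]; ring
    · left
      have hb : b = 0 := by simpa using h
      subst hb
      refine ⟨a, d, ?_, fun x => by rw [hfx]; ring⟩
      rintro rfl
      apply hf.inj 0 1 zero_ne_one
      rw [hfx, hfx]; ring
  · right; right
    have hab : a * c + b ^ 2 = 0 := by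
      by_contra hne
      have h0 := (mul_eq_zero.1 (key 0)).resolve_right hne
      have h1 := (mul_eq_zero.1 (key 1)).resolve_right hne
      apply hc
      linear_combination h1 - h0
    obtain ⟨e, rfl⟩ : ∃ e, b = c * e := ⟨b / c, by field_simp⟩
    have ha : a = c * e ^ 2 := by
      apply mul_left_cancel₀ hc
      linear_combination hab - c ^ 2 * e ^ 2 * hf.two
    subst ha
    refine ⟨c, e ^ 4, d + c * e ^ 3, hc, fun x => ?_⟩
    have he : (e ^ 4) ^ 2 = e := by rw [← pow_mul]; exact h8 e
    have h6 : (x + e ^ 4) ^ 6 = (x ^ 2 + e) ^ 3 := by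
      calc (x + e ^ 4) ^ 6 = ((x + e ^ 4) ^ 2) ^ 3 := by ring
        _ = (x ^ 2 + e) ^ 3 := by rw [hf.add_two, he]
    rw [hfx, h6]
    linear_combination -(c * x ^ 4 * e + c * x ^ 2 * e ^ 2 + c * e ^ 3) * hf.two

end OFun
end OPoly


section PartD
set_option linter.unusedSectionVars false
set_option linter.unusedVariables false
open Classical Module Submodule
variable {K V : Type*} [Field K] [Finite K] [AddCommGroup V] [Module K V] [Fintype V]
  [Fintype (Submodule K V)]

lemma span_smul_eq {c : K} (hc : c ≠ 0) {v w : V} (h : w = c • v) :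
    (span K {w} : Submodule K V) = span K {v} := by
  rw [h, span_singleton_smul_eq (IsUnit.mk0 c hc)]

lemma exists_g (e0 e1 e2 : V)
    (h : ∀ x y z : K, x • e0 + y • e1 + z • e2 = 0 → x = 0 ∧ y = 0 ∧ z = 0) :
    ∃ g : (Fin 3 → K) →ₗ[K] V, Function.Injective g ∧
      ∀ x y z : K, g ![x, y, z] = x • e0 + y • e1 + z • e2 := by
  refine ⟨(LinearMap.proj 0 : (Fin 3 → K) →ₗ[K] K).smulRight e0 +
    (LinearMap.proj 1 : (Fin 3 → K) →ₗ[K] K).smulRight e1 +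
    (LinearMap.proj 2 : (Fin 3 → K) →ₗ[K] K).smulRight e2, ?_, ?_⟩
  · rw [← LinearMap.ker_eq_bot, LinearMap.ker_eq_bot']
    intro m hm
    obtain ⟨h0, h1, h2⟩ := h (m 0) (m 1) (m 2) (by simpa using hm)
    ext i
    fin_cases i
    · exact h0
    · exact h1
    · exact h2
  · intro x y z
    simp

namespace CylHyp
variable {S : Finset (Submodule K V)} {W : Submodule K V}

set_option maxHeartbeats 2000000 in
lemma param (H : CylHyp S) (hW : finrank K W = 3) (hN : NN S W = Nat.card K + 2)
    (h2 : (2 : K) = 0) :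
    ∃ (a b u : V) (f : K → K), OFun f ∧
      (∀ x y z : K, x • a + y • b + z • u = 0 → x = 0 ∧ y = 0 ∧ z = 0) ∧
      ∀ P : Submodule K V, (P ∈ S ∧ P ≤ W) ↔
        P = span K {a} ∨ P = span K {b} ∨ ∃ x, P = span K {u + x • a + f x • b} := by
  obtain ⟨P3, hP3, hP3W⟩ := exists_of_NN (S := S) (W := W) (by omega)
  obtain ⟨P1, P2, hP1, hP1W, hP2, hP2W, n12, n1, n2⟩ := H.two_others hN P3
  have h3 := H.not_le_line hW hN hP3 hP1 hP1W hP2 hP2W n12 n1 n2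
  have hWe : P1 ⊔ P2 ⊔ P3 = W := eq_of_le_fr (sup_le (sup_le hP1W hP2W) hP3W) (by
    rw [fr_sup_pt (H.ev.pt _ hP3) h3, fr_line (H.ev.pt _ hP1) (H.ev.pt _ hP2) n12, hW])
  obtain ⟨a, ha, rfl⟩ := pt_exists (H.ev.pt _ hP1)
  obtain ⟨b, hb, rfl⟩ := pt_exists (H.ev.pt _ hP2)
  obtain ⟨u, hu, rfl⟩ := pt_exists (H.ev.pt _ hP3)
  have mem : ∀ w : V, w ∈ (span K {w} : Submodule K V) := fun w => mem_span_singleton_self w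
  have hind : ∀ x y z : K, x • a + y • b + z • u = 0 → x = 0 ∧ y = 0 ∧ z = 0 := by
    intro x y z h
    have hz : z = 0 := by
      by_contra hz
      apply h3
      rw [span_singleton_le_iff_mem]
      have : u = (-(z⁻¹ * x)) • a + (-(z⁻¹ * y)) • b := by
        have : u = z⁻¹ • (z • u) := by rw [smul_smul, inv_mul_cancel₀ hz, one_smul]
        rw [this, show z • u = -(x • a + y • b) from (neg_eq_of_add_eq_zero_right h).symm]
        module
      rw [this]
      exact add_mem (mem_sup_left (smul_mem _ _ (mem a))) (mem_sup_right (smul_mem _ _ (mem b)))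
    subst hz
    have hy : y = 0 := by
      by_contra hy
      apply n12
      symm
      apply pt_eq (H.ev.pt _ hP2) (H.ev.pt _ hP1)
      rw [span_singleton_le_iff_mem]
      have : b = (-(y⁻¹ * x)) • a := by
        have : b = y⁻¹ • (y • b) := by rw [smul_smul, inv_mul_cancel₀ hy, one_smul]
        rw [this, show y • b = -(x • a) from
          (neg_eq_of_add_eq_zero_right (by simpa using h)).symm]
        module
      rw [this]
      exact smul_mem _ _ (mem a)
    subst hy
    refine ⟨?_, rfl, rfl⟩
    by_contra hx
    exact ha ((smul_eq_zero.1 (by simpa using h)).resolve_left hx)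
  have hnz : ∀ x y : K, u + x • a + y • b ≠ 0 := by
    intro x y h
    have := (hind x y 1 (by rw [← h]; module)).2.2
    exact one_ne_zero this
  have hsp : ∀ x y x' y' : K, (span K {u + x • a + y • b} : Submodule K V) =
      span K {u + x' • a + y' • b} → x = x' ∧ y = y' := by
    intro x y x' y' h
    have h1 : u + x • a + y • b ∈ span K {u + x' • a + y' • b} := h ▸ mem _
    obtain ⟨c, hc⟩ := mem_span_singleton.1 h1
    have h4 := hind (c * x' - x) (c * y' - y) (c - 1) (by
      have : c • (u + x' • a + y' • b) - (u + x • a + y • b) = 0 := by rw [hc, sub_self]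
      rw [← this]; module)
    have hc1 : c = 1 := by linear_combination h4.2.2
    rw [hc1] at h4
    exact ⟨by linear_combination -h4.1, by linear_combination -h4.2.1⟩
  have hspa : ∀ x y : K, (span K {a} : Submodule K V) ≠ span K {u + x • a + y • b} := by
    intro x y h
    have h1 : u + x • a + y • b ∈ span K {a} := h ▸ mem _
    obtain ⟨c, hc⟩ := mem_span_singleton.1 h1
    have h4 := hind (x - c) y 1 (by
      have : (u + x • a + y • b) - c • a = 0 := by rw [hc, sub_self]
      rw [← this]; module)
    exact one_ne_zero h4.2.2
  have hspb : ∀ x y : K, (span K {b} : Submodule K V) ≠ span K {u + x • a + y • b} := by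
    intro x y h
    have h1 : u + x • a + y • b ∈ span K {b} := h ▸ mem _
    obtain ⟨c, hc⟩ := mem_span_singleton.1 h1
    have h4 := hind x (y - c) 1 (by
      have : (u + x • a + y • b) - c • b = 0 := by rw [hc, sub_self]
      rw [← this]; module)
    exact one_ne_zero h4.2.2
  have haW : a ∈ W := hP1W (mem a)
  have hbW : b ∈ W := hP2W (mem b)
  have huW : u ∈ W := hP3W (mem u)
  have hvW : ∀ x y : K, span K {u + x • a + y • b} ≤ W := by
    intro x y
    rw [span_singleton_le_iff_mem]
    exact add_mem (add_mem huW (smul_mem _ _ haW)) (smul_mem _ _ hbW)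
  have hex : ∀ x : K, ∃ y : K, span K {u + x • a + y • b} ∈ S := by
    intro x
    have hne := hspb x 0
    have hfr : finrank K (span K {u + x • a + (0 : K) • b} : Submodule K V) = 1 :=
      finrank_span_singleton (hnz x 0)
    have hM := fr_line (H.ev.pt _ hP2) hfr hne
    have hN2 := H.ev.plane_two hW hN hP2 le_sup_left (sup_le hP2W (hvW x 0)) hM
    have h5 : 1 < (S.filter (fun P => P ≤ span K {b} ⊔ span K {u + x • a + (0 : K) • b})).card := by
      change 1 < NN S _
      omega
    obtain ⟨Q, hQ, hQb⟩ := Finset.exists_mem_ne h5 (span K {b})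
    obtain ⟨hQS, hQM⟩ := Finset.mem_filter.1 hQ
    obtain ⟨w, hw, rfl⟩ := pt_exists (H.ev.pt _ hQS)
    rw [span_singleton_le_iff_mem, mem_sup] at hQM
    obtain ⟨y1, hy1, y2, hy2, hw2⟩ := hQM
    obtain ⟨c, rfl⟩ := mem_span_singleton.1 hy1
    obtain ⟨d, rfl⟩ := mem_span_singleton.1 hy2
    have hd : d ≠ 0 := by
      rintro rfl
      apply hQb
      apply pt_eq (H.ev.pt _ hQS) (H.ev.pt _ hP2)
      rw [span_singleton_le_iff_mem, ← hw2, zero_smul, add_zero]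
      exact smul_mem _ _ (mem b)
    refine ⟨d⁻¹ * c, ?_⟩
    rwa [← span_smul_eq hd (v := u + x • a + (d⁻¹ * c) • b) (w := w)]
    rw [← hw2]
    match_scalars <;> field_simp
    ring
  choose f hf using hex
  refine ⟨a, b, u, f, ⟨h2, ?_, ?_⟩, hind, ?_⟩
  · intro x y hxy e
    have n : (span K {u + x • a + f x • b} : Submodule K V) ≠ span K {u + y • a + f y • b} :=
      fun h => hxy (hsp _ _ _ _ h).1
    refine H.not_le_line hW hN (hf x) hP1 hP1W (hf y) (hvW _ _) (hspa _ _) (hspa _ _) n.symm ?_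
    rw [span_singleton_le_iff_mem]
    have : u + x • a + f x • b = (x - y) • a + (u + y • a + f y • b) := by rw [e]; module
    rw [this]
    exact add_mem (mem_sup_left (smul_mem _ _ (mem a))) (mem_sup_right (mem _))
  · intro s y z hys hzs hyz e
    have n : ∀ x y : K, x ≠ y → (span K {u + x • a + f x • b} : Submodule K V) ≠
        span K {u + y • a + f y • b} := fun x y hxy h => hxy (hsp _ _ _ _ h).1
    refine H.not_le_line hW hN (hf y) (hf z) (hvW _ _) (hf s) (hvW _ _) (n _ _ hzs)
      (n _ _ hyz.symm) (n _ _ hys.symm) ?_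
    rw [span_singleton_le_iff_mem]
    have hzs' : z - s ≠ 0 := sub_ne_zero.2 hzs
    have hl : (y - s) / (z - s) * (z - s) = y - s := div_mul_cancel₀ _ hzs'
    set l := (y - s) / (z - s)
    have hl2 : l * (f z - f s) = f y - f s := by
      apply mul_right_cancel₀ hzs'
      linear_combination (f z - f s) * hl - e + (f y * s + f s * z - f z * s - f s * y) * h2
    have : u + y • a + f y • b = l • (u + z • a + f z • b) + (1 - l) • (u + s • a + f s • b) := by
      match_scalars
      · ring
      · linear_combination -hl
      · linear_combination -hl2
    rw [this]
    exact add_mem (mem_sup_left (smul_mem _ _ (mem _))) (mem_sup_right (smul_mem _ _ (mem _)))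
  · intro P
    constructor
    · rintro ⟨hP, hPW⟩
      by_contra! hcon
      obtain ⟨c1, c2, c3⟩ := hcon
      have hPn := H.not_le_line hW hN hP hP1 hP1W hP2 hP2W n12 c1.symm c2.symm
      obtain ⟨w, hw, rfl⟩ := pt_exists (H.ev.pt _ hP)
      rw [← hWe, span_singleton_le_iff_mem, mem_sup] at hPW
      obtain ⟨w1, hw1, w2, hw2, rfl⟩ := hPW
      obtain ⟨x1, hx1, x2, hx2, rfl⟩ := mem_sup.1 hw1
      obtain ⟨x, rfl⟩ := mem_span_singleton.1 hx1
      obtain ⟨y, rfl⟩ := mem_span_singleton.1 hx2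
      obtain ⟨z, rfl⟩ := mem_span_singleton.1 hw2
      have hz : z ≠ 0 := by
        rintro rfl
        apply hPn
        rw [span_singleton_le_iff_mem, zero_smul, add_zero]
        exact hw1
      have hP' := hP
      have c3' := c3
      rw [span_smul_eq hz (v := u + (z⁻¹ * x) • a + (z⁻¹ * y) • b) (by
        match_scalars <;> field_simp)] at c2 hP'
      refine H.not_le_line hW hN hP' hP2 hP2W (hf (z⁻¹ * x)) (hvW _ _) (hspb _ _) c2.symm ?_ ?_
      · intro h
        apply c3 (z⁻¹ * x)
        rw [h]
        exact span_smul_eq hz (by match_scalars <;> field_simp)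
      · rw [span_singleton_le_iff_mem]
        have : u + (z⁻¹ * x) • a + (z⁻¹ * y) • b = (z⁻¹ * y - f (z⁻¹ * x)) • b +
          (u + (z⁻¹ * x) • a + f (z⁻¹ * x) • b) := by module
        rw [this]
        exact add_mem (mem_sup_left (smul_mem _ _ (mem _))) (mem_sup_right (mem _))
    · rintro (rfl | rfl | ⟨x, rfl⟩)
      · exact ⟨hP1, hP1W⟩
      · exact ⟨hP2, hP2W⟩
      · exact ⟨hf x, hvW _ _⟩

set_option maxHeartbeats 2000000 in
/-- Regularity of the hyperoval. -/
theorem regular (H : CylHyp S) (hW : finrank K W = 3) (hN : NN S W = Nat.card K + 2)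
    (hq : Nat.card K = 4 ∨ Nat.card K = 8) :
    ∃ g : (Fin 3 → K) →ₗ[K] V, Function.Injective g ∧
      ∀ P : Submodule K V, (P ∈ S ∧ P ≤ W) ↔
        (∃ s t : K, ¬(s = 0 ∧ t = 0) ∧ P = span K {g ![s ^ 2, s * t, t ^ 2]}) ∨
        P = span K {g ![0, 1, 0]} := by
  have := Fintype.ofFinite K
  rw [Nat.card_eq_fintype_card] at hq
  have h2 : (2 : K) = 0 := by
    have h := FiniteField.cast_card_eq_zero K
    rcases hq with hq | hq <;> rw [hq] at h
    · have : (2 : K) ^ 2 = 0 := by rw [← h]; norm_num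
      exact pow_eq_zero_iff (two_ne_zero) |>.1 this
    · have : (2 : K) ^ 3 = 0 := by rw [← h]; norm_num
      exact pow_eq_zero_iff (three_ne_zero) |>.1 this
  obtain ⟨a, b, u, f, hf, hind, hO⟩ := H.param hW hN h2
  have hcase : (∃ a d : K, a ≠ 0 ∧ ∀ x, f x = a * x ^ 2 + d) ∨
    (Fintype.card K = 8 ∧ ∃ a d : K, a ≠ 0 ∧ ∀ x, f x = a * x ^ 4 + d) ∨
    (Fintype.card K = 8 ∧ ∃ c g d : K, c ≠ 0 ∧ ∀ x, f x = c * (x + g) ^ 6 + d) := by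
    rcases hq with hq | hq
    · exact Or.inl (hf.four hq)
    · rcases hf.eight hq with h | h | h
      · exact Or.inl h
      · exact Or.inr (Or.inl ⟨hq, h⟩)
      · exact Or.inr (Or.inr ⟨hq, h⟩)
  simp only [hO]
  rcases hcase with ⟨c, d, hc, hfx⟩ | ⟨h8, c, d, hc, hfx⟩ | ⟨h8, c, γ, d, hc, hfx⟩
  · obtain ⟨g, hg, hgx⟩ := exists_g (K := K) (u + d • b) a (c • b) (by
      intro x y z h
      obtain ⟨h0, h1, h2⟩ := hind y (x * d + z * c) x (by rw [← h]; module)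
      subst h2
      refine ⟨rfl, h0, ?_⟩
      simpa [hc] using h1)
    refine ⟨g, hg, fun P => ?_⟩
    simp only [hgx]
    constructor
    · rintro (rfl | rfl | ⟨x, rfl⟩)
      · right; congr 2; module
      · left
        refine ⟨0, 1, by simp, ?_⟩
        symm
        exact span_smul_eq hc (by module)
      · left
        refine ⟨1, x, by simp, ?_⟩
        rw [hfx]
        congr 2
        module
    · rintro (⟨s, t, hst, rfl⟩ | rfl)
      · by_cases hs : s = 0
        · subst hs
          have ht : t ≠ 0 := fun h => hst ⟨rfl, h⟩
          right; left
          exact span_smul_eq (mul_ne_zero hc (pow_ne_zero 2 ht)) (by module)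
        · right; right
          obtain ⟨r, rfl⟩ : ∃ r, t = s * r := ⟨t / s, by field_simp⟩
          refine ⟨r, ?_⟩
          rw [hfx]
          exact span_smul_eq (pow_ne_zero 2 hs) (by module)
      · left; congr 2; module
  · have hp : ∀ z : K, z ^ 8 = z := fun z => by
      have := FiniteField.pow_card z
      rwa [h8] at this
    obtain ⟨g, hg, hgx⟩ := exists_g (K := K) (u + d • b) (c • b) a (by
      intro x y z h
      obtain ⟨h0, h1, h2⟩ := hind z (x * d + y * c) x (by rw [← h]; module)
      subst h2
      refine ⟨rfl, ?_, h0⟩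
      simpa [hc] using h1)
    refine ⟨g, hg, fun P => ?_⟩
    simp only [hgx]
    constructor
    · rintro (rfl | rfl | ⟨x, rfl⟩)
      · left
        refine ⟨0, 1, by simp, ?_⟩
        congr 2
        module
      · right
        symm
        exact span_smul_eq hc (by module)
      · left
        refine ⟨1, x ^ 4, by simp, ?_⟩
        rw [hfx]
        congr 2
        match_scalars
        · ring
        · linear_combination -hp x
        · ring
    · rintro (⟨s, t, hst, rfl⟩ | rfl)
      · by_cases hs : s = 0
        · subst hs
          have ht : t ≠ 0 := fun h => hst ⟨rfl, h⟩
          left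
          exact span_smul_eq (pow_ne_zero 2 ht) (by module)
        · right; right
          obtain ⟨r, rfl⟩ : ∃ r, t = s * r := ⟨t / s, by field_simp⟩
          refine ⟨r ^ 2, ?_⟩
          rw [hfx]
          refine span_smul_eq (pow_ne_zero 2 hs) ?_
          match_scalars
          · ring
          · linear_combination -(s ^ 2 * c) * hp r
          · ring
      · right; left
        exact span_smul_eq hc (by module)
  · have hp : ∀ z : K, z ≠ 0 → z ^ 7 = 1 := fun z hz => by
      have := FiniteField.pow_card_sub_one_eq_one z hz
      rwa [h8] at this
    obtain ⟨g, hg, hgx⟩ := exists_g (K := K) (c • b) (u + γ • a + d • b) a (by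
      intro x y z h
      obtain ⟨h0, h1, h2⟩ := hind (y * γ + z) (x * c + y * d) y (by rw [← h]; module)
      subst h2
      refine ⟨?_, rfl, ?_⟩
      · simpa [hc] using h1
      · simpa using h0)
    refine ⟨g, hg, fun P => ?_⟩
    simp only [hgx]
    constructor
    · rintro (rfl | rfl | ⟨x, rfl⟩)
      · left
        refine ⟨0, 1, by simp, ?_⟩
        congr 2
        module
      · left
        refine ⟨1, 0, by simp, ?_⟩
        symm
        exact span_smul_eq hc (by module)
      · obtain ⟨X, rfl⟩ : ∃ X, x = X + γ := ⟨x - γ, by ring⟩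
        rw [hfx]
        have e : X + γ + γ = X := by linear_combination γ * h2
        rw [e]
        by_cases hX : X = 0
        · right
          subst hX
          congr 2
          module
        · left
          refine ⟨1, X, by simp, ?_⟩
          refine span_smul_eq (pow_ne_zero 6 hX) ?_
          match_scalars
          · linear_combination -hp X hX
          · linear_combination -(X + γ) * hp X hX
          · linear_combination -d * hp X hX
    · rintro (⟨s, t, hst, rfl⟩ | rfl)
      · by_cases hs : s = 0
        · subst hs
          have ht : t ≠ 0 := fun h => hst ⟨rfl, h⟩
          left
          exact span_smul_eq (pow_ne_zero 2 ht) (by module)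
        · obtain ⟨r, rfl⟩ : ∃ r, t = s * r := ⟨t / s, by field_simp⟩
          by_cases hr : r = 0
          · subst hr
            right; left
            exact span_smul_eq (mul_ne_zero hc (pow_ne_zero 2 hs)) (by module)
          right; right
          refine ⟨r + γ, ?_⟩
          have e : r + γ + γ = r := by linear_combination γ * h2
          rw [hfx, e]
          refine span_smul_eq (mul_ne_zero (pow_ne_zero 2 hs) hr) ?_
          match_scalars
          · linear_combination -(s ^ 2 * c) * hp r hr
          · ring
          · ring
      · right; right
        refine ⟨γ, ?_⟩
        have e : γ + γ = 0 := by linear_combination γ * h2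
        rw [hfx, e]
        congr 2
        module

end CylHyp
end PartD

/-- Let `q ∈ {4, 8}` and `n ≥ 3`.  Every set of even type in
`PG(n,q)` of size `(q+2)q^{n-2}` is a hypercylinder whose underlying hyperoval
is a regular hyperoval. -/
theorem stmt8 {K : Type*} [Field K] [Finite K]
    (hq : Nat.card K = 4 ∨ Nat.card K = 8)
    (n : ℕ) (hn : 3 ≤ n) (S : Set (PGPoint K n)) (hS : IsEvenType S)
    (hcard : S.ncard = (Nat.card K + 2) * Nat.card K ^ (n - 2)) :
    IsRegularHypercylinder S := by
  classical
  have : Fintype K := Fintype.ofFinite K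
  have : Fintype (Submodule K (Fin (n + 1) → K)) := Fintype.ofFinite _
  obtain ⟨m, rfl⟩ : ∃ m, n = m + 2 := ⟨n - 2, by omega⟩
  set S' : Finset (Submodule K (Fin (m + 2 + 1) → K)) :=
    Finset.univ.filter (fun W => ∃ h, (⟨W, h⟩ : PGPoint K (m + 2)) ∈ S) with hS'
  have hmem : ∀ P : PGPoint K (m + 2), P.1 ∈ S' ↔ P ∈ S := by
    intro P
    simp only [hS', Finset.mem_filter, Finset.mem_univ, true_and]
    exact ⟨fun ⟨_, h⟩ => h, fun h => ⟨P.2, h⟩⟩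
  have hpt : ∀ W ∈ S', Module.finrank K W = 1 := by
    intro W hW
    obtain ⟨h, -⟩ := (Finset.mem_filter.1 hW).2
    exact h
  have hNN : ∀ W : Submodule K (Fin (m + 2 + 1) → K), (S ∩ pts W).ncard = NN S' W := by
    intro W
    have hinj : Function.Injective (fun P : PGPoint K (m + 2) => P.1) := Subtype.val_injective
    rw [← Set.ncard_image_of_injective _ hinj]
    unfold NN
    rw [← Set.ncard_coe_finset]
    congr 1
    ext X
    simp only [Set.mem_image, Set.mem_inter_iff, Finset.coe_filter, Set.mem_setOf_eq]
    constructor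
    · rintro ⟨P, ⟨h1, h2⟩, rfl⟩
      exact ⟨(hmem P).2 h1, h2⟩
    · rintro ⟨h1, h2⟩
      exact ⟨⟨X, hpt X h1⟩, ⟨(hmem ⟨X, hpt X h1⟩).1 h1, h2⟩, rfl⟩
  have hev : EvenSet S' := ⟨hpt, fun L hL => by
    rw [← hNN]
    exact hS _ ⟨L, hL, rfl⟩⟩
  have hV : Module.finrank K (Fin (m + 2 + 1) → K) = m + 3 := by simp
  have hc : NN S' ⊤ = (Nat.card K + 2) * Nat.card K ^ m := by
    rw [← hNN]
    have : S ∩ pts ⊤ = S := by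
      apply Set.inter_eq_left.2
      intro P _
      exact (le_top : P.1 ≤ ⊤)
    rw [this, hcard]
    rfl
  have H := hev.cylHyp hq hV hc
  obtain ⟨W, hW, hN⟩ := hev.exists_plane hq hV hc
  obtain ⟨T, hb, ht, hQ⟩ := H.structure_thm hW hN
  obtain ⟨g, hg, hO⟩ := H.regular hW hN hq
  refine ⟨W, T, S ∩ pts W, hW, ?_, hb, ⟨Set.inter_subset_right, by rw [hNN, hN], ?_⟩,
    ⟨g, hg, ?_⟩, ?_⟩
  · have := Submodule.finrank_sup_add_finrank_inf_eq W T
    rw [hb, ht, finrank_top, finrank_bot, hV, hW] at this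
    omega
  · rintro _ ⟨L, hL, rfl⟩
    have e : S ∩ pts W ∩ pts L = S ∩ pts (W ⊓ L) := by
      ext P
      simp only [Set.mem_inter_iff, pts, Set.mem_setOf_eq, le_inf_iff, and_assoc]
    rw [e, hNN]
    by_contra hlt
    obtain ⟨P, hP, hPL⟩ := exists_of_NN (S := S') (W := W ⊓ L) (by omega)
    by_cases hLW : L ≤ W
    · rw [inf_eq_right.2 hLW] at hlt hPL
      have := hev.plane_two hW hN hP hPL hLW hL
      omega
    · have h1 : Module.finrank K (W ⊓ L : Submodule K _) < Module.finrank K L := by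
        apply Submodule.finrank_lt_finrank_of_lt
        refine lt_of_le_of_ne inf_le_right fun h => hLW ?_
        rw [← h]; exact inf_le_left
      have h2 : P = W ⊓ L := eq_of_le_fr hPL (by rw [hpt P hP]; omega)
      rw [← h2, hev.NN_mem hP] at hlt
      omega
  · ext P
    have := hO P.1
    rw [hmem] at this
    exact this
  · ext Q
    have h1 := hQ Q.1 Q.2
    rw [hmem] at h1
    simp only [Set.mem_setOf_eq]
    rw [h1]
    constructor
    · rintro ⟨⟨P, hP, hPW, h⟩, h'⟩
      exact ⟨⟨⟨P, hpt P hP⟩, ⟨(hmem ⟨P, hpt P hP⟩).1 hP, hPW⟩, h⟩, h'⟩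
    · rintro ⟨⟨P, ⟨hP, hPW⟩, h⟩, h'⟩
      exact ⟨⟨P.1, (hmem P).2 hP, hPW, h⟩, h'⟩
end

section
/- Let q = p^h with p prime and q > 2, let n ≥ 2, and let c be a codeword of C_{n−1}(n,q) with 0 < wt(c) ≤ 2q^{n−1}. Then either wt(c) = θ_{n−1} and c = α·χ_π for some α ∈ 𝔽_p \ {0} and some hyperplane π, or wt(c) = 2q^{n−1} and c = α·(χ_π − χ_ρ) for some α ∈ 𝔽_p \ {0} and distinct hyperplanes π and ρ. -/
open Submodule

/-- The code `C_{n-1}(n,q)` of points and hyperplanes of `PG(n, K)` over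
`𝔽_p`: the span of the characteristic functions of hyperplanes. -/
def hypCode (K : Type*) [Field K] (p n : ℕ) :
    Submodule (ZMod p) (PGPoint K n → ZMod p) :=
  Submodule.span (ZMod p)
    {f : PGPoint K n → ZMod p | ∃ W : Submodule K (Fin (n + 1) → K),
      Module.finrank K W = n ∧ f = (pts W).indicator fun _ => 1}

theorem zmod2_aux : ∀ x y : ZMod 2, x ≠ 0 → y ≠ 0 → y = x := by decide

theorem zmod3_aux : ∀ x y : ZMod 3, x ≠ 0 → y ≠ 0 → y = x ∨ y = -x := by decide

theorem zmod_two_ne {p : ℕ} [Fact p.Prime] (h : (2 : ZMod p) = 0) : p = 2 := by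
  have h3 : ((2 : ℕ) : ZMod p) = 0 := by exact_mod_cast h
  rw [ZMod.natCast_eq_zero_iff] at h3
  exact (Nat.prime_dvd_prime_iff_eq Fact.out Nat.prime_two).mp h3

set_option linter.unusedSectionVars false

section Core
open Finset
open scoped Classical

variable {K V : Type*} [Field K] [Fintype K] [AddCommGroup V] [Module K V] [Fintype V]
variable {p : ℕ} [Fact p.Prime] [Algebra (ZMod p) K]

/-- The properties of (lifts to vectors of) codewords used in the proof. -/
structure Good (K : Type*) {V : Type*} [Field K] [Fintype K] [AddCommGroup V] [Module K V]
    {p : ℕ} [Fact p.Prime] [Algebra (ZMod p) K] (F : V → ZMod p) : Prop where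
  smul : ∀ (t : K) (v : V), t ≠ 0 → F (t • v) = F v
  line : ∀ r : V, r ≠ 0 → ∀ v, ∑ t : K, F (v + t • r) = F 0 - F r
  mom : ∀ r : V, r ≠ 0 → ∃ φ : Module.Dual K V, ∀ v,
    ∑ t : K, t * algebraMap (ZMod p) K (F (v + t • r)) = φ v

theorem Good.zero : Good K (fun _ : V => (0 : ZMod p)) where
  smul := by simp
  line := by simp
  mom := fun r _ => ⟨0, by simp⟩

theorem Good.add {F G : V → ZMod p} (hF : Good K F) (hG : Good K G) :
    Good K (fun v => F v + G v) where
  smul t v ht := by simp only [hF.smul t v ht, hG.smul t v ht]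
  line r hr v := by simp only [sum_add_distrib, hF.line r hr v, hG.line r hr v]; ring
  mom r hr := by
    obtain ⟨φ, hφ⟩ := hF.mom r hr
    obtain ⟨ψ, hψ⟩ := hG.mom r hr
    exact ⟨φ + ψ, fun v => by simp [mul_add, sum_add_distrib, hφ, hψ]⟩

theorem Good.const_mul {F : V → ZMod p} (a : ZMod p) (hF : Good K F) :
    Good K (fun v => a * F v) where
  smul t v ht := by simp only [hF.smul t v ht]
  line r hr v := by simp only [← mul_sum, hF.line r hr v]; ring
  mom r hr := by
    obtain ⟨φ, hφ⟩ := hF.mom r hr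
    refine ⟨(algebraMap (ZMod p) K a) • φ, fun v => ?_⟩
    simp only [map_mul, LinearMap.smul_apply, smul_eq_mul, ← hφ, mul_sum]
    exact sum_congr rfl fun t _ => by ring

theorem card_K_zero : ((Fintype.card K : ℕ) : ZMod p) = 0 := by
  apply (algebraMap (ZMod p) K).injective
  simp

theorem sum_K_zero (hq : 2 < Fintype.card K) : ∑ t : K, t = 0 := by
  have := FiniteField.sum_pow_lt_card_sub_one K 1 (by omega)
  simpa using this

theorem good_ind (hq : 2 < Fintype.card K) (l : Module.Dual K V) :
    l ≠ 0 → Good K (fun v => if l v = 0 then (1 : ZMod p) else 0) := by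
  intro hl
  have key : ∀ r v, l r ≠ 0 → ∀ t : K, (l (v + t • r) = 0 ↔ t = - l v / l r) := by
    intro r v hr t
    rw [map_add, map_smul, smul_eq_mul, eq_div_iff hr]
    constructor <;> intro h <;> linear_combination h
  refine ⟨fun t v ht => by simp [ht], fun r hr v => ?_, fun r hr => ?_⟩
  · by_cases h : l r = 0
    · simp [h, card_K_zero]
    · simp only [key r v h, h]
      simp
  · by_cases h : l r = 0
    · refine ⟨0, fun v => ?_⟩
      by_cases h2 : l v = 0
      · simp [h, h2, sum_K_zero hq]
      · simp [h, h2]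
    · refine ⟨-(l r)⁻¹ • l, fun v => ?_⟩
      simp only [key r v h, apply_ite (algebraMap (ZMod p) K), map_one, map_zero, mul_ite, mul_one, mul_zero]
      simp
      field_simp

theorem Good.tangent {F : V → ZMod p} (hF : Good K F) (r : V) (hr : r ≠ 0) (hs : F r ≠ F 0) :
    ∃ φ : Module.Dual K V, φ r ≠ 0 ∧ ∀ v, F v ≠ 0 → (∀ t : K, t ≠ 0 → F (v + t • r) = 0) →
      φ v = 0 ∧ F v = F 0 - F r := by
  obtain ⟨φ, hφ⟩ := hF.mom r hr
  refine ⟨φ, ?_, fun v hv h => ⟨?_, ?_⟩⟩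
  · have h1 : φ (-r) = algebraMap (ZMod p) K (F 0 - F r) := by
      rw [← hφ, ← hF.line r hr 0, map_sum]
      have h0 := hφ 0
      rw [map_zero] at h0
      rw [← add_zero (∑ t : K, algebraMap (ZMod p) K (F (0 + t • r))), ← h0, ← sum_add_distrib]
      rw [← Equiv.sum_comp (Equiv.addRight (1 : K))]
      refine sum_congr rfl fun t _ => ?_
      have : -r + (t + 1) • r = 0 + t • r := by module
      simp only [Equiv.coe_addRight, this]
      ring
    intro h2
    rw [map_neg, h2, neg_zero] at h1
    have := (algebraMap (ZMod p) K).injective (h1.symm.trans (map_zero _).symm)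
    exact hs (sub_eq_zero.mp this).symm
  · rw [← hφ]
    refine sum_eq_zero fun t _ => ?_
    by_cases ht : t = 0
    · simp [ht]
    · simp [h t ht]
  · rw [← hF.line r hr v, sum_eq_single (0 : K)]
    · simp
    · intro t _ ht; exact h t ht
    · simp

theorem Good.exists_ne {F : V → ZMod p} (hF : Good K F) (r : V) (hr : r ≠ 0) (hs : F r ≠ F 0)
    (v : V) : ∃ t : K, F (v + t • r) ≠ 0 := by
  by_contra! h
  have := hF.line r hr v
  simp [h] at this
  exact hs (sub_eq_zero.mp this.symm).symm

/-! ### Cardinalities -/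

theorem card_ker {n : ℕ} (hn : Module.finrank K V = n + 1) (l : Module.Dual K V) (hl : l ≠ 0) :
    (univ.filter fun v => l v = 0).card = Fintype.card K ^ n := by
  have h1 := Module.Dual.finrank_ker_add_one_of_ne_zero hl
  have h2 := Module.card_eq_pow_finrank (K := K) (V := LinearMap.ker l)
  rw [hn] at h1
  have h3 : Module.finrank K (LinearMap.ker l) = n := by omega
  rw [h3] at h2
  rw [← h2, Fintype.card_subtype]
  congr 1

theorem card_ker_inf {n : ℕ} (hn : Module.finrank K V = n + 1)
    (a b : Module.Dual K V) (ha : a ≠ 0) :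
    (univ.filter fun v => a v = 0 ∧ b v ≠ 0).card + Fintype.card K ^ (n - 1) ≤
      Fintype.card K ^ n := by
  have h1 := card_ker hn a ha
  have h2 : Fintype.card K ^ (n - 1) ≤ (univ.filter fun v => a v = 0 ∧ b v = 0).card := by
    have e1 := Submodule.finrank_sup_add_finrank_inf_eq (LinearMap.ker a) (LinearMap.ker b)
    have e2 := Submodule.finrank_le (LinearMap.ker a ⊔ LinearMap.ker b)
    have e3 := Module.Dual.finrank_ker_add_one_of_ne_zero ha
    have e4 : n ≤ Module.finrank K (LinearMap.ker b) := by
      by_cases hb : b = 0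
      · rw [hb, LinearMap.ker_zero, finrank_top]; omega
      · have := Module.Dual.finrank_ker_add_one_of_ne_zero hb
        omega
    have e5 := Module.card_eq_pow_finrank (K := K) (V := ↥(LinearMap.ker a ⊓ LinearMap.ker b))
    have e6 : (univ.filter fun v => a v = 0 ∧ b v = 0).card =
        Fintype.card ↥(LinearMap.ker a ⊓ LinearMap.ker b) := by
      rw [Fintype.card_subtype]
      congr 1
      ext v
      simp
    rw [e6, e5]
    exact Nat.pow_le_pow_right Fintype.card_pos (by omega)
  rw [← h1, ← card_filter_add_card_filter_not (s := univ.filter fun v => a v = 0) (fun v => b v = 0), filter_filter, filter_filter]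
  rw [add_comm]
  exact Nat.add_le_add_right h2 _


theorem sum_cosets (r : V) (l : Module.Dual K V) (hlr : l r = 0) (f : V → ℕ) :
    ∑ v ∈ univ.filter (fun v => l v ≠ 0), ∑ t : K, f (v + t • r) =
      Fintype.card K * ∑ v ∈ univ.filter (fun v => l v ≠ 0), f v := by
  rw [sum_comm, ← smul_eq_mul, ← card_univ, ← sum_const]
  refine sum_congr rfl fun t _ => ?_
  refine sum_bij' (fun v _ => v + t • r) (fun v _ => v - t • r) ?_ ?_ ?_ ?_ ?_ <;>
    simp [hlr]

/-- The set of points outside `ker l` on lines through `r` with only one further point in the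
support. -/
noncomputable def Dset (F : V → ZMod p) (r : V) (l : Module.Dual K V) : Finset V :=
  univ.filter fun v => l v ≠ 0 ∧ F v ≠ 0 ∧ ∀ t : K, t ≠ 0 → F (v + t • r) = 0

theorem mem_Dset {F : V → ZMod p} {r : V} {l : Module.Dual K V} {v : V} :
    v ∈ Dset F r l ↔ l v ≠ 0 ∧ F v ≠ 0 ∧ ∀ t : K, t ≠ 0 → F (v + t • r) = 0 := by
  simp [Dset]

theorem count_aux {F : V → ZMod p} (hF : Good K F) {r : V} (hr : r ≠ 0) (hs : F r ≠ F 0)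
    {l : Module.Dual K V} (v : V) (hv : l v ≠ 0) (hlr : l r = 0) :
    2 ≤ ∑ t : K, ((if F (v + t • r) ≠ 0 then 1 else 0) +
      (if v + t • r ∈ Dset F r l then 1 else 0)) := by
  obtain ⟨t, ht⟩ := hF.exists_ne r hr hs v
  by_cases hD : v + t • r ∈ Dset F r l
  · refine le_trans ?_ (single_le_sum (fun _ _ => Nat.zero_le _) (mem_univ t))
    simp [ht, hD]
  · have : ∃ u : K, u ≠ 0 ∧ F (v + t • r + u • r) ≠ 0 := by
      by_contra! h
      exact hD (mem_Dset.mpr ⟨by simpa [hlr] using hv, ht, h⟩)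
    obtain ⟨u, hu, hF2⟩ := this
    have e : v + t • r + u • r = v + (t + u) • r := by module
    rw [e] at hF2
    have hne : t ≠ t + u := by simpa using hu
    refine le_trans ?_ (sum_le_sum_of_subset (subset_univ {t, t + u}))
    rw [sum_pair hne]
    simp only [if_pos ht, if_pos hF2]
    omega

theorem card_notker {m : ℕ} (hn : Module.finrank K V = m + 2) (l : Module.Dual K V) (hl : l ≠ 0) :
    (univ.filter fun v => l v ≠ 0).card =
      Fintype.card K * (Fintype.card K ^ m * (Fintype.card K - 1)) := by
  have h1 := card_ker hn l hl
  have h2 := card_filter_add_card_filter_not (s := (univ : Finset V)) (fun v => l v = 0)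
  have h3 := Module.card_eq_pow_finrank (K := K) (V := V)
  rw [h1, card_univ, h3, hn] at h2
  obtain ⟨q, hq⟩ : ∃ q, Fintype.card K = q + 1 := ⟨_, (Nat.sub_add_cancel Fintype.card_pos).symm⟩
  rw [hq] at h2 ⊢
  simp only [Nat.add_sub_cancel]
  have : (q + 1) ^ (m + 2) = (q+1)^(m+1) + (q + 1) * ((q + 1) ^ m * q) := by ring
  rw [this] at h2
  exact Nat.add_left_cancel h2

theorem count {m : ℕ} (hn : Module.finrank K V = m + 2) {F : V → ZMod p} (hF : Good K F) {r : V}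
    (hr : r ≠ 0) (hs : F r ≠ F 0) {l : Module.Dual K V} (hl : l ≠ 0) (hlr : l r = 0) :
    2 * (Fintype.card K ^ m * (Fintype.card K - 1)) ≤
      (univ.filter fun v => l v ≠ 0 ∧ F v ≠ 0).card + (Dset F r l).card ∧
    ((univ.filter fun v => l v ≠ 0 ∧ F v ≠ 0).card + (Dset F r l).card ≤
        2 * (Fintype.card K ^ m * (Fintype.card K - 1)) →
      ∀ v, l v ≠ 0 → F v ≠ 0 → ∀ t u : K, t ≠ 0 → u ≠ 0 → F (v + t • r) ≠ 0 →
        F (v + u • r) ≠ 0 → t = u) := by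
  have h1 := sum_cosets r l hlr (fun v => (if F v ≠ 0 then 1 else 0) +
      (if v ∈ Dset F r l then 1 else 0))
  have h2 : ∑ v ∈ univ.filter (fun v => l v ≠ 0), ((if F v ≠ 0 then 1 else 0) +
      (if v ∈ Dset F r l then 1 else 0)) = (univ.filter fun v => l v ≠ 0 ∧ F v ≠ 0).card + (Dset F r l).card := by
    rw [sum_add_distrib, ← card_filter, ← card_filter, filter_filter]
    congr 2
    ext v
    simp only [mem_filter, mem_univ, true_and, and_iff_right_iff_imp]
    exact fun h => (mem_Dset.mp h).1
  rw [h2] at h1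
  have h3 := card_notker hn l hl
  have h4 : ∀ v ∈ univ.filter (fun v => l v ≠ 0), 2 ≤ ∑ t : K, ((if F (v + t • r) ≠ 0 then 1 else 0) +
      (if v + t • r ∈ Dset F r l then 1 else 0)) := fun v hv =>
    count_aux hF hr hs v (by simpa using hv) hlr
  have h5 := sum_le_sum h4
  have hq : 0 < Fintype.card K := Fintype.card_pos
  rw [sum_const, h3, smul_eq_mul] at h5
  constructor
  · rw [h1] at h5
    refine Nat.le_of_mul_le_mul_left ?_ hq
    linarith
  · intro h6 v hv hFv t u ht hu hFt hFu
    by_contra htu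
    have h7 : ∑ v ∈ univ.filter (fun v => l v ≠ 0), 2 < ∑ v ∈ univ.filter (fun v => l v ≠ 0), ∑ t : K, ((if F (v + t • r) ≠ 0 then 1 else 0) +
      (if v + t • r ∈ Dset F r l then 1 else 0)) := by
      refine sum_lt_sum h4 ⟨v, by simpa using hv, ?_⟩
      refine lt_of_lt_of_le ?_ (sum_le_sum_of_subset (subset_univ {0, t, u}))
      rw [sum_insert (by simp [ht.symm, hu.symm]), sum_pair htu]
      simp only [zero_smul, add_zero, if_pos hFv, if_pos hFt, if_pos hFu]
      omega
    rw [sum_const, h3, smul_eq_mul, h1] at h7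
    have := Nat.mul_le_mul_left (Fintype.card K) h6
    linarith

/-- Nonzero vectors in the support. -/
noncomputable def Wset (F : V → ZMod p) : Finset V := univ.filter fun v => v ≠ 0 ∧ F v ≠ 0

/-- Nonzero vectors of `ker l` in the support. -/
noncomputable def Mset (F : V → ZMod p) (l : Module.Dual K V) : Finset V :=
  univ.filter fun v => v ≠ 0 ∧ F v ≠ 0 ∧ l v = 0

theorem mem_Wset {F : V → ZMod p} {v : V} : v ∈ Wset F ↔ v ≠ 0 ∧ F v ≠ 0 := by simp [Wset]

theorem mem_Mset {F : V → ZMod p} {l : Module.Dual K V} {v : V} :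
    v ∈ Mset F l ↔ v ≠ 0 ∧ F v ≠ 0 ∧ l v = 0 := by simp [Mset]

theorem card_W_eq (F : V → ZMod p) (l : Module.Dual K V) :
    (Wset F).card = (Mset F l).card + (univ.filter fun v => l v ≠ 0 ∧ F v ≠ 0).card := by
  rw [← card_filter_add_card_filter_not (s := Wset F) (fun v => l v = 0)]
  congr 2
  · ext v; simp [mem_Wset, mem_Mset, and_assoc]
  · ext v
    simp only [mem_filter, mem_Wset, mem_univ, true_and]
    constructor
    · rintro ⟨⟨_, h⟩, h2⟩; exact ⟨h2, h⟩
    · rintro ⟨h, h2⟩; exact ⟨⟨fun h0 => h (by simp [h0]), h2⟩, h⟩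

theorem step {m : ℕ} (hn : Module.finrank K V = m + 2) {F : V → ZMod p} (hF : Good K F)
    (hW : (Wset F).card ≤ 2 * (Fintype.card K ^ m * (Fintype.card K - 1))) {r : V}
    (hr : r ≠ 0) (hs : F r ≠ F 0) {φ : Module.Dual K V}
    (hφ : ∀ v, F v ≠ 0 → (∀ t : K, t ≠ 0 → F (v + t • r) = 0) → φ v = 0 ∧ F v = F 0 - F r)
    {l : Module.Dual K V} (hl : l ≠ 0) (hlr : l r = 0) :
    (Mset F l).card ≤ (Dset F r l).card ∧ Dset F r l ⊆ Mset F φ ∧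
    ((Mset F φ).card ≤ (Mset F l).card →
      (Wset F).card = 2 * (Fintype.card K ^ m * (Fintype.card K - 1)) ∧
      (∀ v, v ≠ 0 → F v ≠ 0 → φ v = 0 → l v ≠ 0 ∧ F v = F 0 - F r) ∧
      (∀ v, l v ≠ 0 → F v ≠ 0 → φ v ≠ 0 → ∃ t : K, t ≠ 0 ∧ F (v + t • r) ≠ 0 ∧
        φ (v + t • r) ≠ 0 ∧ F v + F (v + t • r) = F 0 - F r ∧
        ∀ u : K, u ≠ 0 → u ≠ t → F (v + u • r) = 0)) := by
  obtain ⟨c1, c2⟩ := count hn hF hr hs hl hlr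
  have h1 := card_W_eq F l
  have hsub : Dset F r l ⊆ Mset F φ := by
    intro v hv
    obtain ⟨a, b, c⟩ := mem_Dset.mp hv
    exact mem_Mset.mpr ⟨fun h0 => a (by simp [h0]), b, (hφ v b c).1⟩
  have h2 := card_le_card hsub
  refine ⟨by omega, hsub, fun h3 => ?_⟩
  have hD : Dset F r l = Mset F φ := eq_of_subset_of_card_le hsub (by omega)
  have c3 := c2 (by omega)
  refine ⟨by omega, ?_, ?_⟩
  · intro v h0 hv hv2
    have : v ∈ Dset F r l := by rw [hD]; exact mem_Mset.mpr ⟨h0, hv, hv2⟩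
    obtain ⟨a, b, c⟩ := mem_Dset.mp this
    exact ⟨a, (hφ v b c).2⟩
  · intro v h0 hv hv2
    have : ∃ t : K, t ≠ 0 ∧ F (v + t • r) ≠ 0 := by
      by_contra! h
      exact hv2 (hφ v hv h).1
    obtain ⟨t, ht, htF⟩ := this
    have huniq : ∀ u : K, u ≠ 0 → u ≠ t → F (v + u • r) = 0 := by
      intro u hu hut
      by_contra hne
      exact hut (c3 v h0 hv u t hu ht hne htF)
    refine ⟨t, ht, htF, ?_, ?_, huniq⟩
    · intro h4
      have h5 : l (v + t • r) ≠ 0 := by simpa [hlr] using h0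
      have : v + t • r ∈ Dset F r l := by
        rw [hD]; exact mem_Mset.mpr ⟨fun h => h5 (by simp [h]), htF, h4⟩
      have h6 := (mem_Dset.mp this).2.2 (-t) (by simpa using ht)
      simp at h6
      exact hv h6
    · rw [← hF.line r hr v, ← sum_subset (subset_univ {(0 : K), t}), sum_pair ht.symm]
      · simp
      · intro u _ hu
        simp at hu
        exact huniq u hu.1 hu.2

theorem exists_dual {m : ℕ} (hn : Module.finrank K V = m + 2) (r : V) :
    ∃ l : Module.Dual K V, l ≠ 0 ∧ l r = 0 := by
  have h1 : Module.finrank K (Submodule.span K {r}) ≤ 1 := by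
    simpa using finrank_span_le_card (R := K) ({r} : Set V)
  have h2 : Submodule.span K {r} < ⊤ := by
    rw [lt_top_iff_ne_top]
    intro h
    rw [h, finrank_top] at h1
    omega
  obtain ⟨l, hl, hl2⟩ := Submodule.exists_le_ker_of_lt_top _ h2
  exact ⟨l, hl, hl2 (Submodule.mem_span_singleton_self r)⟩

/-- Structure around a support point in the zero-sum case. -/
theorem hull_struct {m : ℕ} (hn : Module.finrank K V = m + 2) {F : V → ZMod p} (hF : Good K F)
    (h0 : F 0 = 0) (hW : (Wset F).card ≤ 2 * (Fintype.card K ^ m * (Fintype.card K - 1))) {r : V}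
    (hr : F r ≠ 0) :
    ∃ a b : Module.Dual K V, a r ≠ 0 ∧ b r = 0 ∧ b ≠ 0 ∧
      (Wset F).card = 2 * (Fintype.card K ^ m * (Fintype.card K - 1)) ∧
      (Mset F a).card = (Mset F b).card ∧
      (∃ u, F u ≠ 0 ∧ a u = 0) ∧
      (∀ v, F v ≠ 0 → a v = 0 → b v ≠ 0 ∧ F v = - F r) ∧
      (∀ v, F v ≠ 0 → b v = 0 → a v ≠ 0 ∧ F v = F r) ∧
      (∀ v, F v ≠ 0 → a v ≠ 0 → b v ≠ 0 → F v ≠ F r ∧ F v ≠ - F r ∧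
        ∃ w, F w ≠ 0 ∧ F v + F w = - F r ∧ F w ≠ F r ∧ F w ≠ - F r) := by
  have nz : ∀ v, F v ≠ 0 → v ≠ 0 := fun v hv h => hv (by rw [h, h0])
  obtain ⟨a, ha, hat⟩ := hF.tangent r (nz r hr) (by rwa [h0])
  obtain ⟨l, hl, hlr⟩ := exists_dual hn r
  obtain ⟨s1, s2, -⟩ := step hn hF hW (nz r hr) (by rwa [h0]) hat hl hlr
  have hne : (Dset F r l).Nonempty := by
    rw [← card_pos]
    refine lt_of_lt_of_le (card_pos.mpr ⟨r, ?_⟩) s1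
    exact mem_Mset.mpr ⟨nz r hr, hr, hlr⟩
  obtain ⟨u, hu⟩ := hne
  have hau := (mem_Mset.mp (s2 hu)).2.2
  obtain ⟨-, hu, hut⟩ := mem_Dset.mp hu
  have hFu := (hat u hu hut).2
  obtain ⟨b, hb, hbt⟩ := hF.tangent u (nz u hu) (by rwa [h0])
  have hbr : b r = 0 := by
    refine (hbt r hr fun t ht => ?_).1
    have := hut t⁻¹ (inv_ne_zero ht)
    rw [← hF.smul t _ ht] at this
    rw [smul_add, smul_smul, mul_inv_cancel₀ ht, one_smul, add_comm] at this
    exact this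
  have ha0 : a ≠ 0 := fun h => ha (by simp [h])
  have hb0 : b ≠ 0 := fun h => hb (by simp [h])
  obtain ⟨a1, a2, a3⟩ := step hn hF hW (nz r hr) (by rwa [h0]) hat hb0 hbr
  obtain ⟨b1, b2, b3⟩ := step hn hF hW (nz u hu) (by rwa [h0]) hbt ha0 hau
  have a4 := card_le_card a2
  have b4 := card_le_card b2
  obtain ⟨a5, a6, a7⟩ := a3 (by omega)
  obtain ⟨b5, b6, b7⟩ := b3 (by omega)
  rw [h0, zero_sub] at *
  rw [hFu, neg_neg] at *
  have key : ∀ v, F v ≠ 0 → a v ≠ 0 → b v ≠ 0 → F v ≠ F r ∧ F v ≠ - F r := by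
    intro v hv hav hbv
    constructor
    · obtain ⟨t, ht, h1, h2, h3, -⟩ := b7 v hav hv hbv
      intro h4; rw [h4] at h3; exact h1 (by simpa using h3)
    · obtain ⟨t, ht, h1, h2, h3, -⟩ := a7 v hbv hv hav
      intro h4; rw [h4] at h3; exact h1 (by simpa using h3)
  refine ⟨a, b, ha, hbr, hb0, a5, by omega, ⟨u, hu, hau⟩, fun v hv => a6 v (nz v hv) hv,
    fun v hv => b6 v (nz v hv) hv, fun v hv hav hbv => ?_⟩
  refine ⟨(key v hv hav hbv).1, (key v hv hav hbv).2, ?_⟩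
  obtain ⟨t, ht, h1, h2, h3, -⟩ := a7 v hbv hv hav
  have := key (v + t • r) h1 h2 (by simpa [hbr] using hbv)
  exact ⟨_, h1, h3, this.1, this.2⟩

theorem hull_values {m : ℕ} (hn : Module.finrank K V = m + 2) {F : V → ZMod p} (hF : Good K F)
    (h0 : F 0 = 0) (hW : (Wset F).card ≤ 2 * (Fintype.card K ^ m * (Fintype.card K - 1))) {r : V}
    (hr : F r ≠ 0) (v : V) (hv : F v ≠ 0) : F v = F r ∨ F v = - F r := by
  -- the set of nonzero values
  have neg : ∀ x, x ≠ 0 → (∃ v, F v = x) → ∃ v, F v = -x := by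
    rintro x hx ⟨v, rfl⟩
    obtain ⟨a, b, h1, h2, h3, h4, h5, ⟨u, hu, hau⟩, h6, -, -⟩ := hull_struct hn hF h0 hW hx
    exact ⟨u, (h6 u hu hau).2⟩
  have main : ∀ x y, x ≠ 0 → y ≠ 0 → (∃ v, F v = x) → (∃ v, F v = y) → y ≠ x → y ≠ -x →
      (∃ v, F v = -x - y) ∧ -x - y ≠ 0 ∧ -x-y ≠ x := by
    rintro x y hx hy ⟨r, rfl⟩ ⟨v, rfl⟩ hxy hxy2
    obtain ⟨a, b, h1, h2, h3, h4, h5, -, h6, h7, h8⟩ := hull_struct hn hF h0 hW hx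
    have hav : a v ≠ 0 := fun h => hxy2 (h6 v hy h).2
    have hbv : b v ≠ 0 := fun h => hxy (h7 v hy h).2
    obtain ⟨-, -, w, w1, w2, w3, w4⟩ := h8 v hy hav hbv
    have : -F r - F v = F w := by linear_combination -w2
    rw [this]
    exact ⟨⟨w, rfl⟩, w1, w3⟩
  by_contra! hcon
  obtain ⟨c1, c2⟩ := hcon
  set x := F r with hx
  set y := F v with hy
  have hA : ∀ x y, x ≠ 0 → y ≠ 0 → (∃ v, F v = x) → (∃ v, F v = y) → y ≠ x → y ≠ -x →
      (∃ v, F v = x + y) ∧ x + y ≠ 0 ∧ y ≠ -(2 * x) ∧ y ≠ 2 * x := by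
    intro x y hx hy ex ey h1 h2
    obtain ⟨m1, m2, m3⟩ := main x y hx hy ex ey h1 h2
    have n1 := neg _ m2 m1
    obtain ⟨-, -, m4⟩ := main x (-y) hx (neg_ne_zero.mpr hy) ex (neg _ hy ey)
      (fun h => h2 (by linear_combination -h)) (fun h => h1 (by linear_combination -h))
    refine ⟨?_, ?_, ?_, ?_⟩
    · convert n1 using 3; ring
    · intro h; apply m2; linear_combination -h
    · intro h; apply m3; linear_combination -h
    · intro h; apply m4; linear_combination h
  have ex : ∃ v, F v = x := ⟨r, rfl⟩
  have ey : ∃ v, F v = y := ⟨v, rfl⟩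
  obtain ⟨e1, e2, e3, e4⟩ := hA x y hr hv ex ey c1 c2
  obtain ⟨f1, f2, f3, f4⟩ := hA x (x + y) hr e2 ex e1 (fun h => hv (by linear_combination h))
    (fun h => e3 (by linear_combination h))
  have h20 : (2 : ZMod p) ≠ 0 := by
    intro h2
    have hp2 : p = 2 := zmod_two_ne h2
    subst hp2
    exact c1 (zmod2_aux _ _ hr hv)
  obtain ⟨g1, g2, -, -⟩ := hA (-y) (x + (x + y)) (neg_ne_zero.mpr hv) f2 (neg _ hv ey) f1
    (fun h => by
      have : 2 * (x + y) = 0 := by linear_combination h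
      rcases mul_eq_zero.mp this with h | h
      · exact h20 h
      · exact e2 h)
    (fun h => by
      have : 2 * x = 0 := by linear_combination h
      rcases mul_eq_zero.mp this with h | h
      · exact h20 h
      · exact hr h)
  have h30 : 2 * x ≠ - x := by
    intro h
    have h3 : (3 : ZMod p) = 0 := by
      have : 3 * x = 0 := by linear_combination h
      exact (mul_eq_zero.mp this).resolve_right hr
    have hp2 : p = 3 := by
      have h3 : ((3 : ℕ) : ZMod p) = 0 := by exact_mod_cast h3
      rw [ZMod.natCast_eq_zero_iff] at h3
      exact (Nat.prime_dvd_prime_iff_eq Fact.out Nat.prime_three).mp h3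
    clear_value x y
    subst hp2
    rcases zmod3_aux x y hr hv with h | h
    · exact c1 h
    · exact c2 h
  have e : -y + (x + (x + y)) = 2 * x := by ring
  rw [e] at g1 g2
  exact (hA x (2 * x) hr g2 ex g1 (fun h => hr (by linear_combination h)) h30).2.2.2 rfl

theorem hull_main {m : ℕ} (hn : Module.finrank K V = m + 2) {F : V → ZMod p} (hF : Good K F)
    (h0 : F 0 = 0) (hW : (Wset F).card ≤ 2 * (Fintype.card K ^ m * (Fintype.card K - 1))) {r : V}
    (hr : F r ≠ 0) :
    ∃ a b : Module.Dual K V, a ≠ 0 ∧ b ≠ 0 ∧ LinearMap.ker b ≠ LinearMap.ker a ∧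
      (Wset F).card = 2 * (Fintype.card K ^ m * (Fintype.card K - 1)) ∧
      ∀ v, F v = F r * ((if b v = 0 then 1 else 0) - (if a v = 0 then 1 else 0)) := by
  obtain ⟨a, b, h1, h2, h3, h4, h5, -, h6, h7, h8⟩ := hull_struct hn hF h0 hW hr
  have ha0 : a ≠ 0 := fun h => h1 (by simp [h])
  refine ⟨a, b, ha0, h3, ?_, h4, ?_⟩
  · intro h
    have : r ∈ LinearMap.ker a := by rw [← h]; exact h2
    exact h1 this
  have hcov : ∀ v, F v ≠ 0 → a v = 0 ∨ b v = 0 := by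
    intro v hv
    by_contra! h
    obtain ⟨k1, k2, -⟩ := h8 v hv h.1 h.2
    rcases hull_values hn hF h0 hW hr v hv with h | h
    · exact k1 h
    · exact k2 h
  have hsub : Wset F ⊆ Mset F a ∪ Mset F b := by
    intro v hv
    obtain ⟨v0, v1⟩ := mem_Wset.mp hv
    rw [mem_union, mem_Mset, mem_Mset]
    rcases hcov v v1 with h | h
    · exact Or.inl ⟨v0, v1, h⟩
    · exact Or.inr ⟨v0, v1, h⟩
  have hc := (card_le_card hsub).trans (card_union_le _ _)
  have hq : 0 < Fintype.card K := Fintype.card_pos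
  have hB : Fintype.card K ^ (m + 1) = Fintype.card K ^ m * (Fintype.card K - 1) + Fintype.card K ^ m := by
    obtain ⟨q, hq⟩ : ∃ q, Fintype.card K = q + 1 := ⟨_, (Nat.sub_add_cancel Fintype.card_pos).symm⟩
    rw [hq]; simp only [Nat.add_sub_cancel]; ring
  have full : ∀ a b : Module.Dual K V, a ≠ 0 → (∀ v, F v ≠ 0 → a v = 0 → b v ≠ 0) →
      Fintype.card K ^ m * (Fintype.card K - 1) ≤ (Mset F a).card → 
      ∀ v, a v = 0 → b v ≠ 0 → F v ≠ 0 := by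
    intro a b ha hab hM v hav hbv
    have k1 := card_ker_inf hn a b ha
    simp only [add_tsub_cancel_right] at k1
    have k2 : Mset F a ⊆ univ.filter fun v => a v = 0 ∧ b v ≠ 0 := by
      intro v hv
      obtain ⟨v0, v1, v2⟩ := mem_Mset.mp hv
      simp [v2, hab v v1 v2]
    have k3 := eq_of_subset_of_card_le k2 (by
      have : m + 1 - 1 = m := rfl
      omega)
    have : v ∈ Mset F a := by rw [k3]; simp [hav, hbv]
    exact (mem_Mset.mp this).2.1
  have fa := full a b ha0 (fun v hv h => (h6 v hv h).1) (by omega)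
  have fb := full b a h3 (fun v hv h => (h7 v hv h).1) (by omega)
  intro v
  by_cases hav : a v = 0 <;> by_cases hbv : b v = 0
  · have : F v = 0 := by
      by_contra h
      exact (h6 v h hav).1 hbv
    simp [hav, hbv, this]
  · simp [hav, hbv, (h6 v (fa v hav hbv) hav).2]
  · simp [hav, hbv, (h7 v (fb v hbv hav) hbv).2]
  · have : F v = 0 := by
      by_contra h
      rcases hcov v h with h | h
      · exact hav h
      · exact hbv h
    simp [hav, hbv, this]

/-- Nonzero vectors of `ker l` outside the support. -/
noncomputable def Zset (F : V → ZMod p) (l : Module.Dual K V) : Finset V :=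
  univ.filter fun v => v ≠ 0 ∧ F v = 0 ∧ l v = 0

theorem mem_Zset {F : V → ZMod p} {l : Module.Dual K V} {v : V} :
    v ∈ Zset F l ↔ v ≠ 0 ∧ F v = 0 ∧ l v = 0 := by simp [Zset]

theorem card_Zset {m : ℕ} (hn : Module.finrank K V = m + 2) (F : V → ZMod p)
    (l : Module.Dual K V) (hl : l ≠ 0) :
    (Mset F l).card + (Zset F l).card + 1 = Fintype.card K ^ (m + 1) := by
  rw [← card_ker hn l hl]
  have h1 : (univ.filter fun v => l v = 0) = insert 0 (Mset F l ∪ Zset F l) := by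
    ext v
    simp only [mem_filter, mem_univ, true_and, mem_insert, mem_union, mem_Mset, mem_Zset]
    by_cases h : v = 0
    · simp [h]
    · by_cases h2 : F v = 0 <;> simp [h, h2]
  have h2 : Disjoint (Mset F l) (Zset F l) := by
    rw [Finset.disjoint_left]
    intro v h1 h2
    exact (mem_Mset.mp h1).2.1 (mem_Zset.mp h2).2.1
  rw [h1, card_insert_of_notMem, card_union_of_disjoint h2]
  simp [mem_Mset, mem_Zset]

theorem q_dvd_card {m : ℕ} (hn : Module.finrank K V = m + 2) (hm : 1 ≤ m)
    (a b : Module.Dual K V) :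
    Fintype.card K ∣ (univ.filter fun v => a v = 0 ∧ b v = 0).card := by
  have e1 := Submodule.finrank_sup_add_finrank_inf_eq (LinearMap.ker a) (LinearMap.ker b)
  have e2 := Submodule.finrank_le (LinearMap.ker a ⊔ LinearMap.ker b)
  have e4 : ∀ b : Module.Dual K V, m + 1 ≤ Module.finrank K (LinearMap.ker b) := by
    intro b
    by_cases hb : b = 0
    · rw [hb, LinearMap.ker_zero, finrank_top]; omega
    · have := Module.Dual.finrank_ker_add_one_of_ne_zero hb
      omega
  have e3 := e4 a
  have e4 := e4 b
  have e5 := Module.card_eq_pow_finrank (K := K) (V := ↥(LinearMap.ker a ⊓ LinearMap.ker b))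
  have e6 : (univ.filter fun v => a v = 0 ∧ b v = 0).card =
      Fintype.card ↥(LinearMap.ker a ⊓ LinearMap.ker b) := by
    rw [Fintype.card_subtype]
    congr 1
    ext v
    simp
  rw [e6, e5]
  exact dvd_pow_self _ (by omega)

theorem card_B (m : ℕ) : Fintype.card K ^ (m + 1) =
    Fintype.card K ^ m * (Fintype.card K - 1) + Fintype.card K ^ m := by
  obtain ⟨q, hq⟩ : ∃ q, Fintype.card K = q + 1 := ⟨_, (Nat.sub_add_cancel Fintype.card_pos).symm⟩
  rw [hq]; simp only [Nat.add_sub_cancel]; ring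

theorem exists_max (hne : ∃ l : Module.Dual K V, l ≠ 0) (F : V → ZMod p) :
    ∃ l : Module.Dual K V, l ≠ 0 ∧ ∀ l' : Module.Dual K V, l' ≠ 0 →
      (Mset F l').card ≤ (Mset F l).card := by
  have : Finite (Module.Dual K V) := DFunLike.finite _
  exact Set.exists_max_image {l : Module.Dual K V | l ≠ 0} (fun l => (Mset F l).card)
    (Set.toFinite _) hne

theorem block_hyp {m : ℕ} (hn : Module.finrank K V = m + 2) (hm : 1 ≤ m)
    (hq : 2 < Fintype.card K) {F : V → ZMod p} (hF : Good K F)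
    (h0 : F 0 ≠ 0) (hW : (Wset F).card ≤ 2 * (Fintype.card K ^ m * (Fintype.card K - 1))) :
    ∃ l : Module.Dual K V, l ≠ 0 ∧ (∀ v, F v ≠ 0 → l v = 0 → F v = F 0) ∧
      (Zset F l).card ≤ (Mset F l).card := by
  have hne : ∃ l : Module.Dual K V, l ≠ 0 := by
    obtain ⟨l, hl, -⟩ := exists_dual hn (0 : V)
    exact ⟨l, hl⟩
  obtain ⟨l, hl, hmax⟩ := exists_max hne F
  by_cases hA : ∀ v, v ≠ 0 → l v = 0 → F v ≠ 0
  · -- the hyperplane is contained in the support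
    have hZ : Zset F l = ∅ := by
      rw [Finset.eq_empty_iff_forall_notMem]
      intro v hv
      obtain ⟨a, b, c⟩ := mem_Zset.mp hv
      exact hA v a c b
    have hc := card_Zset hn F l hl
    rw [hZ, card_empty] at hc
    refine ⟨l, hl, fun r hFr hlr => ?_, by simp [hZ]⟩
    by_contra hs
    have hr : r ≠ 0 := fun h => hs (by rw [h])
    obtain ⟨φ, h1, h2⟩ := hF.tangent r hr hs
    have hφ0 : φ ≠ 0 := fun h => h1 (by simp [h])
    obtain ⟨s1, s2, -⟩ := step hn hF hW hr hs h2 hl hlr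
    have k1 := card_ker_inf hn φ l hφ0
    have k2 : Dset F r l ⊆ univ.filter fun v => φ v = 0 ∧ l v ≠ 0 := by
      intro v hv
      have e1 := (mem_Dset.mp hv).1
      have e2 := (mem_Mset.mp (s2 hv)).2.2
      simp [e1, e2]
    have k3 := card_le_card k2
    simp only [add_tsub_cancel_right] at k1
    have k4 : 1 < Fintype.card K ^ m := Nat.one_lt_pow (by omega) (by omega)
    omega
  · push Not at hA
    obtain ⟨r, hr, hlr, hFr⟩ := hA
    -- facts for a zero on a maximal hyperplane
    have fact : ∀ l : Module.Dual K V, l ≠ 0 → (∀ l' : Module.Dual K V, l' ≠ 0 →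
        (Mset F l').card ≤ (Mset F l).card) → ∀ r, r ≠ 0 → l r = 0 → F r = 0 →
        ∃ φ : Module.Dual K V, φ ≠ 0 ∧ (Mset F l).card ≤ (Mset F φ).card ∧
          (Wset F).card = 2 * (Fintype.card K ^ m * (Fintype.card K - 1)) ∧
          (∀ v, v ≠ 0 → F v ≠ 0 → φ v = 0 → l v ≠ 0 ∧ F v = F 0) ∧
          (∀ v, l v ≠ 0 → F v ≠ 0 → φ v ≠ 0 → ∃ t : K, t ≠ 0 ∧ F (v + t • r) ≠ 0 ∧
            F v + F (v + t • r) = F 0 ∧ ∀ u : K, u ≠ 0 → u ≠ t → F (v + u • r) = 0) := by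
      intro l hl hmax r hr hlr hFr
      have hs : F r ≠ F 0 := by rw [hFr]; exact h0.symm
      obtain ⟨φ, h1, h2⟩ := hF.tangent r hr hs
      have hφ0 : φ ≠ 0 := fun h => h1 (by simp [h])
      obtain ⟨s1, s2, s3⟩ := step hn hF hW hr hs h2 hl hlr
      obtain ⟨s4, s5, s6⟩ := s3 (hmax φ hφ0)
      rw [hFr, sub_zero] at s5 s6
      refine ⟨φ, hφ0, s1.trans (card_le_card s2), s4, s5, fun v a b c => ?_⟩
      obtain ⟨t, x1, x2, -, x3, x4⟩ := s6 v a b c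
      exact ⟨t, x1, x2, x3, x4⟩
    obtain ⟨l₁, hl₁, hle, hW2, hv1, -⟩ := fact l hl hmax r hr hlr hFr
    have hmax₁ : ∀ l' : Module.Dual K V, l' ≠ 0 → (Mset F l').card ≤ (Mset F l₁).card :=
      fun l' h => (hmax l' h).trans hle
    refine ⟨l₁, hl₁, fun v hv hlv => ?_, ?_⟩
    · by_cases hv0 : v = 0
      · rw [hv0]
      · exact (hv1 v hv0 hv hlv).2
    by_cases hZ : ∃ r, r ≠ 0 ∧ l₁ r = 0 ∧ F r = 0
    swap
    · have hZ : Zset F l₁ = ∅ := by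
        rw [Finset.eq_empty_iff_forall_notMem]
        intro v hv
        obtain ⟨a, b, c⟩ := mem_Zset.mp hv
        exact hZ ⟨v, a, c, b⟩
      simp [hZ]
    by_cases hB : ∃ z, z ≠ 0 ∧ F z ≠ 0 ∧ F z ≠ F 0
    · obtain ⟨z, hz, hFz, hFz0⟩ := hB
      have hlz : l₁ z ≠ 0 := fun h => hFz0 (hv1 z hz hFz h).2
      obtain ⟨ψ, g1, g2⟩ := hF.tangent z hz hFz0
      have hψ0 : ψ ≠ 0 := fun h => g1 (by simp [h])
      refine le_trans ?_ (hmax₁ ψ hψ0)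
      have ex : ∀ r, r ∈ Zset F l₁ → ∃ t : K, r + t • z ∈ Mset F ψ := by
        intro r hr
        obtain ⟨r0, r1, r2⟩ := mem_Zset.mp hr
        obtain ⟨φ, f1, f2, f3, f4, f5⟩ := fact l₁ hl₁ hmax₁ r r0 r2 r1
        obtain ⟨t, t1, t2, t3, t4⟩ := f5 z hlz hFz (fun h => hFz0 (f4 z hz hFz h).2)
        have conv : ∀ u : K, u ≠ 0 → F (r + u • z) = F (z + u⁻¹ • r) := by
          intro u hu
          rw [← hF.smul u (z + _) hu, smul_add, smul_smul, mul_inv_cancel₀ hu, one_smul, add_comm]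
        have hne : F (r + t⁻¹ • z) ≠ 0 := by
          rw [conv _ (inv_ne_zero t1), inv_inv]; exact t2
        refine ⟨t⁻¹, mem_Mset.mpr ⟨fun h => ?_, hne, (g2 _ hne fun u hu => ?_).1⟩⟩
        · have := congrArg l₁ h
          simp [r2, hlz, t1] at this
        · have e : r + t⁻¹ • z + u • z = r + (t⁻¹ + u) • z := by module
          rw [e]
          by_cases h : t⁻¹ + u = 0
          · rw [h]; simpa using r1
          · rw [conv _ h]
            refine t4 _ (inv_ne_zero h) fun h2 => hu ?_
            rw [← h2, inv_inv] at *
            simpa using h2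
      choose! f hf using ex
      refine card_le_card_of_injOn (fun r => r + f r • z) (fun r hr => hf r hr) ?_
      intro r hr r' hr' h
      have h1 := congrArg l₁ h
      have e1 := (mem_Zset.mp hr).2.2
      have e2 := (mem_Zset.mp hr').2.2
      simp [e1, e2, hlz] at h1
      simp [h1] at h
      exact h
    · push Not at hB
      obtain ⟨r, hr, hlr, hFr⟩ := hZ
      obtain ⟨φ, f1, f2, f3, f4, f5⟩ := fact l₁ hl₁ hmax₁ r hr hlr hFr
      have hsub : Wset F ⊆ Mset F l₁ ∪ Mset F φ := by
        intro v hv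
        obtain ⟨v0, v1⟩ := mem_Wset.mp hv
        rw [mem_union, mem_Mset, mem_Mset]
        by_contra! hcon
        obtain ⟨c1, c2⟩ := hcon
        obtain ⟨t, t1, t2, t3, -⟩ := f5 v (c1 v0 v1) v1 (c2 v0 v1)
        have hlv := c1 v0 v1
        rw [hB v v0 v1, hB (v + t • r) (fun h => hlv (by
          have := congrArg l₁ h
          simpa [hlr] using this)) t2] at t3
        exact h0 (by simpa using t3)
      have hc := (card_le_card hsub).trans (card_union_le _ _)
      have h1 := hmax₁ φ f1
      have h2 := card_Zset hn F l₁ hl₁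
      have h3 := card_B (K := K) m
      have h4 : Fintype.card K ^ m * 1 ≤ Fintype.card K ^ m * (Fintype.card K - 1) :=
        Nat.mul_le_mul_left _ (by omega)
      omega

theorem block_main {m : ℕ} (hn : Module.finrank K V = m + 2) (hm : 1 ≤ m)
    (hq : 2 < Fintype.card K) (hpq : p ∣ Fintype.card K) {F : V → ZMod p} (hF : Good K F)
    (h0 : F 0 ≠ 0) (hW : (Wset F).card ≤ 2 * (Fintype.card K ^ m * (Fintype.card K - 1))) :
    ∃ l : Module.Dual K V, l ≠ 0 ∧ ∀ v, F v = F 0 * (if l v = 0 then 1 else 0) := by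
  obtain ⟨l, hl, hval, hZM⟩ := block_hyp hn hm hq hF h0 hW
  refine ⟨l, hl, ?_⟩
  by_contra hcon
  push Not at hcon
  obtain ⟨r, hr⟩ := hcon
  set G : V → ZMod p := fun v => F v + (-F 0) * (if l v = 0 then 1 else 0) with hGdef
  have hG : Good K G := hF.add ((good_ind hq l hl).const_mul (-F 0))
  have hG0 : G 0 = 0 := by simp [hGdef]
  have hGr : G r ≠ 0 := fun h => hr (by simp only [hGdef] at h; linear_combination h)
  have hGon : ∀ v, l v = 0 → G v = F v - F 0 := by
    intro v hv; simp [hGdef, hv, sub_eq_add_neg]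
  have hGoff : ∀ v, l v ≠ 0 → G v = F v := by
    intro v hv; simp [hGdef, hv]
  have hsub : Wset G ⊆ (univ.filter fun v => l v ≠ 0 ∧ F v ≠ 0) ∪ Zset F l := by
    intro v hv
    obtain ⟨v0, v1⟩ := mem_Wset.mp hv
    by_cases h : l v = 0
    · rw [hGon v h] at v1
      refine mem_union_right _ (mem_Zset.mpr ⟨v0, ?_, h⟩)
      by_contra hne
      exact v1 (by rw [hval v hne h, sub_self])
    · rw [hGoff v h] at v1
      exact mem_union_left _ (by simp [h, v1])
  have c1 := (card_le_card hsub).trans (card_union_le _ _)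
  have c2 := card_W_eq F l
  obtain ⟨a, b, ha, hb, hab, hWG, hGv⟩ := hull_main hn hG hG0 (by omega) hGr
  have c3 := card_Zset hn F l hl
  have c4 : 2 * (Zset F l).card + 1 = Fintype.card K ^ (m + 1) := by omega
  have hqq : Fintype.card K ∣ Fintype.card K ^ (m + 1) := dvd_pow_self _ (by omega)
  have hmem : ∀ v, v ∈ Zset F l ↔ l v = 0 ∧ G v ≠ 0 := by
    intro v
    rw [mem_Zset]
    constructor
    · rintro ⟨v0, v1, v2⟩
      refine ⟨v2, ?_⟩
      rw [hGon v v2, v1]; simpa using h0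
    · rintro ⟨v1, v2⟩
      refine ⟨fun h => v2 (by rw [h, hG0]), ?_, v1⟩
      by_contra h
      rw [hGon v v1, hval v h v1, sub_self] at v2
      exact v2 rfl
  have fin : ∀ a b : Module.Dual K V, (∀ v, G v ≠ 0 ↔ ¬ (a v = 0 ↔ b v = 0)) →
      (∀ v, l v = 0 → b v = 0 → a v = 0) → False := by
    intro a b h1 h2
    have h3 : (univ.filter fun v => l v = 0 ∧ a v = 0) =
        Zset F l ∪ (univ.filter fun v => l v = 0 ∧ b v = 0) := by
      ext v
      rw [mem_union, hmem, h1]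
      simp only [mem_filter, mem_univ, true_and]
      have := h2 v
      tauto
    have h4 : Disjoint (Zset F l) (univ.filter fun v => l v = 0 ∧ b v = 0) := by
      rw [Finset.disjoint_left]
      intro v e1 e2
      rw [hmem, h1] at e1
      simp only [mem_filter, mem_univ, true_and] at e2
      have := h2 v
      tauto
    have h5 := congrArg card h3
    rw [card_union_of_disjoint h4] at h5
    have h6 := q_dvd_card hn hm l a
    have h7 := q_dvd_card hn hm l b
    rw [h5] at h6
    have h8 := (Nat.dvd_add_left h7).mp h6
    rw [← c4] at hqq
    have h9 := (Nat.dvd_add_right (h8.mul_left 2)).mp hqq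
    have := Nat.dvd_one.mp h9
    omega
  have hGiff : ∀ v, G v ≠ 0 ↔ ¬ (a v = 0 ↔ b v = 0) := by
    intro v
    rw [hGv v]
    by_cases h1 : a v = 0 <;> by_cases h2 : b v = 0 <;> simp [h1, h2, hGr]
  by_cases k1 : ∀ v, l v = 0 → b v = 0 → a v = 0
  · exact fin a b hGiff k1
  by_cases k2 : ∀ v, l v = 0 → a v = 0 → b v = 0
  · exact fin b a (fun v => by rw [hGiff v]; tauto) k2
  push Not at k1 k2
  obtain ⟨v, v1, v2, v3⟩ := k1
  obtain ⟨w, w1, w2, w3⟩ := k2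
  have hFv : F v = 0 := (mem_Zset.mp ((hmem v).mpr ⟨v1, (hGiff v).mpr (by tauto)⟩)).2.1
  have hFw : F w = 0 := (mem_Zset.mp ((hmem w).mpr ⟨w1, (hGiff w).mpr (by tauto)⟩)).2.1
  have e1 := hGv v
  have e2 := hGv w
  rw [hGon v v1, hFv] at e1
  rw [hGon w w1, hFw] at e2
  simp [v2, v3] at e1
  simp [w2, w3] at e2
  have : (2 : ZMod p) * F 0 = 0 := by
    rw [← e1] at e2
    linear_combination e2
  have hp2 := zmod_two_ne ((mul_eq_zero.mp this).resolve_right h0)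
  rw [hp2] at hpq
  have := hpq.trans hqq
  omega

end Core

section Final
open Finset
open scoped Classical

/-- The point spanned by a nonzero vector. -/
noncomputable def ptOf {K : Type*} [Field K] {n : ℕ} (v : Fin (n + 1) → K) (hv : v ≠ 0) :
    PGPoint K n := ⟨Submodule.span K {v}, finrank_span_singleton hv⟩

theorem ptOf_mem_pts {K : Type*} [Field K] {n : ℕ} (v : Fin (n + 1) → K) (hv : v ≠ 0)
    (W : Submodule K (Fin (n + 1) → K)) : ptOf v hv ∈ pts W ↔ v ∈ W := by
  exact Submodule.span_singleton_le_iff_mem v W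

theorem ptOf_eq {K : Type*} [Field K] {n : ℕ} (v : Fin (n + 1) → K) (hv : v ≠ 0)
    (P : PGPoint K n) (h : v ∈ P.1) : ptOf v hv = P := by
  apply Subtype.ext
  apply Submodule.eq_of_le_of_finrank_eq
  · simpa [ptOf] using h
  · rw [P.2]; exact (ptOf v hv).2

theorem exists_ptOf {K : Type*} [Field K] {n : ℕ} (P : PGPoint K n) :
    ∃ v, ∃ hv : v ≠ 0, ptOf v hv = P := by
  obtain ⟨v, hv, -⟩ := finrank_eq_one_iff'.mp P.2
  have hv' : (v : Fin (n + 1) → K) ≠ 0 := fun h => hv (Subtype.ext h)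
  exact ⟨v, hv', ptOf_eq _ hv' P v.2⟩

theorem exists_lift {K : Type*} [Field K] [Fintype K] {p n : ℕ} [Fact p.Prime]
    [Algebra (ZMod p) K] (hq : 2 < Fintype.card K)
    (c : PGPoint K n → ZMod p) (hc : c ∈ hypCode K p n) :
    ∃ F : (Fin (n + 1) → K) → ZMod p, Good K F ∧ ∀ v hv, F v = c (ptOf v hv) := by
  induction hc using Submodule.span_induction with
  | mem f hf =>
    obtain ⟨W, hW, rfl⟩ := hf
    have hlt : W < ⊤ := by
      rw [lt_top_iff_ne_top]
      rintro rfl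
      rw [finrank_top] at hW
      simp at hW
    obtain ⟨l, hl, hWl⟩ := Submodule.exists_le_ker_of_lt_top W hlt
    have hk : W = LinearMap.ker l := by
      apply Submodule.eq_of_le_of_finrank_eq hWl
      have := Module.Dual.finrank_ker_add_one_of_ne_zero hl
      simp at this
      omega
    refine ⟨_, good_ind hq l hl, fun v hv => ?_⟩
    rw [Set.indicator_apply, ptOf_mem_pts, hk]
    simp
  | zero => exact ⟨_, Good.zero, fun v hv => rfl⟩
  | add f g _ _ hf hg =>
    obtain ⟨F, hF, hF2⟩ := hf
    obtain ⟨G, hG, hG2⟩ := hg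
    exact ⟨_, hF.add hG, fun v hv => by simp [hF2 v hv, hG2 v hv]⟩
  | smul a f _ hf =>
    obtain ⟨F, hF, hF2⟩ := hf
    exact ⟨_, hF.const_mul a, fun v hv => by simp [hF2 v hv]⟩

theorem card_lift {K : Type*} [Field K] [Fintype K] {p n : ℕ} [Fact p.Prime]
    (c : PGPoint K n → ZMod p) (F : (Fin (n + 1) → K) → ZMod p)
    (hF : ∀ v hv, F v = c (ptOf v hv)) :
    (Wset F).card = {P : PGPoint K n | c P ≠ 0}.ncard * (Fintype.card K - 1) := by
  have : Finite (PGPoint K n) := Subtype.finite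
  have : Fintype (PGPoint K n) := Fintype.ofFinite _
  obtain ⟨P0⟩ : Nonempty (PGPoint K n) :=
    ⟨ptOf (fun _ => 1) (fun h => one_ne_zero (congrFun h 0))⟩
  rw [Set.ncard_eq_toFinset_card']
  let g : (Fin (n + 1) → K) → PGPoint K n := fun v => if hv : v ≠ 0 then ptOf v hv else P0
  have hg : ∀ v (hv : v ≠ 0), g v = ptOf v hv := fun v hv => by simp [g, hv]
  have hmaps : Set.MapsTo g (Wset F : Set (Fin (n + 1) → K))
      ({P : PGPoint K n | c P ≠ 0}.toFinset : Finset (PGPoint K n)) := by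
    intro v hv
    obtain ⟨v0, v1⟩ := mem_Wset.mp hv
    rw [hF v v0] at v1
    rw [hg v v0]
    simpa using v1
  rw [card_eq_sum_card_fiberwise hmaps, ← smul_eq_mul, ← sum_const]
  refine sum_congr rfl fun P hP => ?_
  have hcP : c P ≠ 0 := by simpa using hP
  have e : (Wset F).filter (fun v => g v = P) = (univ.filter fun v => v ∈ P.1).erase 0 := by
    ext v
    simp only [mem_filter, mem_Wset, mem_erase, mem_univ, true_and]
    constructor
    · rintro ⟨⟨v0, v1⟩, v2⟩
      refine ⟨v0, ?_⟩
      rw [hg v v0] at v2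
      rw [← v2]
      exact Submodule.mem_span_singleton_self v
    · rintro ⟨v0, v1⟩
      have h1 := ptOf_eq v v0 P v1
      refine ⟨⟨v0, ?_⟩, ?_⟩
      · rw [hF v v0, h1]; exact hcP
      · rw [hg v v0, h1]
  rw [e, card_erase_of_mem (by simp), ← Fintype.card_subtype]
  have h1 := Module.card_eq_pow_finrank (K := K) (V := P.1)
  rw [P.2, pow_one] at h1
  rw [← h1]

end Final

/-- Let `q = p^h > 2` with `p` prime and `n ≥ 2`, and let `c`
be a codeword of `C_{n-1}(n,q)` with `0 < wt(c) ≤ 2 q^{n-1}`.  Then either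
`wt(c) = θ_{n-1} = 1 + q + ⋯ + q^{n-1}` and `c = α · χ_π` for some nonzero
`α ∈ 𝔽_p` and hyperplane `π`, or `wt(c) = 2 q^{n-1}` and `c = α (χ_π - χ_ρ)`
for some nonzero `α ∈ 𝔽_p` and distinct hyperplanes `π, ρ`. -/
theorem stmt13 {K : Type*} [Field K] [Finite K] (p h n : ℕ) (hp : p.Prime)
    (hq : Nat.card K = p ^ h) (hq2 : 2 < Nat.card K) (hn : 2 ≤ n)
    (c : PGPoint K n → ZMod p) (hc : c ∈ hypCode K p n)
    (hw1 : 0 < {P : PGPoint K n | c P ≠ 0}.ncard)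
    (hw2 : {P : PGPoint K n | c P ≠ 0}.ncard ≤ 2 * Nat.card K ^ (n - 1)) :
    ({P : PGPoint K n | c P ≠ 0}.ncard = ∑ i ∈ Finset.range n, Nat.card K ^ i ∧
      ∃ α : ZMod p, α ≠ 0 ∧ ∃ W : Submodule K (Fin (n + 1) → K),
        Module.finrank K W = n ∧
        c = α • (pts W).indicator fun _ => 1) ∨
    ({P : PGPoint K n | c P ≠ 0}.ncard = 2 * Nat.card K ^ (n - 1) ∧
      ∃ α : ZMod p, α ≠ 0 ∧ ∃ W₁ W₂ : Submodule K (Fin (n + 1) → K),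
        W₁ ≠ W₂ ∧ Module.finrank K W₁ = n ∧ Module.finrank K W₂ = n ∧
        c = α • ((pts W₁).indicator (fun _ => 1) -
                 (pts W₂).indicator fun _ => 1)) := by
  have hfp : Fact p.Prime := ⟨hp⟩
  have : Fintype K := Fintype.ofFinite K
  classical
  rw [Nat.card_eq_fintype_card] at hq hq2 hw2 ⊢
  have : CharP K p := charP_of_card_eq_prime_pow hq
  let : Algebra (ZMod p) K := ZMod.algebra K p
  obtain ⟨m, rfl⟩ : ∃ m, n = m + 1 := ⟨n - 1, by omega⟩
  have hm : 1 ≤ m := by omega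
  have hpq : p ∣ Fintype.card K := by
    rw [hq]
    refine dvd_pow_self p ?_
    rintro rfl
    simp at hq
    omega
  obtain ⟨F, hF, hFc⟩ := exists_lift hq2 c hc
  have hcard := card_lift c F hFc
  have hn' : Module.finrank K (Fin (m + 1 + 1) → K) = m + 2 := by simp
  simp only [Nat.add_sub_cancel] at hw2 ⊢
  have hq1 : 0 < Fintype.card K - 1 := by omega
  have hW : (Wset F).card ≤ 2 * (Fintype.card K ^ m * (Fintype.card K - 1)) := by
    rw [hcard, ← mul_assoc]
    exact Nat.mul_le_mul_right _ hw2
  have hker : ∀ l : Module.Dual K (Fin (m + 1 + 1) → K), l ≠ 0 →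
      Module.finrank K (LinearMap.ker l) = m + 1 := by
    intro l hl
    have := Module.Dual.finrank_ker_add_one_of_ne_zero hl
    omega
  have hind : ∀ (l : Module.Dual K (Fin (m + 1 + 1) → K)) v hv,
      (pts (LinearMap.ker l)).indicator (fun _ => (1 : ZMod p)) (ptOf v hv) =
        if l v = 0 then 1 else 0 := by
    intro l v hv
    rw [Set.indicator_apply, ptOf_mem_pts]
    simp
  by_cases h0 : F 0 = 0
  · right
    obtain ⟨P, hP⟩ := Set.nonempty_of_ncard_ne_zero hw1.ne'
    obtain ⟨r, hr, rfl⟩ := exists_ptOf P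
    have hFr : F r ≠ 0 := by rw [hFc r hr]; exact hP
    obtain ⟨a, b, ha, hb, hab, hWc, hFv⟩ := hull_main hn' hF h0 hW hFr
    refine ⟨?_, F r, hFr, LinearMap.ker b, LinearMap.ker a, hab, hker b hb, hker a ha, ?_⟩
    · rw [hcard, ← mul_assoc] at hWc
      exact Nat.eq_of_mul_eq_mul_right hq1 hWc
    · funext P
      obtain ⟨v, hv, rfl⟩ := exists_ptOf P
      rw [Pi.smul_apply, Pi.sub_apply, hind, hind, ← hFc, hFv, smul_eq_mul]
  · left
    obtain ⟨l, hl, hFl⟩ := block_main hn' hm hq2 hpq hF h0 hW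
    refine ⟨?_, F 0, h0, LinearMap.ker l, hker l hl, ?_⟩
    · have e : Wset F = (Finset.univ.filter fun v => l v = 0).erase 0 := by
        ext v
        rw [mem_Wset, hFl v]
        by_cases h : l v = 0 <;> simp [h, h0]
      have h1 := card_ker hn' l hl
      have h2 : (Wset F).card = Fintype.card K ^ (m + 1) - 1 := by
        rw [e, Finset.card_erase_of_mem (by simp), ← h1]
      rw [hcard] at h2
      apply Nat.eq_of_mul_eq_mul_right hq1
      rw [h2]
      obtain ⟨q, hq⟩ : ∃ q, Fintype.card K = q + 1 :=
        ⟨_, (Nat.sub_add_cancel Fintype.card_pos).symm⟩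
      have h3 := geom_sum_mul_add q (m + 1)
      rw [hq, ← h3]
      simp
    · funext P
      obtain ⟨v, hv, rfl⟩ := exists_ptOf P
      rw [Pi.smul_apply, hind, ← hFc, hFl, smul_eq_mul]
end
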